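/- Let G be an even-hole-free graph, and let a ∈ V(G) be splendid. Suppose there is no extended near-prism contained in G such that a is an end of its cross-edge. Let 𝒮=(a,S1,…,Sk) be an indecomposable pyramid strip system with apex a, with strips Si=(Ai,Bi,Ci) for 1≤i≤k, chosen with V(𝒮) maximal. Then every vertex v ∈ N[a]\V(𝒮) has type α, α', β or γ. -/

import Mathlib

open SimpleGraph

namespace EHF

variable {V : Type*} {W : Type*} {U : Type*}

/-- The closed neighbourhood `N[a]` of a vertex `a`. -/
def closedNbhd (G : SimpleGraph V) (a : V) : Set V := insert a (G.neighborSet a)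

/-- A hole: an induced cycle of length at least four. -/
def IsHole (G : SimpleGraph V) {v : V} (c : G.Walk v v) : Prop :=
  c.IsCycle ∧ 4 ≤ c.length ∧
    ∀ x y : V, x ∈ c.support → y ∈ c.support → G.Adj x y → s(x, y) ∈ c.edges

/-- A graph is even-hole-free if it has no hole with an even number of vertices. -/
def EvenHoleFree (G : SimpleGraph V) : Prop :=
  ∀ (v : V) (c : G.Walk v v), IsHole G c → ¬ Even c.length

/-- A vertex is bisimplicial if its neighbourhood is the union of two cliques. -/
def Bisimplicial (G : SimpleGraph V) (v : V) : Prop :=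
  ∃ K₁ K₂ : Set V, G.IsClique K₁ ∧ G.IsClique K₂ ∧ G.neighborSet v = K₁ ∪ K₂

/-- `F` induces a connected subgraph of `G`. -/
def ConnectedSubset (G : SimpleGraph V) (F : Set V) : Prop :=
  F.Nonempty ∧ ∀ x ∈ F, ∀ y ∈ F, ∃ p : G.Walk x y, ∀ z ∈ p.support, z ∈ F

/-- `F` is the vertex set of a connected component of `G` minus the vertex set `S`. -/
def IsComponentOf (G : SimpleGraph V) (S F : Set V) : Prop :=
  ConnectedSubset G F ∧ Disjoint F S ∧
    ∀ x ∈ F, ∀ y : V, y ∉ S → G.Adj x y → y ∈ F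

/-- The set of vertices of `S` having a neighbour in `F`. -/
def Att (G : SimpleGraph V) (S F : Set V) : Set V :=
  {v ∈ S | ∃ x ∈ F, G.Adj v x}

/-- A cutset: the rest of the graph is the union of two nonempty sets that are
anticomplete to each other. -/
def IsCutset (G : SimpleGraph V) (C : Set V) : Prop :=
  ∃ X Y : Set V, X.Nonempty ∧ Y.Nonempty ∧ Disjoint X Y ∧ X ∪ Y = Cᶜ ∧
    ∀ x ∈ X, ∀ y ∈ Y, ¬ G.Adj x y

/-- `G` has a full star cutset with centre `v`. -/
def FullStarCutset (G : SimpleGraph V) (v : V) : Prop :=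
  IsCutset G (closedNbhd G v)

/-- A walk is induced if every edge of `G` between vertices of the walk is an
edge of the walk. -/
def InducedWalk (G : SimpleGraph V) {x y : V} (P : G.Walk x y) : Prop :=
  ∀ u v : V, u ∈ P.support → v ∈ P.support → G.Adj u v → s(u, v) ∈ P.edges

/-- A theta with ends `u,w` and constituent paths `P₁,P₂,P₃`, as an induced
subgraph of `G`. -/
def IsThetaIn (G : SimpleGraph V) (u w : V) (P₁ P₂ P₃ : G.Walk u w) : Prop :=
  u ≠ w ∧ P₁.IsPath ∧ P₂.IsPath ∧ P₃.IsPath ∧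
  2 ≤ P₁.length ∧ 2 ≤ P₂.length ∧ 2 ≤ P₃.length ∧
  (∀ v : V, v ∈ P₁.support → v ∈ P₂.support → v = u ∨ v = w) ∧
  (∀ v : V, v ∈ P₁.support → v ∈ P₃.support → v = u ∨ v = w) ∧
  (∀ v : V, v ∈ P₂.support → v ∈ P₃.support → v = u ∨ v = w) ∧
  (∀ x y : V, (x ∈ P₁.support ∨ x ∈ P₂.support ∨ x ∈ P₃.support) →
    (y ∈ P₁.support ∨ y ∈ P₂.support ∨ y ∈ P₃.support) → G.Adj x y →
    s(x, y) ∈ P₁.edges ∨ s(x, y) ∈ P₂.edges ∨ s(x, y) ∈ P₃.edges)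

/-- A near-prism with bases `{a₁,a₂,a₃}`, `{b₁,b₂,b₃}` and constituent paths
`R₁,R₂,R₃`, as an induced subgraph of `G`. -/
def IsNearPrismIn (G : SimpleGraph V) (a₁ a₂ a₃ b₁ b₂ b₃ : V)
    (R₁ : G.Walk a₁ b₁) (R₂ : G.Walk a₂ b₂) (R₃ : G.Walk a₃ b₃) : Prop :=
  G.Adj a₁ a₂ ∧ G.Adj a₁ a₃ ∧ G.Adj a₂ a₃ ∧
  G.Adj b₁ b₂ ∧ G.Adj b₁ b₃ ∧ G.Adj b₂ b₃ ∧
  (({a₁, a₂, a₃} : Set V) ∩ ({b₁, b₂, b₃} : Set V) = ({a₃} : Set V) ∩ ({b₃} : Set V)) ∧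
  R₁.IsPath ∧ R₂.IsPath ∧ R₃.IsPath ∧
  (∀ v : V, v ∈ R₁.support → v ∉ R₂.support) ∧
  (∀ v : V, v ∈ R₁.support → v ∉ R₃.support) ∧
  (∀ v : V, v ∈ R₂.support → v ∉ R₃.support) ∧
  (∀ p q : V, (p ∈ R₁.support ∨ p ∈ R₂.support ∨ p ∈ R₃.support) →
    (q ∈ R₁.support ∨ q ∈ R₂.support ∨ q ∈ R₃.support) → G.Adj p q →
    s(p, q) ∈ R₁.edges ∨ s(p, q) ∈ R₂.edges ∨ s(p, q) ∈ R₃.edges ∨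
    s(p, q) = s(a₁, a₂) ∨ s(p, q) = s(a₁, a₃) ∨ s(p, q) = s(a₂, a₃) ∨
    s(p, q) = s(b₁, b₂) ∨ s(p, q) = s(b₁, b₃) ∨ s(p, q) = s(b₂, b₃))

/-- An extended near-prism contained in `G`, with cross-edge `xy` where
`x` lies in the interior of `R₁` and `y` in the interior of `R₂`. -/
def IsExtNearPrismIn (G : SimpleGraph V) (a₁ a₂ a₃ b₁ b₂ b₃ : V)
    (R₁ : G.Walk a₁ b₁) (R₂ : G.Walk a₂ b₂) (R₃ : G.Walk a₃ b₃) (x y : V) : Prop :=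
  G.Adj a₁ a₂ ∧ G.Adj a₁ a₃ ∧ G.Adj a₂ a₃ ∧
  G.Adj b₁ b₂ ∧ G.Adj b₁ b₃ ∧ G.Adj b₂ b₃ ∧
  (({a₁, a₂, a₃} : Set V) ∩ ({b₁, b₂, b₃} : Set V) = ({a₃} : Set V) ∩ ({b₃} : Set V)) ∧
  R₁.IsPath ∧ R₂.IsPath ∧ R₃.IsPath ∧
  (∀ v : V, v ∈ R₁.support → v ∉ R₂.support) ∧
  (∀ v : V, v ∈ R₁.support → v ∉ R₃.support) ∧
  (∀ v : V, v ∈ R₂.support → v ∉ R₃.support) ∧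
  x ∈ R₁.support ∧ x ≠ a₁ ∧ x ≠ b₁ ∧
  y ∈ R₂.support ∧ y ≠ a₂ ∧ y ≠ b₂ ∧
  G.Adj x y ∧
  (∀ p q : V, (p ∈ R₁.support ∨ p ∈ R₂.support ∨ p ∈ R₃.support) →
    (q ∈ R₁.support ∨ q ∈ R₂.support ∨ q ∈ R₃.support) → G.Adj p q →
    s(p, q) ∈ R₁.edges ∨ s(p, q) ∈ R₂.edges ∨ s(p, q) ∈ R₃.edges ∨
    s(p, q) = s(a₁, a₂) ∨ s(p, q) = s(a₁, a₃) ∨ s(p, q) = s(a₂, a₃) ∨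
    s(p, q) = s(b₁, b₂) ∨ s(p, q) = s(b₁, b₃) ∨ s(p, q) = s(b₂, b₃) ∨
    s(p, q) = s(x, y))

/-- There is an extended near-prism contained in `G` such that `a` is an end of
its cross-edge. -/
def ExtNearPrismCrossEnd (G : SimpleGraph V) (a : V) : Prop :=
  ∃ (a₁ a₂ a₃ b₁ b₂ b₃ : V) (R₁ : G.Walk a₁ b₁) (R₂ : G.Walk a₂ b₂)
    (R₃ : G.Walk a₃ b₃) (y : V),
    IsExtNearPrismIn G a₁ a₂ a₃ b₁ b₂ b₃ R₁ R₂ R₃ a y ∨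
    IsExtNearPrismIn G a₁ a₂ a₃ b₁ b₂ b₃ R₁ R₂ R₃ y a

/-- `G` contains an even wheel (as an induced subgraph). -/
def HasEvenWheel (G : SimpleGraph V) : Prop :=
  ∃ (u : V) (c : G.Walk u u) (v : V), IsHole G c ∧ v ∉ c.support ∧
    3 ≤ {x : V | x ∈ c.support ∧ G.Adj v x}.ncard ∧
    ({x : V | x ∈ c.support ∧ G.Adj v x}.ncard = 3 →
      ∀ x y : V, x ∈ c.support → y ∈ c.support → G.Adj v x → G.Adj v y → ¬ G.Adj x y) ∧
    Even {x : V | x ∈ c.support ∧ G.Adj v x}.ncard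

/-- A pyramid with apex `a`, base `{b₁,b₂,b₃}` and constituent paths
`R₁,R₂,R₃`, as an induced subgraph of `G`. -/
def IsPyramidIn (G : SimpleGraph V) (a b₁ b₂ b₃ : V)
    (R₁ : G.Walk a b₁) (R₂ : G.Walk a b₂) (R₃ : G.Walk a b₃) : Prop :=
  G.Adj b₁ b₂ ∧ G.Adj b₁ b₃ ∧ G.Adj b₂ b₃ ∧
  a ≠ b₁ ∧ a ≠ b₂ ∧ a ≠ b₃ ∧
  R₁.IsPath ∧ R₂.IsPath ∧ R₃.IsPath ∧
  (∀ v : V, v ∈ R₁.support → v ∈ R₂.support → v = a) ∧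
  (∀ v : V, v ∈ R₁.support → v ∈ R₃.support → v = a) ∧
  (∀ v : V, v ∈ R₂.support → v ∈ R₃.support → v = a) ∧
  ((2 ≤ R₁.length ∧ 2 ≤ R₂.length) ∨ (2 ≤ R₁.length ∧ 2 ≤ R₃.length) ∨
    (2 ≤ R₂.length ∧ 2 ≤ R₃.length)) ∧
  (∀ p q : V, (p ∈ R₁.support ∨ p ∈ R₂.support ∨ p ∈ R₃.support) →
    (q ∈ R₁.support ∨ q ∈ R₂.support ∨ q ∈ R₃.support) → G.Adj p q →
    s(p, q) ∈ R₁.edges ∨ s(p, q) ∈ R₂.edges ∨ s(p, q) ∈ R₃.edges ∨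
    s(p, q) = s(b₁, b₂) ∨ s(p, q) = s(b₁, b₃) ∨ s(p, q) = s(b₂, b₃))

/-- A vertex `a` is splendid: `V(G)\N[a]` is connected, every neighbour of `a`
has a neighbour in `V(G)\N[a]`, and there is no short pyramid with apex `a`. -/
def Splendid (G : SimpleGraph V) (a : V) : Prop :=
  ConnectedSubset G ((closedNbhd G a)ᶜ) ∧
  (∀ v : V, G.Adj a v → ∃ w : V, w ∉ closedNbhd G a ∧ G.Adj v w) ∧
  ¬ ∃ (b₁ b₂ b₃ : V) (R₁ : G.Walk a b₁) (R₂ : G.Walk a b₂) (R₃ : G.Walk a b₃),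
      IsPyramidIn G a b₁ b₂ b₃ R₁ R₂ R₃ ∧
      (R₁.length = 1 ∨ R₂.length = 1 ∨ R₃.length = 1)

/-- A rung of the strip `(A,B,C)`. -/
def IsRung (G : SimpleGraph V) (A B C : Set V) {x y : V} (P : G.Walk x y) : Prop :=
  P.IsPath ∧ x ∈ A ∧ y ∈ B ∧
  (∀ v ∈ P.support, v ≠ x → v ≠ y → v ∈ C) ∧
  (x ≠ y → x ∉ B ∧ y ∉ A) ∧
  InducedWalk G P

/-- A strip `(A,B,C)`: `A,B` nonempty and disjoint from `C`, and every vertex of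
`A∪B∪C` lies on a rung. -/
def IsStrip (G : SimpleGraph V) (A B C : Set V) : Prop :=
  A.Nonempty ∧ B.Nonempty ∧ Disjoint A C ∧ Disjoint B C ∧
  ∀ v ∈ A ∪ B ∪ C, ∃ (x y : V) (P : G.Walk x y), IsRung G A B C P ∧ v ∈ P.support

/-- A `J`-strip system in `G`. -/
structure StripSystem (G : SimpleGraph V) (J : SimpleGraph W) where
  ME : W → W → Set V
  MV : W → Set V
  me_symm : ∀ u v : W, ME u v = ME v u
  me_disj : ∀ u v w x : W, J.Adj u v → J.Adj w x → s(u, v) ≠ s(w, x) →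
    Disjoint (ME u v) (ME w x)
  mv_sub : ∀ u : W, MV u ⊆ ⋃ (v : W), ⋃ (_ : J.Adj u v), ME u v
  strip : ∀ u v : W, J.Adj u v →
    IsStrip G (ME u v ∩ MV u) (ME u v ∩ MV v) (ME u v \ (MV u ∪ MV v))
  far : ∀ u v w x : W, J.Adj u v → J.Adj w x → u ≠ w → u ≠ x → v ≠ w → v ≠ x →
    ∀ p ∈ ME u v, ∀ q ∈ ME w x, ¬ G.Adj p q
  near : ∀ u v w : W, J.Adj u v → J.Adj u w → v ≠ w →
    ∀ p ∈ ME u v, ∀ q ∈ ME u w, (G.Adj p q ↔ p ∈ MV u ∧ q ∈ MV u)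

/-- `V(M)`: the union of the sets `M_e` over the edges of `J`. -/
def VM {G : SimpleGraph V} {J : SimpleGraph W} (S : StripSystem G J) : Set V :=
  ⋃ (u : W), ⋃ (v : W), ⋃ (_ : J.Adj u v), S.ME u v

/-- A leaf of a graph: a vertex of degree exactly one. -/
def IsLeaf (J : SimpleGraph W) (u : W) : Prop := (J.neighborSet u).ncard = 1

/-- `ab` is a cross-edge for the strip system `S` with partition `(α,β)` of the
leaves of `J`. -/
def IsCrossEdge {G : SimpleGraph V} {J : SimpleGraph W} (S : StripSystem G J)
    (a b : V) (α β : Set W) : Prop :=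
  G.Adj a b ∧
  α ∪ β = {u : W | IsLeaf J u} ∧ Disjoint α β ∧
  (∀ u : W, (J.neighborSet u).ncard ≠ 2) ∧
  3 ≤ Nat.card W ∧
  (∀ u u₁ u₂ : W, u₁ ∈ α → u₂ ∈ α → J.Adj u u₁ → J.Adj u u₂ → u₁ = u₂) ∧
  (∀ u u₁ u₂ : W, u₁ ∈ β → u₂ ∈ β → J.Adj u u₁ → J.Adj u u₂ → u₁ = u₂) ∧
  (∀ u v : W, J.Adj u v → a ∉ S.ME u v ∧ b ∉ S.ME u v) ∧
  (∀ x ∈ VM S, (G.Adj a x ↔ ∃ u ∈ α, x ∈ S.MV u)) ∧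
  (∀ x ∈ VM S, (G.Adj b x ↔ ∃ u ∈ β, x ∈ S.MV u))

/-- A local subset of `V(M)∪{a,b}`. -/
def IsLocal {G : SimpleGraph V} {J : SimpleGraph W} (S : StripSystem G J)
    (a b : V) (α β : Set W) (X : Set V) : Prop :=
  (∃ u v : W, J.Adj u v ∧ X ⊆ S.ME u v) ∨
  (∃ u : W, X ⊆ S.MV u) ∨
  (a ∈ X ∧ b ∉ X ∧ ∃ u ∈ α, X \ {a} ⊆ S.MV u) ∨
  (b ∈ X ∧ a ∉ X ∧ ∃ u ∈ β, X \ {b} ⊆ S.MV u)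

/-- A branch-vertex of a tree: a vertex of degree different from two. -/
def BranchVertex (T : SimpleGraph U) (u : U) : Prop := (T.neighborSet u).ncard ≠ 2

/-- `u` and `v` are distinct branch-vertices joined by a branch of `T`. -/
def JoinedByBranch (T : SimpleGraph U) (u v : U) : Prop :=
  u ≠ v ∧ BranchVertex T u ∧ BranchVertex T v ∧
    ∃ p : T.Walk u v, p.IsPath ∧
      ∀ w ∈ p.support, w ≠ u → w ≠ v → (T.neighborSet w).ncard = 2

/-- The shape of a tree `T`: the graph on its branch-vertices, two being
adjacent when joined by a branch. -/
def Shape (T : SimpleGraph U) : SimpleGraph {u : U // BranchVertex T u} :=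
  SimpleGraph.fromRel (fun u v => JoinedByBranch T u.1 v.1)

/-- `y` is reachable from `x` in `T` by a walk avoiding `v`. -/
def ReachAvoiding (T : SimpleGraph U) (v x y : U) : Prop :=
  ∃ p : T.Walk x y, v ∉ p.support

/-- The component of `x` in `T` minus `v` contains no vertex of `A`. -/
def MissesSet (T : SimpleGraph U) (v : U) (A : Set U) (x : U) : Prop :=
  ∀ z : U, ReachAvoiding T v x z → z ∉ A

/-- `G` contains an induced extended tree line-graph `H(T)` with cross-edge
`ab`, via the injection `φ` of the edges of `T` into `V(G)`, where `(A',B')`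
is the bipartition of the tree `T`. -/
def ExtTreeLineGraphIn (G : SimpleGraph V) (T : SimpleGraph U)
    (A' B' : Set U) (a b : V) (φ : Sym2 U → V) : Prop :=
  T.IsTree ∧
  A' ∪ B' = Set.univ ∧ Disjoint A' B' ∧
  (∀ u v : U, T.Adj u v → (u ∈ A' ↔ v ∈ B')) ∧
  3 ≤ {u : U | IsLeaf T u}.ncard ∧
  (∀ v x y : U, x ≠ v → y ≠ v → MissesSet T v A' x → MissesSet T v A' y →
    ReachAvoiding T v x y) ∧
  (∀ v x y : U, x ≠ v → y ≠ v → MissesSet T v B' x → MissesSet T v B' y →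
    ReachAvoiding T v x y) ∧
  G.Adj a b ∧
  Set.InjOn φ T.edgeSet ∧
  (∀ e ∈ T.edgeSet, φ e ≠ a ∧ φ e ≠ b) ∧
  (∀ e ∈ T.edgeSet, ∀ f ∈ T.edgeSet, e ≠ f →
    (G.Adj (φ e) (φ f) ↔ ∃ u : U, u ∈ e ∧ u ∈ f)) ∧
  (∀ e ∈ T.edgeSet, (G.Adj a (φ e) ↔ ∃ u : U, u ∈ e ∧ IsLeaf T u ∧ u ∈ A')) ∧
  (∀ e ∈ T.edgeSet, (G.Adj b (φ e) ↔ ∃ u : U, u ∈ e ∧ IsLeaf T u ∧ u ∈ B'))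

/-- `(J, M)` is optimal for the edge `ab`: `G` contains an induced extended tree
line-graph with cross-edge `ab`; among all such, the shape `J` has as many edges
as possible; and the `J`-strip system `S` has cross-edge `ab` with partition
`(α,β)` and `V(M)` maximal. -/
def OptimalFor {G : SimpleGraph V} {J : SimpleGraph W} (S : StripSystem G J)
    (a b : V) (α β : Set W) : Prop :=
  (∃ (n : ℕ) (T : SimpleGraph (Fin n)) (A' B' : Set (Fin n)) (φ : Sym2 (Fin n) → V),
      ExtTreeLineGraphIn G T A' B' a b φ ∧ Nonempty (J ≃g Shape T)) ∧
  (∀ (n : ℕ) (T : SimpleGraph (Fin n)) (A' B' : Set (Fin n)) (φ : Sym2 (Fin n) → V),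
      ExtTreeLineGraphIn G T A' B' a b φ →
      (Shape T).edgeSet.ncard ≤ J.edgeSet.ncard) ∧
  IsCrossEdge S a b α β ∧
  (∀ (S' : StripSystem G J) (α' β' : Set W), IsCrossEdge S' a b α' β' →
      VM S ⊆ VM S' → VM S' = VM S)

/-- There is a path from `y` to `VMset \ N[a]` containing no neighbours of `a`
except `y`. -/
def ExternalFrom (G : SimpleGraph V) (VMset : Set V) (a y : V) : Prop :=
  ∃ (z : V) (P : G.Walk y z), P.IsPath ∧ z ∈ VMset ∧ z ∉ closedNbhd G a ∧
    ∀ v ∈ P.support, G.Adj a v → v = y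

/-- A major vertex: a common neighbour of `a,b` that is both `a`-external and
`b`-external. -/
def MajorVertex {G : SimpleGraph V} {J : SimpleGraph W} (S : StripSystem G J)
    (a b : V) (y : V) : Prop :=
  G.Adj a y ∧ G.Adj b y ∧ ExternalFrom G (VM S) a y ∧ ExternalFrom G (VM S) b y

/-- The vertex set of a pyramid strip system. -/
def PSSVerts (a : V) {k : ℕ} (A B C : Fin k → Set V) : Set V :=
  insert a (⋃ i, A i ∪ B i ∪ C i)

/-- A pyramid strip system with apex `a` and proper strips `(A i, B i, C i)`. -/
def IsPyramidStripSystem (G : SimpleGraph V) (a : V) {k : ℕ}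
    (A B C : Fin k → Set V) : Prop :=
  3 ≤ k ∧
  (∀ i, IsStrip G (A i) (B i) (C i)) ∧
  (∀ i, Disjoint (A i) (B i)) ∧
  (∀ i j, i ≠ j → Disjoint (A i ∪ B i ∪ C i) (A j ∪ B j ∪ C j)) ∧
  (∀ i j, i ≠ j → ∀ p ∈ A i ∪ B i ∪ C i, ∀ q ∈ A j ∪ B j ∪ C j,
      (G.Adj p q ↔ p ∈ B i ∧ q ∈ B j)) ∧
  (∀ i, a ∉ A i ∪ B i ∪ C i) ∧
  (∀ i, ∀ p ∈ A i ∪ B i ∪ C i, (G.Adj a p ↔ p ∈ A i))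

/-- `D i`: the union of the vertex sets of all components `F` of
`G \ (V(𝒮) ∪ N[a])` having a neighbour in `A i ∪ C i`. -/
def PSSD (G : SimpleGraph V) (a : V) {k : ℕ} (A B C : Fin k → Set V)
    (i : Fin k) : Set V :=
  ⋃₀ {F : Set V | IsComponentOf G (PSSVerts a A B C ∪ closedNbhd G a) F ∧
      ∃ v ∈ A i ∪ C i, ∃ x ∈ F, G.Adj v x}

def TypeAlpha (G : SimpleGraph V) {k : ℕ} (A B C : Fin k → Set V) (v : V) : Prop :=
  ∀ i : Fin k, (∃ p ∈ B i ∪ C i, G.Adj v p) ∨ ∀ p ∈ A i, G.Adj v p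

def TypeAlpha' (G : SimpleGraph V) (a : V) {k : ℕ} (A B C : Fin k → Set V)
    (v : V) : Prop :=
  ∃ i : Fin k, (∃ x ∈ PSSD G a A B C i, G.Adj v x) ∧
    (∀ p ∈ B i ∪ C i, ¬ G.Adj v p) ∧
    ∀ j : Fin k, j ≠ i →
      (∀ p ∈ A j, G.Adj v p) ∧ ∀ p ∈ B j ∪ C j ∪ PSSD G a A B C j, ¬ G.Adj v p

def TypeBeta (G : SimpleGraph V) {k : ℕ} (A B C : Fin k → Set V) (v : V) : Prop :=
  ∃ i : Fin k, (∀ p ∈ A i ∪ B i ∪ C i, ¬ G.Adj v p) ∧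
    ∀ j : Fin k, j ≠ i → ∃ p ∈ B j ∪ C j, G.Adj v p

def TypeGamma (G : SimpleGraph V) (a : V) {k : ℕ} (A B C : Fin k → Set V)
    (v : V) : Prop :=
  ∃ (i : Fin k) (q : V) (Q : G.Walk v q), Q.IsPath ∧ InducedWalk G Q ∧
    (∀ w ∈ Q.support, w ≠ v → w ∉ PSSVerts a A B C ∪ closedNbhd G a) ∧
    (∃ p ∈ ⋃ j, B j, G.Adj q p) ∧
    ((∀ p ∈ (⋃ j, B j) \ B i, G.Adj q p) ∨ ∀ p ∈ (⋃ j, B j) \ B i, ¬ G.Adj q p) ∧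
    (∀ j : Fin k, j ≠ i → ∀ p ∈ A j, G.Adj v p) ∧
    (∀ j : Fin k, ∀ p ∈ B j ∪ C j ∪ PSSD G a A B C j, ¬ G.Adj v p) ∧
    ∀ w ∈ Q.support, w ≠ v → ∀ p ∈ PSSVerts a A B C, G.Adj w p →
      w = q ∧ p ∈ ⋃ j, B j

/-- A backdoor for `z`, relative to the strip `(A,B,C)` and the set `D`. -/
def Backdoor (G : SimpleGraph V) (A B C D : Set V) (z : V) : Prop :=
  ∃ (b' : V) (R : G.Walk z b'), R.IsPath ∧ InducedWalk G R ∧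
    (∀ w ∈ R.support, w ≠ z → w ≠ b' → ∀ p ∈ (A ∪ B ∪ C) ∪ D, ¬ G.Adj w p) ∧
    (∀ p ∈ B, G.Adj b' p) ∧ ∀ p ∈ A ∪ C ∪ D, ¬ G.Adj b' p

/-- `S` is the vertex set of an induced path from `x` to `y` with `n` vertices. -/
inductive Seg (G : SimpleGraph V) : V → V → Set V → ℕ → Prop
  | single (x : V) : Seg G x x {x} 1
  | cons {x y z : V} {S T : Set V} {n : ℕ} (hxy : G.Adj x y) (s : Seg G y z S n)
      (hx : ∀ w ∈ S, w ≠ x ∧ (G.Adj x w → w = y)) (hT : T = insert x S) : Seg G x z T (n + 1)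

/-- `S` and `T` are disjoint and `yx` is the only edge between them. -/
def Link (G : SimpleGraph V) (S T : Set V) (y x : V) : Prop :=
  G.Adj y x ∧ ∀ p ∈ S, ∀ q ∈ T, p ≠ q ∧ (G.Adj p q → p = y ∧ q = x)

/-- `S` and `T` are disjoint and anticomplete. -/
def AC (G : SimpleGraph V) (S T : Set V) : Prop :=
  ∀ p ∈ S, ∀ q ∈ T, p ≠ q ∧ ¬ G.Adj p q

section Basic

variable {G : SimpleGraph V}

theorem link_single {x y : V} (h : G.Adj y x) : Link G {y} {x} y x := by
  refine ⟨h, ?_⟩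
  rintro _ rfl _ rfl
  exact ⟨h.ne, fun _ => ⟨rfl, rfl⟩⟩

theorem Link.symm {S T : Set V} {x y : V} (h : Link G S T y x) : Link G T S x y :=
  ⟨h.1.symm, fun p hp q hq => ⟨fun e => (h.2 q hq p hp).1 e.symm,
    fun e => ((h.2 q hq p hp).2 e.symm).symm⟩⟩

theorem AC.symm {S T : Set V} (h : AC G S T) : AC G T S :=
  fun p hp q hq => ⟨fun e => (h q hq p hp).1 e.symm, fun e => (h q hq p hp).2 e.symm⟩

theorem Link.mono {S T S' T' : Set V} {x y : V} (h : Link G S T y x) (hS : S' ⊆ S)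
    (hT : T' ⊆ T) : Link G S' T' y x :=
  ⟨h.1, fun p hp q hq => h.2 p (hS hp) q (hT hq)⟩

theorem AC.mono {S T S' T' : Set V} (h : AC G S T) (hS : S' ⊆ S) (hT : T' ⊆ T) : AC G S' T' :=
  fun p hp q hq => h p (hS hp) q (hT hq)

theorem Link.ac_left {S T S' T' : Set V} {x y : V} (h : Link G S T y x) (hS : S' ⊆ S)
    (hT : T' ⊆ T) (hy : y ∉ S') : AC G S' T' := fun p hp q hq =>
  ⟨(h.2 p (hS hp) q (hT hq)).1, fun e => hy (((h.2 p (hS hp) q (hT hq)).2 e).1 ▸ hp)⟩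

theorem Link.ac_right {S T S' T' : Set V} {x y : V} (h : Link G S T y x) (hS : S' ⊆ S)
    (hT : T' ⊆ T) (hx : x ∉ T') : AC G S' T' := fun p hp q hq =>
  ⟨(h.2 p (hS hp) q (hT hq)).1, fun e => hx (((h.2 p (hS hp) q (hT hq)).2 e).2 ▸ hq)⟩

theorem AC.union_left {S S' T : Set V} (h : AC G S T) (h' : AC G S' T) : AC G (S ∪ S') T :=
  fun p hp q hq => hp.elim (fun hp => h p hp q hq) (fun hp => h' p hp q hq)

theorem Link.union_left {S S' T : Set V} {x y : V} (h : Link G S T y x) (h' : AC G S' T) :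
    Link G (S ∪ S') T y x :=
  ⟨h.1, fun p hp q hq => hp.elim (fun hp => h.2 p hp q hq)
    (fun hp => ⟨(h' p hp q hq).1, fun e => ((h' p hp q hq).2 e).elim⟩)⟩

theorem Link.union_left' {S S' T : Set V} {x y : V} (h' : AC G S T) (h : Link G S' T y x) :
    Link G (S ∪ S') T y x := Set.union_comm S' S ▸ h.union_left h'

theorem Link.union_right {S T T' : Set V} {x y : V} (h : Link G S T y x) (h' : AC G S T') :
    Link G S (T ∪ T') y x := (h.symm.union_left h'.symm).symm

namespace Seg

theorem left_mem {x y : V} {S : Set V} {n : ℕ} (s : Seg G x y S n) : x ∈ S := by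
  cases s with
  | single => simp
  | cons _ _ _ hT => simp [hT]

theorem right_mem {x y : V} {S : Set V} {n : ℕ} (s : Seg G x y S n) : y ∈ S := by
  induction s with
  | single => simp
  | cons _ _ _ hT ih => simp [hT, ih]

theorem pos {x y : V} {S : Set V} {n : ℕ} (s : Seg G x y S n) : 1 ≤ n := by
  cases s <;> omega

theorem two_le {x y : V} {S : Set V} {n : ℕ} (s : Seg G x y S n) (h : x ≠ y) : 2 ≤ n := by
  cases s with
  | single => exact (h rfl).elim
  | cons _ s _ _ => have := s.pos; omega

theorem eq_of_ends {x y : V} {S : Set V} {n : ℕ} (s : Seg G x y S n) (h : x = y) :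
    n = 1 ∧ S = {x} := by
  cases s with
  | single => exact ⟨rfl, rfl⟩
  | cons _ s hx _ => exact ((hx _ s.right_mem).1 h.symm).elim

theorem append {x y z w : V} {S T : Set V} {n m : ℕ} (s : Seg G x y S n) (t : Seg G z w T m)
    (h : Link G S T y z) : Seg G x w (S ∪ T) (n + m) := by
  induction s with
  | single x =>
    rw [Nat.add_comm]
    exact .cons h.1 t (fun u hu => ⟨((h.2 x rfl u hu).1).symm, fun e => ((h.2 x rfl u hu).2 e).2⟩)
      (by rw [Set.singleton_union])
  | @cons x y z' S T' n hxy s hx hT ih =>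
    subst hT
    have h1 := ih (h.mono (Set.subset_insert _ _) subset_rfl)
    have h2 : Seg G x w (insert x S ∪ T) ((n + m) + 1) := by
      refine .cons hxy h1 ?_ (by rw [Set.insert_union])
      rintro u (hu | hu)
      · exact hx u hu
      · have := h.2 x (by simp) u hu
        refine ⟨this.1.symm, fun e => ?_⟩
        exact ((hx _ s.right_mem).1 (this.2 e).1.symm).elim
    rwa [show n + 1 + m = n + m + 1 by omega]

theorem reverse {x y : V} {S : Set V} {n : ℕ} (s : Seg G x y S n) : Seg G y x S n := by
  induction s with
  | single x => exact .single x
  | @cons x y z S T n hxy s hx hT ih =>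
    subst hT
    have := ih.append (.single x) (z := x) ⟨hxy.symm, by
      rintro p hp q rfl
      exact ⟨(hx p hp).1, fun e => ⟨(hx p hp).2 e.symm, rfl⟩⟩⟩
    rwa [Set.union_singleton] at this

theorem toWalk {x y : V} {S : Set V} {n : ℕ} (s : Seg G x y S n) :
    ∃ p : G.Walk x y, p.IsPath ∧ (∀ z, z ∈ p.support ↔ z ∈ S) ∧ p.length + 1 = n ∧
      InducedWalk G p := by
  induction s with
  | single x =>
    refine ⟨.nil, by simp, by simp, by simp, ?_⟩
    intro u v hu hv h
    simp only [Walk.support_nil, List.mem_singleton] at hu hv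
    subst hu; subst hv; exact (G.irrefl h).elim
  | @cons x y z S T n hxy s hx hT ih =>
    subst hT
    obtain ⟨p, hp, hs, hl, hi⟩ := ih
    refine ⟨.cons hxy p, ?_, ?_, by simp [hl], ?_⟩
    · rw [Walk.cons_isPath_iff]
      exact ⟨hp, fun h => (hx x ((hs x).1 h)).1 rfl⟩
    · intro w; simp [hs]
    · intro u v hu hv h
      simp only [Walk.support_cons, List.mem_cons] at hu hv
      simp only [Walk.edges_cons, List.mem_cons]
      rcases hu with rfl | hu <;> rcases hv with rfl | hv
      · exact (G.irrefl h).elim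
      · left; rw [(hx v ((hs v).1 hv)).2 h]
      · left; rw [(hx u ((hs u).1 hu)).2 h.symm, Sym2.eq_swap]
      · exact Or.inr (hi u v hu hv h)

theorem ofWalk {x y : V} (p : G.Walk x y) (hp : p.IsPath) (hi : InducedWalk G p) :
    Seg G x y {z | z ∈ p.support} (p.length + 1) := by
  induction p with
  | nil => simpa using Seg.single _
  | @cons u v w h p ih =>
    rw [Walk.cons_isPath_iff] at hp
    have hi' : InducedWalk G p := by
      intro a b ha hb hab
      have := hi a b (by simp [ha]) (by simp [hb]) hab
      simp only [Walk.edges_cons, List.mem_cons] at this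
      rcases this with h' | h'
      · rw [Sym2.eq_iff] at h'
        rcases h' with ⟨rfl, rfl⟩ | ⟨rfl, rfl⟩
        · exact (hp.2 ha).elim
        · exact (hp.2 hb).elim
      · exact h'
    refine .cons h (ih hp.1 hi') ?_ (by ext z; simp)
    intro z hz
    have hzu : z ≠ u := fun e => hp.2 (e ▸ hz)
    refine ⟨hzu, fun e => ?_⟩
    have := hi u z (by simp) (by simpa using Or.inr hz) e
    simp only [Walk.edges_cons, List.mem_cons] at this
    rcases this with h' | h'
    · rw [Sym2.eq_iff] at h'
      rcases h' with ⟨-, rfl⟩ | ⟨rfl, -⟩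
      · rfl
      · exact (G.irrefl h).elim
    · exact (hp.2 (Walk.fst_mem_support_of_mem_edges _ h')).elim

theorem split {x y w : V} {S : Set V} {n : ℕ} (s : Seg G x y S n) (hw : w ∈ S) :
    ∃ U W m l, Seg G x w U m ∧ Seg G w y W l ∧ U ∪ W = S ∧ m + l = n + 1 ∧
      (∀ p ∈ U, ∀ q ∈ W, (p = q → p = w) ∧ (G.Adj p q → p = w ∨ q = w)) := by
  induction s with
  | single x =>
    obtain rfl : w = x := hw
    exact ⟨{w}, {w}, 1, 1, .single w, .single w, by simp, rfl, by
      rintro p rfl q rfl; simp⟩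
  | @cons x y z S T n hxy s hx hT ih =>
    subst hT
    by_cases hwx : w = x
    · subst hwx
      refine ⟨{w}, insert w S, 1, n + 1, .single w, .cons hxy s hx rfl, by simp, by omega, ?_⟩
      rintro p rfl q hq; simp
    · obtain ⟨U, W, m, l, s1, s2, hU, hm, hUW⟩ := ih (hw.resolve_left hwx)
      have hUS : U ⊆ S := hU ▸ Set.subset_union_left
      have hWS : W ⊆ S := hU ▸ Set.subset_union_right
      refine ⟨insert x U, W, m + 1, l, .cons hxy s1 (fun w hw => hx w (hUS hw)) rfl, s2,
        by rw [Set.insert_union, hU], by omega, ?_⟩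
      rintro p (rfl | hp) q hq
      · refine ⟨fun e => ((hx q (hWS hq)).1 e.symm).elim, fun e => ?_⟩
        have hqy := (hx q (hWS hq)).2 e
        exact Or.inr ((hUW y s1.left_mem q hq).1 hqy.symm ▸ hqy)
      · exact hUW p hp q hq

theorem exists_first {x y : V} {S : Set V} {n : ℕ} (s : Seg G x y S n) (N : V → Prop)
    (hN : ∃ w ∈ S, N w) :
    ∃ w U W m l, Seg G x w U m ∧ Seg G w y W l ∧ U ∪ W = S ∧ m + l = n + 1 ∧
      (∀ p ∈ U, ∀ q ∈ W, (p = q → p = w) ∧ (G.Adj p q → p = w ∨ q = w)) ∧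
      N w ∧ ∀ p ∈ U, N p → p = w := by
  induction s with
  | single x =>
    obtain ⟨w, rfl, hw⟩ := hN
    exact ⟨w, {w}, {w}, 1, 1, .single w, .single w, by simp, rfl, by
      rintro p rfl q rfl; simp, hw, by rintro p rfl _; rfl⟩
  | @cons x y z S T n hxy s hx hT ih =>
    subst hT
    by_cases hNx : N x
    · refine ⟨x, {x}, insert x S, 1, n + 1, .single x, .cons hxy s hx rfl, by simp, by omega, ?_,
        hNx, by rintro p rfl _; rfl⟩
      rintro p rfl q hq; simp
    · obtain ⟨w, hw, hNw⟩ := hN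
      have hwS : w ∈ S := hw.resolve_left (fun e => hNx (e ▸ hNw))
      obtain ⟨w, U, W, m, l, s1, s2, hU, hm, hUW, h1, h2⟩ := ih ⟨w, hwS, hNw⟩
      have hUS : U ⊆ S := hU ▸ Set.subset_union_left
      have hWS : W ⊆ S := hU ▸ Set.subset_union_right
      refine ⟨w, insert x U, W, m + 1, l, .cons hxy s1 (fun w hw => hx w (hUS hw)) rfl, s2,
        by rw [Set.insert_union, hU], by omega, ?_, h1, ?_⟩
      · rintro p (rfl | hp) q hq
        · refine ⟨fun e => ((hx q (hWS hq)).1 e.symm).elim, fun e => ?_⟩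
          have hqy := (hx q (hWS hq)).2 e
          exact Or.inr ((hUW y s1.left_mem q hq).1 hqy.symm ▸ hqy)
        · exact hUW p hp q hq
      · rintro p (rfl | hp) hp'
        · exact (hNx hp').elim
        · exact h2 p hp hp'

theorem eq_two_of_adj {x y : V} {S : Set V} {n : ℕ} (s : Seg G x y S n) (h : G.Adj x y) :
    n = 2 ∧ S = {x, y} := by
  cases s with
  | single => exact (G.irrefl h).elim
  | cons _ s hx hT =>
    have := s.eq_of_ends ((hx y s.right_mem).2 h).symm
    refine ⟨by omega, ?_⟩
    rw [hT, this.2, (hx y s.right_mem).2 h]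

/-- The parts of an induced path up to its first, and from its last, vertex in `N`. -/
theorem exists_first_last {x y : V} {S : Set V} {n : ℕ} (s : Seg G x y S n) (N : V → Prop)
    (hN : ∃ w ∈ S, N w) :
    ∃ y₁ y₂ U W m l, Seg G x y₁ U m ∧ Seg G y₂ y W l ∧ U ⊆ S ∧ W ⊆ S ∧ N y₁ ∧ N y₂ ∧
      (∀ u ∈ U, N u → u = y₁) ∧ (∀ u ∈ W, N u → u = y₂) ∧
      (y ∈ U → y = y₁ ∧ y₁ = y₂) ∧ (x ∈ W → x = y₁ ∧ y₁ = y₂) ∧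
      ((y₁ = y₂ ∧ m + l = n + 1 ∧ ∀ u ∈ S, N u → u = y₁) ∨
        (y₁ ≠ y₂ ∧ Link G U W y₁ y₂ ∧ m + l = n) ∨ (y₁ ≠ y₂ ∧ AC G U W)) := by
  obtain ⟨y₁, U, W', m, l', s1, s2, hU, hml, hUW, hN1, hfst⟩ := s.exists_first N hN
  obtain ⟨y₂, W, M, l, k, s3, s4, hW, hlk, hWM, hN2, hlst⟩ :=
    s2.reverse.exists_first N ⟨y₁, s2.left_mem, hN1⟩
  have hUS : U ⊆ S := hU ▸ Set.subset_union_left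
  have hWS' : W' ⊆ S := hU ▸ Set.subset_union_right
  have hWW : W ⊆ W' := hW ▸ Set.subset_union_left
  have hy1M := s4.right_mem
  refine ⟨y₁, y₂, U, W, m, l, s1, s3.reverse, hUS, hWW.trans hWS', hN1, hN2, hfst, hlst, ?_, ?_, ?_⟩
  · intro hy
    have := (hUW y hy y s2.right_mem).1 rfl
    subst this
    exact ⟨rfl, (hWM y s3.left_mem y hy1M).1 rfl⟩
  · intro hx
    have := (hUW x s1.left_mem x (hWW hx)).1 rfl
    subst this
    exact ⟨rfl, (hWM x hx x hy1M).1 rfl⟩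
  · by_cases h12 : y₁ = y₂
    · left
      obtain ⟨h1, h2⟩ := s4.eq_of_ends h12.symm
      refine ⟨h12, by omega, fun u hu hNu => ?_⟩
      rw [← hU] at hu
      rcases hu with hu | hu
      · exact hfst u hu hNu
      · rw [← hW, h2] at hu
        rcases hu with hu | hu
        · exact (hlst u hu hNu).trans h12.symm
        · exact hu.trans h12.symm
    · right
      have hy1W : y₁ ∉ W := fun h => h12 ((hWM _ h _ hy1M).1 rfl)
      have key : ∀ p ∈ U, ∀ q ∈ W, p ≠ q ∧ (G.Adj p q → p = y₁ ∧ q = y₂) := by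
        intro p hp q hq
        refine ⟨?_, fun e => ?_⟩
        · rintro rfl
          exact hy1W ((hUW p hp p (hWW hq)).1 rfl ▸ hq)
        · rcases (hUW p hp q (hWW hq)).2 e with rfl | rfl
          · refine ⟨rfl, ?_⟩
            rcases (hWM q hq p hy1M).2 e.symm with h | h
            · exact h
            · exact (h12 h).elim
          · exact (hy1W hq).elim
      by_cases hadj : G.Adj y₁ y₂
      · left
        obtain ⟨h1, h2⟩ := s4.eq_two_of_adj hadj.symm
        exact ⟨h12, ⟨hadj, key⟩, by omega⟩
      · right
        refine ⟨h12, fun p hp q hq => ⟨(key p hp q hq).1, fun e => hadj ?_⟩⟩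
        obtain ⟨rfl, rfl⟩ := (key p hp q hq).2 e
        exact e

end Seg

/-- `x` and `y` are joined by a walk inside `F`. -/
def Joined (G : SimpleGraph V) (F : Set V) (x y : V) : Prop :=
  ∃ p : G.Walk x y, ∀ z ∈ p.support, z ∈ F

theorem Joined.refl {F : Set V} {x : V} (h : x ∈ F) : Joined G F x x :=
  ⟨.nil, by simpa using h⟩

theorem Joined.symm {F : Set V} {x y : V} (h : Joined G F x y) : Joined G F y x := by
  obtain ⟨p, hp⟩ := h
  exact ⟨p.reverse, by simpa using hp⟩

theorem Joined.trans {F : Set V} {x y z : V} (h : Joined G F x y) (h' : Joined G F y z) :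
    Joined G F x z := by
  obtain ⟨p, hp⟩ := h
  obtain ⟨q, hq⟩ := h'
  refine ⟨p.append q, fun w hw => ?_⟩
  rw [Walk.mem_support_append_iff] at hw
  exact hw.elim (hp w) (hq w)

theorem Joined.mono {F F' : Set V} {x y : V} (h : Joined G F x y) (hF : F ⊆ F') :
    Joined G F' x y := by
  obtain ⟨p, hp⟩ := h
  exact ⟨p, fun z hz => hF (hp z hz)⟩

theorem Joined.of_adj {F : Set V} {x y : V} (hx : x ∈ F) (hy : y ∈ F) (h : G.Adj x y) :
    Joined G F x y :=
  ⟨h.toWalk, by simp [hx, hy]⟩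

theorem Joined.right_mem {F : Set V} {x y : V} (h : Joined G F x y) : y ∈ F := by
  obtain ⟨p, hp⟩ := h
  exact hp _ p.end_mem_support

theorem Joined.left_mem {F : Set V} {x y : V} (h : Joined G F x y) : x ∈ F := h.symm.right_mem

/-- A property preserved along edges inside `F` is preserved by `Joined`. -/
theorem Joined.induct {F : Set V} {x y : V} (h : Joined G F x y) (P : V → Prop)
    (hP : ∀ u ∈ F, ∀ w ∈ F, G.Adj u w → P u → P w) (hx : P x) : P y := by
  obtain ⟨p, hp⟩ := h
  induction p with
  | nil => exact hx
  | cons e p ih =>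
    simp only [Walk.support_cons, List.mem_cons, forall_eq_or_imp] at hp
    exact ih (hP _ hp.1 _ (hp.2 _ p.start_mem_support) e hx) (fun z hz => hp.2 z hz)

theorem Seg.joined {x y u : V} {S : Set V} {n : ℕ} (s : Seg G x y S n) (hu : u ∈ S) :
    Joined G S x u := by
  obtain ⟨U, W, m, l, h1, -, hU, -⟩ := s.split hu
  obtain ⟨p, -, hp, -⟩ := h1.toWalk
  exact ⟨p, fun z hz => hU ▸ Or.inl ((hp z).1 hz)⟩

theorem Joined.exists_seg {F : Set V} {x y : V} (h : Joined G F x y) :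
    ∃ S n, Seg G x y S n ∧ S ⊆ F := by
  obtain ⟨p, hp⟩ := h
  induction p with
  | @nil u => exact ⟨{u}, 1, .single u, by simpa using hp⟩
  | @cons x z y e p ih =>
    simp only [Walk.support_cons, List.mem_cons, forall_eq_or_imp] at hp
    obtain ⟨S, n, s, hS⟩ := ih hp.2
    by_cases hx : x ∈ S
    · obtain ⟨U, W, m, l, -, h2, hU, -⟩ := s.split hx
      exact ⟨W, l, h2, (hU ▸ Set.subset_union_right : W ⊆ S).trans hS⟩
    · obtain ⟨w, U, W, m, l, h1, h2, hU, -, -, hw, hlast⟩ :=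
        s.reverse.exists_first (fun w => G.Adj x w) ⟨z, s.left_mem, e⟩
      have hUS : U ⊆ S := hU ▸ Set.subset_union_left
      refine ⟨insert x U, m + 1, .cons hw h1.reverse (fun u hu => ⟨?_, hlast u hu⟩) rfl, ?_⟩
      · rintro rfl; exact hx (hUS hu)
      · rintro u (rfl | hu)
        · exact hp.1
        · exact hS (hUS hu)

/-- A shortest path inside `F` between two vertex properties. -/
theorem Joined.exists_linking {F : Set V} {x y : V} (h : Joined G F x y) (X Y : V → Prop)
    (hx : X x) (hy : Y y) : ∃ p q S n, Seg G p q S n ∧ S ⊆ F ∧ X p ∧ Y q ∧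
      (∀ w ∈ S, X w → w = p) ∧ (∀ w ∈ S, Y w → w = q) := by
  obtain ⟨S, n, s, hS⟩ := h.exists_seg
  obtain ⟨q, U, W, m, l, h1, -, hU, -, -, hq, hfst⟩ := s.exists_first Y ⟨y, s.right_mem, hy⟩
  obtain ⟨p, U', W', m', l', h1', -, hU', -, -, hp, hfst'⟩ :=
    h1.reverse.exists_first X ⟨x, h1.left_mem, hx⟩
  have hUS : U ⊆ S := hU ▸ Set.subset_union_left
  have hUU : U' ⊆ U := hU' ▸ Set.subset_union_left
  exact ⟨p, q, U', m', h1'.reverse, hUU.trans (hUS.trans hS), hp, hq, hfst',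
    fun w hw => hfst w (hUU hw)⟩

theorem hole_vertex (hG : EvenHoleFree G) {x y w : V} {S : Set V} {n : ℕ} (s : Seg G x y S n)
    (hn : 3 ≤ n) (hx : G.Adj w x) (hy : G.Adj y w)
    (hw : ∀ p ∈ S, p ≠ w ∧ (G.Adj p w → p = x ∨ p = y)) : (n + 1) % 2 = 1 := by
  obtain ⟨p, hp, hs, hl, hi⟩ := s.toWalk
  have hxy : x ≠ y := fun e => by have := (s.eq_of_ends e).1; omega
  have hwp : w ∉ p.support := fun h => (hw w ((hs w).1 h)).1 rfl
  have hc : IsHole G (Walk.cons hx (p.concat hy)) := by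
    refine ⟨?_, ?_, ?_⟩
    · rw [Walk.cons_isCycle_iff]
      refine ⟨(Walk.concat_isPath_iff _).2 ⟨hp, hwp⟩, fun h => ?_⟩
      rw [Walk.edges_concat, List.concat_eq_append, List.mem_append] at h
      rcases h with h | h
      · exact hwp (Walk.fst_mem_support_of_mem_edges _ h)
      · simp only [List.mem_singleton, Sym2.eq_iff] at h
        rcases h with ⟨rfl, -⟩ | ⟨-, h⟩
        · exact G.irrefl hy
        · exact hxy h
    · simp; omega
    · intro u v hu hv huv
      simp only [Walk.support_cons, Walk.support_concat, List.mem_cons,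
        List.mem_append, List.not_mem_nil, or_false] at hu hv
      simp only [Walk.edges_cons, Walk.edges_concat, List.concat_eq_append, List.mem_cons,
        List.mem_append, List.not_mem_nil, or_false]
      have main : ∀ u' v', u' ∈ p.support → v' = w → G.Adj u' v' →
          s(u', v') = s(w, x) ∨ s(u', v') ∈ p.edges ∨ s(u', v') = s(y, w) := by
        intro u' v' hu' hv' huv'
        subst hv'
        rcases (hw u' ((hs u').1 hu')).2 huv' with rfl | rfl
        · exact Or.inl Sym2.eq_swap
        · exact Or.inr (Or.inr rfl)
      have hu' : u ∈ p.support ∨ u = w := by tauto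
      have hv' : v ∈ p.support ∨ v = w := by tauto
      rcases hu' with hu' | hu' <;> rcases hv' with hv' | hv'
      · exact Or.inr (Or.inl (hi u v hu' hv' huv))
      · exact main u v hu' hv' huv
      · rw [Sym2.eq_swap]; exact main v u hv' hu' huv.symm
      · exact (G.irrefl (hu' ▸ hv' ▸ huv)).elim
  have := hG _ _ hc
  rw [Nat.not_even_iff_odd, Nat.odd_iff] at this
  simp at this
  omega

theorem hole2 (hG : EvenHoleFree G) {x y z w : V} {S T : Set V} {n m : ℕ} (s : Seg G x y S n)
    (t : Seg G z w T m) (hyz : G.Adj y z) (hwx : G.Adj w x)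
    (h : ∀ p ∈ S, ∀ q ∈ T, p ≠ q ∧ (G.Adj p q → (p = y ∧ q = z) ∨ (p = x ∧ q = w)))
    (hnm : 4 ≤ n + m) : (n + m) % 2 = 1 := by
  cases t with
  | single =>
    have := hole_vertex hG s (by omega) hwx hyz (fun p hp => ⟨(h p hp z rfl).1, fun e => by
      have := (h p hp z rfl).2 e; tauto⟩)
    omega
  | @cons _ z' _ T' _ m hzz' t hz hT =>
    subst hT
    have st := t.append s (z := x) ⟨hwx, fun p hp q hq => ⟨(h q hq p (Or.inr hp)).1.symm, fun e => by
      rcases (h q hq p (Or.inr hp)).2 e.symm with h' | h'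
      · exact ((hz p hp).1 h'.2).elim
      · exact h'.symm⟩⟩
    have := hole_vertex hG st (w := z) (by omega) hzz' hyz (by
      rintro p (hp | hp)
      · exact ⟨(hz p hp).1, fun e => Or.inl ((hz p hp).2 e.symm)⟩
      · refine ⟨(h p hp z (Or.inl rfl)).1, fun e => ?_⟩
        rcases (h p hp z (Or.inl rfl)).2 e with h' | h'
        · exact Or.inr h'.1
        · exact ((hz w t.right_mem).1 h'.2.symm).elim)
    omega

end Basic

section Holes

variable {G : SimpleGraph V}

theorem hole3 (hG : EvenHoleFree G) {x₁ y₁ x₂ y₂ x₃ y₃ : V} {S₁ S₂ S₃ : Set V} {n₁ n₂ n₃ : ℕ}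
    (s₁ : Seg G x₁ y₁ S₁ n₁) (s₂ : Seg G x₂ y₂ S₂ n₂) (s₃ : Seg G x₃ y₃ S₃ n₃)
    (h₁₂ : Link G S₁ S₂ y₁ x₂) (h₂₃ : Link G S₂ S₃ y₂ x₃) (h₃₁ : Link G S₃ S₁ y₃ x₁)
    (hn : 4 ≤ n₁ + n₂ + n₃) : (n₁ + n₂ + n₃) % 2 = 1 := by
  refine hole2 hG (s₁.append s₂ h₁₂) s₃ h₂₃.1 h₃₁.1 ?_ hn
  rintro p (hp | hp) q hq
  · exact ⟨(h₃₁.2 q hq p hp).1.symm, fun e => Or.inr ((h₃₁.2 q hq p hp).2 e.symm).symm⟩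
  · exact ⟨(h₂₃.2 p hp q hq).1, fun e => Or.inl ((h₂₃.2 p hp q hq).2 e)⟩

theorem hole4 (hG : EvenHoleFree G) {x₁ y₁ x₂ y₂ x₃ y₃ x₄ y₄ : V} {S₁ S₂ S₃ S₄ : Set V}
    {n₁ n₂ n₃ n₄ : ℕ} (s₁ : Seg G x₁ y₁ S₁ n₁) (s₂ : Seg G x₂ y₂ S₂ n₂)
    (s₃ : Seg G x₃ y₃ S₃ n₃) (s₄ : Seg G x₄ y₄ S₄ n₄)
    (h₁₂ : Link G S₁ S₂ y₁ x₂) (h₂₃ : Link G S₂ S₃ y₂ x₃) (h₃₄ : Link G S₃ S₄ y₃ x₄)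
    (h₄₁ : Link G S₄ S₁ y₄ x₁) (h₁₃ : AC G S₁ S₃) (h₂₄ : AC G S₂ S₄) :
    (n₁ + n₂ + n₃ + n₄) % 2 = 1 := by
  have := s₁.pos; have := s₂.pos; have := s₃.pos; have := s₄.pos
  exact hole3 hG (s₁.append s₂ h₁₂) s₃ s₄ (h₂₃.union_left' h₁₃) h₃₄
    (h₄₁.union_right h₂₄.symm) (by omega)

theorem hole5 (hG : EvenHoleFree G) {x₁ y₁ x₂ y₂ x₃ y₃ x₄ y₄ x₅ y₅ : V}
    {S₁ S₂ S₃ S₄ S₅ : Set V} {n₁ n₂ n₃ n₄ n₅ : ℕ} (s₁ : Seg G x₁ y₁ S₁ n₁)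
    (s₂ : Seg G x₂ y₂ S₂ n₂) (s₃ : Seg G x₃ y₃ S₃ n₃) (s₄ : Seg G x₄ y₄ S₄ n₄)
    (s₅ : Seg G x₅ y₅ S₅ n₅)
    (h₁₂ : Link G S₁ S₂ y₁ x₂) (h₂₃ : Link G S₂ S₃ y₂ x₃) (h₃₄ : Link G S₃ S₄ y₃ x₄)
    (h₄₅ : Link G S₄ S₅ y₄ x₅) (h₅₁ : Link G S₅ S₁ y₅ x₁) (h₁₃ : AC G S₁ S₃)
    (h₁₄ : AC G S₁ S₄) (h₂₄ : AC G S₂ S₄) (h₂₅ : AC G S₂ S₅) (h₃₅ : AC G S₃ S₅) :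
    (n₁ + n₂ + n₃ + n₄ + n₅) % 2 = 1 :=
  hole4 hG (s₁.append s₂ h₁₂) s₃ s₄ s₅ (h₂₃.union_left' h₁₃) h₃₄ h₄₅
    (h₅₁.union_right h₂₅.symm) (h₁₄.union_left h₂₄) h₃₅

theorem hole6 (hG : EvenHoleFree G) {x₁ y₁ x₂ y₂ x₃ y₃ x₄ y₄ x₅ y₅ x₆ y₆ : V}
    {S₁ S₂ S₃ S₄ S₅ S₆ : Set V} {n₁ n₂ n₃ n₄ n₅ n₆ : ℕ} (s₁ : Seg G x₁ y₁ S₁ n₁)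
    (s₂ : Seg G x₂ y₂ S₂ n₂) (s₃ : Seg G x₃ y₃ S₃ n₃) (s₄ : Seg G x₄ y₄ S₄ n₄)
    (s₅ : Seg G x₅ y₅ S₅ n₅) (s₆ : Seg G x₆ y₆ S₆ n₆)
    (h₁₂ : Link G S₁ S₂ y₁ x₂) (h₂₃ : Link G S₂ S₃ y₂ x₃) (h₃₄ : Link G S₃ S₄ y₃ x₄)
    (h₄₅ : Link G S₄ S₅ y₄ x₅) (h₅₆ : Link G S₅ S₆ y₅ x₆) (h₆₁ : Link G S₆ S₁ y₆ x₁)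
    (h₁₃ : AC G S₁ S₃) (h₁₄ : AC G S₁ S₄) (h₁₅ : AC G S₁ S₅) (h₂₄ : AC G S₂ S₄)
    (h₂₅ : AC G S₂ S₅) (h₂₆ : AC G S₂ S₆) (h₃₅ : AC G S₃ S₅) (h₃₆ : AC G S₃ S₆)
    (h₄₆ : AC G S₄ S₆) : (n₁ + n₂ + n₃ + n₄ + n₅ + n₆) % 2 = 1 :=
  hole5 hG (s₁.append s₂ h₁₂) s₃ s₄ s₅ s₆ (h₂₃.union_left' h₁₃) h₃₄ h₄₅ h₅₆
    (h₆₁.union_right h₂₆.symm) (h₁₄.union_left h₂₄) (h₁₅.union_left h₂₅) h₃₅ h₃₆ h₄₆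

theorem extNearPrism_of_segs {x y a₁ a₂ a₃ b₁ b₂ b₃ : V} {S₁ S₂ S₃ : Set V} {n₁ n₂ n₃ : ℕ}
    (s₁ : Seg G a₁ b₁ S₁ n₁) (s₂ : Seg G a₂ b₂ S₂ n₂) (s₃ : Seg G a₃ b₃ S₃ n₃)
    (hx : x ∈ S₁) (hxa : x ≠ a₁) (hxb : x ≠ b₁) (hy : y ∈ S₂) (hya : y ≠ a₂) (hyb : y ≠ b₂)
    (hxy : G.Adj x y)
    (ha₁₂ : G.Adj a₁ a₂) (ha₁₃ : G.Adj a₁ a₃) (ha₂₃ : G.Adj a₂ a₃)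
    (hb₁₂ : G.Adj b₁ b₂) (hb₁₃ : G.Adj b₁ b₃) (hb₂₃ : G.Adj b₂ b₃)
    (h₁₂ : ∀ p ∈ S₁, ∀ q ∈ S₂, p ≠ q ∧
      (G.Adj p q → (p = a₁ ∧ q = a₂) ∨ (p = b₁ ∧ q = b₂) ∨ (p = x ∧ q = y)))
    (h₁₃ : ∀ p ∈ S₁, ∀ q ∈ S₃, p ≠ q ∧ (G.Adj p q → (p = a₁ ∧ q = a₃) ∨ (p = b₁ ∧ q = b₃)))
    (h₂₃ : ∀ p ∈ S₂, ∀ q ∈ S₃, p ≠ q ∧ (G.Adj p q → (p = a₂ ∧ q = a₃) ∨ (p = b₂ ∧ q = b₃))) :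
    ExtNearPrismCrossEnd G x := by
  have e₁ : a₁ ≠ b₁ := fun e => by
    have := (s₁.eq_of_ends e).2
    subst this; exact hxa hx
  have e₂ : a₂ ≠ b₂ := fun e => by
    have := (s₂.eq_of_ends e).2
    subst this; exact hya hy
  obtain ⟨R₁, hR₁, m₁, -, i₁⟩ := s₁.toWalk
  obtain ⟨R₂, hR₂, m₂, -, i₂⟩ := s₂.toWalk
  obtain ⟨R₃, hR₃, m₃, -, i₃⟩ := s₃.toWalk
  refine ⟨a₁, a₂, a₃, b₁, b₂, b₃, R₁, R₂, R₃, y, Or.inl ⟨ha₁₂, ha₁₃, ha₂₃, hb₁₂, hb₁₃, hb₂₃, ?_,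
    hR₁, hR₂, hR₃, ?_, ?_, ?_, (m₁ x).2 hx, hxa, hxb, (m₂ y).2 hy, hya, hyb, hxy, ?_⟩⟩
  · have := (h₁₂ _ s₁.left_mem _ s₂.right_mem).1
    have := (h₁₂ _ s₁.right_mem _ s₂.left_mem).1
    have := (h₁₃ _ s₁.left_mem _ s₃.right_mem).1
    have := (h₁₃ _ s₁.right_mem _ s₃.left_mem).1
    have := (h₂₃ _ s₂.left_mem _ s₃.right_mem).1
    have := (h₂₃ _ s₂.right_mem _ s₃.left_mem).1
    ext w
    simp only [Set.mem_inter_iff, Set.mem_insert_iff, Set.mem_singleton_iff]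
    grind
  · exact fun v h h' => (h₁₂ v ((m₁ v).1 h) v ((m₂ v).1 h')).1 rfl
  · exact fun v h h' => (h₁₃ v ((m₁ v).1 h) v ((m₃ v).1 h')).1 rfl
  · exact fun v h h' => (h₂₃ v ((m₂ v).1 h) v ((m₃ v).1 h')).1 rfl
  · intro p q hp hq e
    rw [m₁, m₂, m₃] at hp hq
    rcases hp with hp | hp | hp <;> rcases hq with hq | hq | hq
    · exact Or.inl (i₁ p q ((m₁ p).2 hp) ((m₁ q).2 hq) e)
    · rcases (h₁₂ p hp q hq).2 e with ⟨rfl, rfl⟩ | ⟨rfl, rfl⟩ | ⟨rfl, rfl⟩ <;> simp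
    · rcases (h₁₃ p hp q hq).2 e with ⟨rfl, rfl⟩ | ⟨rfl, rfl⟩ <;> simp
    · rcases (h₁₂ q hq p hp).2 e.symm with ⟨rfl, rfl⟩ | ⟨rfl, rfl⟩ | ⟨rfl, rfl⟩ <;> simp
    · exact Or.inr (Or.inl (i₂ p q ((m₂ p).2 hp) ((m₂ q).2 hq) e))
    · rcases (h₂₃ p hp q hq).2 e with ⟨rfl, rfl⟩ | ⟨rfl, rfl⟩ <;> simp
    · rcases (h₁₃ q hq p hp).2 e.symm with ⟨rfl, rfl⟩ | ⟨rfl, rfl⟩ <;> simp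
    · rcases (h₂₃ q hq p hp).2 e.symm with ⟨rfl, rfl⟩ | ⟨rfl, rfl⟩ <;> simp
    · exact Or.inr (Or.inr (Or.inl (i₃ p q ((m₃ p).2 hp) ((m₃ q).2 hq) e)))

/-- In a pyramid with legs `S₁, S₂, S₃` from the apex `a`, there is no path from the first vertex
`v` of the first leg to the second leg. -/
theorem pyramid_no_path (hG : EvenHoleFree G) {a v b₁ a₂ b₂ a₃ b₃ p₁ p₂ : V}
    {S₁ S₂ S₃ P : Set V} {n₁ n₂ n₃ m : ℕ} (hnx : ¬ ExtNearPrismCrossEnd G a)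
    (L₁ : Seg G v b₁ S₁ n₁) (L₂ : Seg G a₂ b₂ S₂ n₂) (L₃ : Seg G a₃ b₃ S₃ n₃)
    (ha₁ : Link G {a} S₁ a v) (ha₂ : Link G {a} S₂ a a₂) (ha₃ : Link G {a} S₃ a a₃)
    (hv : v ≠ b₁) (hab₂ : a₂ ≠ b₂) (h₁₂ : Link G S₁ S₂ b₁ b₂) (h₁₃ : Link G S₁ S₃ b₁ b₃)
    (h₂₃ : Link G S₂ S₃ b₂ b₃) (hP : Seg G p₁ p₂ P m) (haP : AC G {a} P) (hP₃ : AC G P S₃)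
    (hP₁ : Link G S₁ P v p₁) (hP₂ : ∀ p ∈ P, ∀ q ∈ S₂, p ≠ q ∧ (G.Adj p q → p = p₂))
    (hex : ∃ q ∈ S₂, G.Adj p₂ q) : False := by
  have sa := Seg.single (G := G) a
  have sv := Seg.single (G := G) v
  have hvS : ({v} : Set V) ⊆ S₁ := Set.singleton_subset_iff.2 L₁.left_mem
  have hb₁v : b₁ ∉ ({v} : Set V) := fun h => hv h.symm
  have hav : Link G {a} {v} a v := ha₁.mono subset_rfl hvS
  have hvP : Link G {v} P v p₁ := hP₁.mono hvS subset_rfl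
  have := L₁.two_le hv
  have := L₂.two_le hab₂
  have := hP.pos
  obtain ⟨y₁, y₂, U, W, c, d, sU, sW, hU, hW, hy₁, hy₂, hfst, hlst, hbU, haW, hcase⟩ :=
    L₂.exists_first_last (fun q => G.Adj p₂ q) hex
  have hPU : Link G P U p₂ y₁ := ⟨hy₁, fun p hp q hq => ⟨(hP₂ p hp q (hU hq)).1, fun e => by
    have := (hP₂ p hp q (hU hq)).2 e
    subst this
    exact ⟨rfl, hfst q hq e⟩⟩⟩
  have hPW : Link G P W p₂ y₂ := ⟨hy₂, fun p hp q hq => ⟨(hP₂ p hp q (hW hq)).1, fun e => by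
    have := (hP₂ p hp q (hW hq)).2 e
    subst this
    exact ⟨rfl, hlst q hq e⟩⟩⟩
  have hvU : AC G {v} U := h₁₂.ac_left hvS hU hb₁v
  have hvW : AC G {v} W := h₁₂.ac_left hvS hW hb₁v
  have hv₃ : AC G {v} S₃ := h₁₃.ac_left hvS subset_rfl hb₁v
  have haU : Link G {a} U a a₂ := ha₂.mono subset_rfl hU
  have hW₃ : Link G W S₃ b₂ b₃ := h₂₃.mono hW subset_rfl
  have H1 := hole4 hG sa sv hP sU.reverse hav hvP hPU haU.symm haP hvU
  have H2 := hole3 hG sa L₂ L₃.reverse ha₂ h₂₃ ha₃.symm (by have := L₃.pos; omega)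
  by_cases ha₂W : a₂ ∈ W
  · obtain ⟨e1, e2⟩ := haW ha₂W
    subst e1
    obtain ⟨h3, h4⟩ := sU.eq_of_ends rfl
    obtain ⟨-, h5, h6⟩ | h5 | h5 := hcase
    · have H3 := hole3 hG hP L₂ L₁.reverse ⟨hy₁, fun p hp q hq => ⟨(hP₂ p hp q hq).1, fun e => by
        have := (hP₂ p hp q hq).2 e
        subst this
        exact ⟨rfl, h6 q hq e⟩⟩⟩ h₁₂.symm hP₁ (by omega)
      have H4 := hole3 hG sa L₁ L₃.reverse ha₁ h₁₃ ha₃.symm (by have := L₃.pos; omega)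
      omega
    · exact (h5.1 e2).elim
    · exact (h5.1 e2).elim
  · have haW' : AC G {a} W := ha₂.ac_right subset_rfl hW ha₂W
    have H3 := hole5 hG sa sv hP sW L₃.reverse hav hvP hPW hW₃ ha₃.symm haP haW' hvW hv₃ hP₃
    have hp₂P : ({p₂} : Set V) ⊆ P := Set.singleton_subset_iff.2 hP.right_mem
    obtain ⟨-, h5, h6⟩ | ⟨hne, hUW, hcd⟩ | ⟨hne, hUW⟩ := hcase
    · omega
    · have hb₂U : b₂ ∉ U := fun h => hne (hbU h).2
      have hU₃ : AC G U S₃ := h₂₃.ac_left hU subset_rfl hb₂U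
      have sX := (sU.reverse.append sa haU.symm).append L₃ (ha₃.union_left' hU₃)
      have sY := hP.reverse.append L₁ hP₁.symm
      have haS₁ := fun w hw => (ha₁.2 a rfl w hw)
      refine hnx (extNearPrism_of_segs sX sY sW (x := a) (y := v) (by simp) ?_ ?_
        (Or.inr L₁.left_mem) ?_ hv ha₁.1 hy₁.symm hUW.1 hy₂ h₁₃.1.symm h₂₃.1.symm h₁₂.1 ?_ ?_ ?_)
      · exact (haU.2 a rfl _ sU.right_mem).1
      · exact (ha₃.2 a rfl _ L₃.right_mem).1
      · exact (hP₁.2 _ L₁.left_mem _ hP.right_mem).1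
      · rintro p ((hp | rfl) | hp) q (hq | hq)
        · have := hPU.2 q hq p hp
          exact ⟨this.1.symm, fun e => Or.inl (this.2 e.symm).symm⟩
        · have := h₁₂.2 q hq p (hU hp)
          exact ⟨this.1.symm, fun e => (hb₂U ((this.2 e.symm).2 ▸ hp)).elim⟩
        · exact ⟨(haP p rfl q hq).1, fun e => ((haP p rfl q hq).2 e).elim⟩
        · exact ⟨(ha₁.2 p rfl q hq).1, fun e => Or.inr (Or.inr ((ha₁.2 p rfl q hq).2 e))⟩
        · exact ⟨(hP₃ q hq p hp).1.symm, fun e => ((hP₃ q hq p hp).2 e.symm).elim⟩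
        · have := h₁₃.2 q hq p hp
          exact ⟨this.1.symm, fun e => Or.inr (Or.inl (this.2 e.symm).symm)⟩
      · rintro p ((hp | rfl) | hp) q hq
        · exact ⟨(hUW.2 p hp q hq).1, fun e => Or.inl ((hUW.2 p hp q hq).2 e)⟩
        · exact ⟨(haW' p rfl q hq).1, fun e => ((haW' p rfl q hq).2 e).elim⟩
        · exact ⟨(hW₃.2 q hq p hp).1.symm, fun e => Or.inr ((hW₃.2 q hq p hp).2 e.symm).symm⟩
      · rintro p (hp | hp) q hq
        · exact ⟨(hPW.2 p hp q hq).1, fun e => Or.inl ((hPW.2 p hp q hq).2 e)⟩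
        · exact ⟨(h₁₂.2 p hp q (hW hq)).1, fun e => Or.inr ((h₁₂.2 p hp q (hW hq)).2 e)⟩
    · have hb₂U : b₂ ∉ U := fun h => hne (hbU h).2
      have hU₃ : AC G U S₃ := h₂₃.ac_left hU subset_rfl hb₂U
      have H4 := hole5 hG sa sU (Seg.single p₂) sW L₃.reverse haU
        (hPU.symm.mono subset_rfl hp₂P) (hPW.mono hp₂P subset_rfl) hW₃ ha₃.symm
        (haP.mono subset_rfl hp₂P) haW' hUW hU₃ (hP₃.mono hp₂P subset_rfl)
      omega

end Holes

/-- `R` is the vertex set of a rung from `x` to `y`, with `n` vertices, of the strip `(A, B, C)`. -/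
structure Rung (G : SimpleGraph V) (A B C : Set V) (x y : V) (R : Set V) (n : ℕ) : Prop where
  seg : Seg G x y R n
  left : x ∈ A
  right : y ∈ B
  mid : ∀ w ∈ R, w ≠ x → w ≠ y → w ∈ C

section System

variable {G : SimpleGraph V}

theorem Rung.sub {A B C R : Set V} {x y : V} {n : ℕ} (r : Rung G A B C x y R n) :
    R ⊆ A ∪ B ∪ C := by
  intro w hw
  by_cases h1 : w = x
  · exact Or.inl (Or.inl (h1 ▸ r.left))
  · by_cases h2 : w = y
    · exact Or.inl (Or.inr (h2 ▸ r.right))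
    · exact Or.inr (r.mid w hw h1 h2)

theorem Rung.mono {A B C A' B' C' R : Set V} {x y : V} {n : ℕ} (r : Rung G A B C x y R n)
    (hA : A ⊆ A') (hB : B ⊆ B') (hC : C ⊆ C') : Rung G A' B' C' x y R n :=
  ⟨r.seg, hA r.left, hB r.right, fun w hw h1 h2 => hC (r.mid w hw h1 h2)⟩

theorem Rung.exists_isRung {A B C R : Set V} {x y w : V} {n : ℕ} (r : Rung G A B C x y R n)
    (hAB : Disjoint A B) (hw : w ∈ R) :
    ∃ (x y : V) (P : G.Walk x y), IsRung G A B C P ∧ w ∈ P.support := by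
  obtain ⟨P, hP, hs, -, hi⟩ := r.seg.toWalk
  refine ⟨x, y, P, ⟨hP, r.left, r.right, fun v hv => r.mid v ((hs v).1 hv), fun _ => ?_, hi⟩,
    (hs w).2 hw⟩
  exact ⟨Set.disjoint_left.1 hAB r.left, Set.disjoint_right.1 hAB r.right⟩

theorem mem_PSSVerts {a v : V} {k : ℕ} {A B C : Fin k → Set V} :
    v ∈ PSSVerts a A B C ↔ v = a ∨ ∃ i, v ∈ A i ∪ B i ∪ C i := by
  simp [PSSVerts]

theorem mem_closedNbhd {a v : V} : v ∈ closedNbhd G a ↔ v = a ∨ G.Adj a v := by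
  simp [closedNbhd]

theorem exists_ne_ne {k : ℕ} (hk : 3 ≤ k) (i j : Fin k) : ∃ h, h ≠ i ∧ h ≠ j := by
  by_contra! H
  have : (Finset.univ : Finset (Fin k)) ⊆ {i, j} := fun h _ => by
    by_cases hi : h = i
    · simp [hi]
    · simp [H h hi]
  have := (Finset.card_le_card this).trans (Finset.card_le_two)
  simp at this
  omega

namespace IsPyramidStripSystem

variable {a : V} {k : ℕ} {A B C : Fin k → Set V}

theorem notMem_B (h : IsPyramidStripSystem G a A B C) {i : Fin k} {v : V} (hv : v ∈ A i ∪ C i) :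
    v ∉ B i := fun hb => hv.elim (fun hv => Set.disjoint_left.1 (h.2.2.1 i) hv hb)
  (fun hv => Set.disjoint_left.1 (h.2.1 i).2.2.2.1 hb hv)

theorem notMem_A (h : IsPyramidStripSystem G a A B C) {i : Fin k} {v : V} (hv : v ∈ B i ∪ C i) :
    v ∉ A i := fun ha => hv.elim (fun hv => Set.disjoint_left.1 (h.2.2.1 i) ha hv)
  (fun hv => Set.disjoint_left.1 (h.2.1 i).2.2.1 ha hv)

theorem index_eq (h : IsPyramidStripSystem G a A B C) {i j : Fin k} {v : V}
    (hi : v ∈ A i ∪ B i ∪ C i) (hj : v ∈ A j ∪ B j ∪ C j) : i = j := by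
  by_contra hij
  exact Set.disjoint_left.1 (h.2.2.2.1 i j hij) hi hj

theorem adj_iff (h : IsPyramidStripSystem G a A B C) {i j : Fin k} (hij : i ≠ j) {p q : V}
    (hp : p ∈ A i ∪ B i ∪ C i) (hq : q ∈ A j ∪ B j ∪ C j) : G.Adj p q ↔ p ∈ B i ∧ q ∈ B j :=
  h.2.2.2.2.1 i j hij p hp q hq

theorem apex_adj (h : IsPyramidStripSystem G a A B C) {i : Fin k} {p : V}
    (hp : p ∈ A i ∪ B i ∪ C i) : G.Adj a p ↔ p ∈ A i := h.2.2.2.2.2.2 i p hp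

theorem apex_ne (h : IsPyramidStripSystem G a A B C) {i : Fin k} {p : V}
    (hp : p ∈ A i ∪ B i ∪ C i) : a ≠ p := fun e => h.2.2.2.2.2.1 i (e ▸ hp)

theorem exists_rung (h : IsPyramidStripSystem G a A B C) {i : Fin k} {v : V}
    (hv : v ∈ A i ∪ B i ∪ C i) :
    ∃ x y R n, Rung G (A i) (B i) (C i) x y R n ∧ v ∈ R := by
  obtain ⟨x, y, P, ⟨hP, hx, hy, hm, -, hi⟩, hv⟩ := (h.2.1 i).2.2.2.2 v hv
  exact ⟨x, y, _, _, ⟨Seg.ofWalk P hP hi, hx, hy, hm⟩, hv⟩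

theorem rung (h : IsPyramidStripSystem G a A B C) (i : Fin k) :
    ∃ x y R n, Rung G (A i) (B i) (C i) x y R n := by
  obtain ⟨v, hv⟩ := (h.2.1 i).1
  obtain ⟨x, y, R, n, r, -⟩ := h.exists_rung (Or.inl (Or.inl hv))
  exact ⟨x, y, R, n, r⟩

theorem rung_from (h : IsPyramidStripSystem G a A B C) {i : Fin k} {x : V} (hx : x ∈ A i) :
    ∃ y R n, Rung G (A i) (B i) (C i) x y R n := by
  obtain ⟨x', y, R, n, r, hv⟩ := h.exists_rung (Or.inl (Or.inl hx))
  obtain rfl : x = x' := by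
    by_contra hne
    by_cases hy : x = y
    · exact h.notMem_B (Or.inl hx) (hy ▸ r.right)
    · exact h.notMem_A (Or.inr (r.mid x hv hne hy)) hx
  exact ⟨y, R, n, r⟩

theorem rung_to (h : IsPyramidStripSystem G a A B C) {i : Fin k} {y : V} (hy : y ∈ B i) :
    ∃ x R n, Rung G (A i) (B i) (C i) x y R n := by
  obtain ⟨x, y', R, n, r, hv⟩ := h.exists_rung (Or.inl (Or.inr hy))
  obtain rfl : y = y' := by
    by_contra hne
    by_cases hx : y = x
    · exact h.notMem_B (Or.inl r.left) (hx ▸ hy)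
    · exact h.notMem_B (Or.inr (r.mid y hv hx hne)) hy
  exact ⟨x, R, n, r⟩

variable {i j : Fin k} {x y x' y' : V} {R R' : Set V} {n n' : ℕ}

theorem eq_left (h : IsPyramidStripSystem G a A B C) (r : Rung G (A i) (B i) (C i) x y R n)
    {w : V} (hw : w ∈ R) (hA : w ∈ A i) : w = x := by
  by_contra hne
  by_cases hy : w = y
  · exact h.notMem_B (Or.inl hA) (hy ▸ r.right)
  · exact h.notMem_A (Or.inr (r.mid w hw hne hy)) hA

theorem eq_right (h : IsPyramidStripSystem G a A B C) (r : Rung G (A i) (B i) (C i) x y R n)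
    {w : V} (hw : w ∈ R) (hB : w ∈ B i) : w = y := by
  by_contra hne
  by_cases hx : w = x
  · exact h.notMem_B (Or.inl r.left) (hx ▸ hB)
  · exact h.notMem_B (Or.inr (r.mid w hw hx hne)) hB

theorem ne (h : IsPyramidStripSystem G a A B C) (r : Rung G (A i) (B i) (C i) x y R n) : x ≠ y :=
  fun e => h.notMem_B (Or.inl r.left) (e ▸ r.right)

theorem two_le (h : IsPyramidStripSystem G a A B C) (r : Rung G (A i) (B i) (C i) x y R n) :
    2 ≤ n := r.seg.two_le (h.ne r)

theorem link (h : IsPyramidStripSystem G a A B C) (r : Rung G (A i) (B i) (C i) x y R n)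
    (r' : Rung G (A j) (B j) (C j) x' y' R' n') (hij : i ≠ j) : Link G R R' y y' := by
  refine ⟨(h.adj_iff hij (r.sub r.seg.right_mem) (r'.sub r'.seg.right_mem)).2 ⟨r.right, r'.right⟩,
    fun p hp q hq => ⟨?_, fun e => ?_⟩⟩
  · rintro rfl
    exact hij (h.index_eq (r.sub hp) (r'.sub hq))
  · have := (h.adj_iff hij (r.sub hp) (r'.sub hq)).1 e
    exact ⟨h.eq_right r hp this.1, h.eq_right r' hq this.2⟩

theorem apex (h : IsPyramidStripSystem G a A B C) (r : Rung G (A i) (B i) (C i) x y R n) :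
    Link G {a} R a x := by
  refine ⟨(h.apex_adj (r.sub r.seg.left_mem)).2 r.left, ?_⟩
  rintro p rfl q hq
  exact ⟨h.apex_ne (r.sub hq), fun e => ⟨rfl, h.eq_left r hq ((h.apex_adj (r.sub hq)).1 e)⟩⟩

theorem parity_of_ne (h : IsPyramidStripSystem G a A B C) (hG : EvenHoleFree G)
    (r : Rung G (A i) (B i) (C i) x y R n) (r' : Rung G (A j) (B j) (C j) x' y' R' n')
    (hij : i ≠ j) : n % 2 = n' % 2 := by
  have := h.two_le r
  have := h.two_le r'
  have := hole3 hG (Seg.single a) r.seg r'.seg.reverse (h.apex r) (h.link r r' hij)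
    (h.apex r').symm (by omega)
  omega

theorem parity (h : IsPyramidStripSystem G a A B C) (hG : EvenHoleFree G)
    (r : Rung G (A i) (B i) (C i) x y R n) (r' : Rung G (A j) (B j) (C j) x' y' R' n') :
    n % 2 = n' % 2 := by
  obtain ⟨l, hi, hj⟩ := exists_ne_ne h.1 i j
  obtain ⟨_, _, _, _, r''⟩ := h.rung l
  exact (h.parity_of_ne hG r r'' hi.symm).trans (h.parity_of_ne hG r'' r' hj)

/-- No new vertices can be added to the union of the strips outside `K`. -/
theorem no_merge (h : IsPyramidStripSystem G a A B C)
    (hidc : ∀ i, ConnectedSubset G (A i ∪ C i))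
    (hmax : ∀ (k' : ℕ) (A' B' C' : Fin k' → Set V),
      IsPyramidStripSystem G a A' B' C' →
      (∀ i, ConnectedSubset G (A' i ∪ C' i)) →
      PSSVerts a A B C ⊆ PSSVerts a A' B' C' →
      PSSVerts a A' B' C' = PSSVerts a A B C)
    (K : Set (Fin k)) {i j : Fin k} (hi : i ∈ K) (hj : j ∈ K) (hij : i ≠ j)
    {XA XB XC AM BM CM : Set V} (hAM : AM = (⋃ i ∈ Kᶜ, A i) ∪ XA)
    (hBM : BM = (⋃ i ∈ Kᶜ, B i) ∪ XB) (hCM : CM = (⋃ i ∈ Kᶜ, C i) ∪ XC)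
    (hXA : ∀ w ∈ XA, G.Adj a w) (hXB : ∀ w ∈ XB ∪ XC, ¬ G.Adj a w)
    (hX : ∀ w ∈ XA ∪ XB ∪ XC, w ∉ PSSVerts a A B C) (hBC : Disjoint XB XC)
    (hKA : ∀ i ∈ K, ∀ w ∈ XA ∪ XC, ∀ u ∈ A i ∪ B i ∪ C i, ¬ G.Adj w u)
    (hKB : ∀ i ∈ K, ∀ w ∈ XB, ∀ u ∈ A i ∪ B i ∪ C i, (G.Adj w u ↔ u ∈ B i))
    (hrung : ∀ w ∈ XA ∪ XB ∪ XC, ∃ x y R n, Rung G AM BM CM x y R n ∧ w ∈ R)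
    (z : V) (hz : ∀ l ∉ K, ∃ u ∈ A l ∪ C l, Joined G (AM ∪ CM) z u)
    (hzX : ∀ w ∈ XA ∪ XC, Joined G (AM ∪ CM) z w) : XA ∪ XB ∪ XC = ∅ := by
  rw [Set.eq_empty_iff_forall_notMem]
  intro w₀ hw₀
  classical
  have memA : ∀ w, w ∈ AM ↔ (∃ i ∉ K, w ∈ A i) ∨ w ∈ XA := by simp [hAM]
  have memB : ∀ w, w ∈ BM ↔ (∃ i ∉ K, w ∈ B i) ∨ w ∈ XB := by simp [hBM]
  have memC : ∀ w, w ∈ CM ↔ (∃ i ∉ K, w ∈ C i) ∨ w ∈ XC := by simp [hCM]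
  have memM : ∀ w, w ∈ AM ∪ BM ∪ CM ↔ (∃ i ∉ K, w ∈ A i ∪ B i ∪ C i) ∨ w ∈ XA ∪ XB ∪ XC := by
    intro w
    simp only [Set.mem_union, memA, memB, memC]
    grind
  have hVX : ∀ i w, w ∈ A i ∪ B i ∪ C i → w ∉ XA ∪ XB ∪ XC := fun i w hw hwX =>
    hX w hwX (mem_PSSVerts.2 (Or.inr ⟨i, hw⟩))
  have hsame : ∀ i j w, w ∈ A i ∪ B i ∪ C i → w ∈ A j ∪ B j ∪ C j → i = j :=
    fun i j w hi hj => h.index_eq hi hj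
  have hdAB : Disjoint AM BM := by
    rw [Set.disjoint_left]
    intro w hA hB
    rw [memA] at hA
    rw [memB] at hB
    rcases hA with ⟨i, -, hA⟩ | hA <;> rcases hB with ⟨j, -, hB⟩ | hB
    · obtain rfl := hsame i j w (by simp [hA]) (by simp [hB])
      exact h.notMem_B (Or.inl hA) hB
    · exact hVX i w (by simp [hA]) (by simp [hB])
    · exact hVX j w (by simp [hB]) (by simp [hA])
    · exact hXB w (Or.inl hB) (hXA w hA)
  have hdAC : Disjoint AM CM := by
    rw [Set.disjoint_left]
    intro w hA hB
    rw [memA] at hA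
    rw [memC] at hB
    rcases hA with ⟨i, -, hA⟩ | hA <;> rcases hB with ⟨j, -, hB⟩ | hB
    · obtain rfl := hsame i j w (by simp [hA]) (by simp [hB])
      exact h.notMem_A (Or.inr hB) hA
    · exact hVX i w (by simp [hA]) (by simp [hB])
    · exact hVX j w (by simp [hB]) (by simp [hA])
    · exact hXB w (Or.inr hB) (hXA w hA)
  have hdBC : Disjoint BM CM := by
    rw [Set.disjoint_left]
    intro w hA hB
    rw [memB] at hA
    rw [memC] at hB
    rcases hA with ⟨i, -, hA⟩ | hA <;> rcases hB with ⟨j, -, hB⟩ | hB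
    · obtain rfl := hsame i j w (by simp [hA]) (by simp [hB])
      exact h.notMem_B (Or.inr hB) hA
    · exact hVX i w (by simp [hA]) (by simp [hB])
    · exact hVX j w (by simp [hB]) (by simp [hA])
    · exact Set.disjoint_left.1 hBC hA hB
  have subA : ∀ i ∉ K, A i ⊆ AM := fun i hi w hw => (memA w).2 (Or.inl ⟨i, hi, hw⟩)
  have subB : ∀ i ∉ K, B i ⊆ BM := fun i hi w hw => (memB w).2 (Or.inl ⟨i, hi, hw⟩)
  have subC : ∀ i ∉ K, C i ⊆ CM := fun i hi w hw => (memC w).2 (Or.inl ⟨i, hi, hw⟩)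
  have hjoin : ∀ w ∈ AM ∪ CM, Joined G (AM ∪ CM) z w := by
    have hold : ∀ i ∉ K, ∀ w ∈ A i ∪ C i, Joined G (AM ∪ CM) z w := by
      intro i hi w hw
      obtain ⟨u, hu, hzu⟩ := hz i hi
      exact hzu.trans (Joined.mono ((hidc i).2 u hu w hw)
        (Set.union_subset_union (subA i hi) (subC i hi)))
    rintro w (hw | hw)
    · rcases (memA w).1 hw with ⟨i, hi, hw⟩ | hw
      · exact hold i hi w (Or.inl hw)
      · exact hzX w (Or.inl hw)
    · rcases (memC w).1 hw with ⟨i, hi, hw⟩ | hw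
      · exact hold i hi w (Or.inr hw)
      · exact hzX w (Or.inr hw)
  obtain ⟨a₀, b₀, _, _, r₀, -⟩ := hrung w₀ hw₀
  have hstrip : IsStrip G AM BM CM := by
    refine ⟨⟨a₀, r₀.left⟩, ⟨b₀, r₀.right⟩, hdAC, hdBC, fun w hw => ?_⟩
    rcases (memM w).1 hw with ⟨i, hi, hw⟩ | hw
    · obtain ⟨x, y, R, n, r, hwR⟩ := h.exists_rung hw
      exact (r.mono (subA i hi) (subB i hi) (subC i hi)).exists_isRung hdAB hwR
    · obtain ⟨x, y, R, n, r, hwR⟩ := hrung w hw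
      exact r.exists_isRung hdAB hwR
  have hMK : ∀ i ∈ K, ∀ p ∈ AM ∪ BM ∪ CM, ∀ q ∈ A i ∪ B i ∪ C i,
      (G.Adj p q ↔ p ∈ BM ∧ q ∈ B i) := by
    intro i hi p hp q hq
    rcases (memM p).1 hp with ⟨j, hj, hp'⟩ | hp'
    · rw [h.adj_iff (fun e : j = i => hj (e ▸ hi)) hp' hq, memB]
      refine and_congr_left fun _ => ⟨fun hb => Or.inl ⟨j, hj, hb⟩, ?_⟩
      rintro (⟨j', -, hb⟩ | hb)
      · rwa [← hsame j' j p (by simp [hb]) hp']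
      · exact (hVX j p hp' (by simp [hb])).elim
    · have hpB : p ∈ XB ↔ p ∈ BM := by
        rw [memB]
        refine ⟨Or.inr, ?_⟩
        rintro (⟨j', -, hb⟩ | hb)
        · exact (hVX j' p (by simp [hb]) hp').elim
        · exact hb
      by_cases hb : p ∈ XB
      · rw [hKB i hi p hb q hq, ← hpB]; simp [hb]
      · have : p ∈ XA ∪ XC := by simp only [Set.mem_union] at hp' ⊢; tauto
        rw [← hpB]
        simp only [hb, false_and, iff_false]
        exact hKA i hi p this q hq
  have hdMK : ∀ i ∈ K, Disjoint (AM ∪ BM ∪ CM) (A i ∪ B i ∪ C i) := by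
    intro i hi
    rw [Set.disjoint_left]
    intro w hw hw'
    rcases (memM w).1 hw with ⟨j, hj, hw⟩ | hw
    · exact hj (hsame i j w hw' hw ▸ hi)
    · exact hVX i w hw' hw
  have haM : ∀ p ∈ AM ∪ BM ∪ CM, (G.Adj a p ↔ p ∈ AM) := by
    intro p hp
    rcases (memM p).1 hp with ⟨j, hj, hp'⟩ | hp'
    · rw [h.apex_adj hp', memA]
      refine ⟨fun hb => Or.inl ⟨j, hj, hb⟩, ?_⟩
      rintro (⟨j', -, hb⟩ | hb)
      · rwa [← hsame j' j p (by simp [hb]) hp']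
      · exact (hVX j p hp' (by simp [hb])).elim
    · refine ⟨fun e => ?_, fun hA => ?_⟩
      · by_contra hA
        refine hXB p ?_ e
        rw [memA] at hA
        simp only [Set.mem_union] at hp' ⊢
        tauto
      · rcases (memA p).1 hA with ⟨j', -, hb⟩ | hb
        · exact (hVX j' p (by simp [hb]) hp').elim
        · exact hXA p hb
  have haM' : a ∉ AM ∪ BM ∪ CM := fun ha => by
    rcases (memM a).1 ha with ⟨j, hj, hp'⟩ | hp'
    · exact h.apex_ne hp' rfl
    · exact hX a hp' (mem_PSSVerts.2 (Or.inl rfl))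
  let e := Fintype.equivFin (Option K)
  have hcard : 3 ≤ Fintype.card (Option K) := by
    rw [Fintype.card_option]
    have : 1 < Fintype.card K := Fintype.one_lt_card_iff.2 ⟨⟨i, hi⟩, ⟨j, hj⟩, by simpa using hij⟩
    omega
  have key := hmax _ (fun t => (e.symm t).elim AM (fun i => A i))
    (fun t => (e.symm t).elim BM (fun i => B i)) (fun t => (e.symm t).elim CM (fun i => C i))
    ⟨hcard, ?_, ?_, ?_, ?_, ?_, ?_⟩ ?_ ?_
  · refine hX w₀ hw₀ (key ▸ mem_PSSVerts.2 (Or.inr ⟨e none, ?_⟩))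
    simpa using (memM w₀).2 (Or.inr hw₀)
  · intro t
    obtain ⟨t, rfl⟩ := e.surjective t
    simp only [Equiv.symm_apply_apply]
    rcases t with _ | t
    · exact hstrip
    · exact h.2.1 t
  · intro t
    obtain ⟨t, rfl⟩ := e.surjective t
    simp only [Equiv.symm_apply_apply]
    rcases t with _ | t
    · exact hdAB
    · exact h.2.2.1 t
  · intro t t' ht
    obtain ⟨t, rfl⟩ := e.surjective t
    obtain ⟨t', rfl⟩ := e.surjective t'
    replace ht : t ≠ t' := fun e' => ht (by rw [e'])
    simp only [Equiv.symm_apply_apply]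
    rcases t with _ | t <;> rcases t' with _ | t'
    · exact (ht rfl).elim
    · exact hdMK t' t'.2
    · exact (hdMK t t.2).symm
    · exact h.2.2.2.1 t t' (fun e' => ht (by rw [Subtype.ext e']))
  · intro t t' ht
    obtain ⟨t, rfl⟩ := e.surjective t
    obtain ⟨t', rfl⟩ := e.surjective t'
    replace ht : t ≠ t' := fun e' => ht (by rw [e'])
    simp only [Equiv.symm_apply_apply]
    rcases t with _ | t <;> rcases t' with _ | t'
    · exact (ht rfl).elim
    · exact hMK t' t'.2
    · intro p hp q hq
      rw [G.adj_comm, and_comm]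
      exact hMK t t.2 q hq p hp
    · exact h.2.2.2.2.1 t t' (fun e' => ht (by rw [Subtype.ext e']))
  · intro t
    obtain ⟨t, rfl⟩ := e.surjective t
    simp only [Equiv.symm_apply_apply]
    rcases t with _ | t
    · exact haM'
    · exact h.2.2.2.2.2.1 t
  · intro t
    obtain ⟨t, rfl⟩ := e.surjective t
    simp only [Equiv.symm_apply_apply]
    rcases t with _ | t
    · exact haM
    · exact h.2.2.2.2.2.2 t
  · intro t
    obtain ⟨t, rfl⟩ := e.surjective t
    simp only [Equiv.symm_apply_apply]
    rcases t with _ | t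
    · exact ⟨⟨a₀, Or.inl r₀.left⟩,
        fun x hx y hy => (hjoin x hx).symm.trans (hjoin y hy)⟩
    · exact hidc t
  · intro w hw
    rcases mem_PSSVerts.1 hw with rfl | ⟨i, hw⟩
    · exact mem_PSSVerts.2 (Or.inl rfl)
    · refine mem_PSSVerts.2 (Or.inr ?_)
      by_cases hi : i ∈ K
      · exact ⟨e (some ⟨i, hi⟩), by simpa using hw⟩
      · exact ⟨e none, by simpa using (memM w).2 (Or.inl ⟨i, hi, hw⟩)⟩

end IsPyramidStripSystem

end System

/-- The complement of `V(𝒮) ∪ N[a]`. -/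
def Outside (G : SimpleGraph V) (a : V) {k : ℕ} (A B C : Fin k → Set V) : Set V :=
  (PSSVerts a A B C ∪ closedNbhd G a)ᶜ

/-- The standing hypotheses: `(A, B, C)` is a maximal indecomposable pyramid strip system. -/
structure MaximalSystem (G : SimpleGraph V) (a : V) {k : ℕ} (A B C : Fin k → Set V) : Prop where
  evenHoleFree : EvenHoleFree G
  no_extNearPrism : ¬ ExtNearPrismCrossEnd G a
  sys : IsPyramidStripSystem G a A B C
  connected : ∀ i, ConnectedSubset G (A i ∪ C i)
  maximal : ∀ (k' : ℕ) (A' B' C' : Fin k' → Set V),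
    IsPyramidStripSystem G a A' B' C' →
    (∀ i, ConnectedSubset G (A' i ∪ C' i)) →
    PSSVerts a A B C ⊆ PSSVerts a A' B' C' →
    PSSVerts a A' B' C' = PSSVerts a A B C

section Components

variable {G : SimpleGraph V} {a : V} {k : ℕ} {A B C : Fin k → Set V}

theorem Seg.joined_diff {x y u : V} {S : Set V} {n : ℕ} (s : Seg G x y S n) (hu : u ∈ S)
    (hne : u ≠ y) : Joined G (S \ {y}) x u := by
  obtain ⟨U, W, m, l, h1, h2, hU, -, hUW⟩ := s.split hu
  refine (h1.joined h1.right_mem).mono fun w hw => ⟨hU ▸ Or.inl hw, ?_⟩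
  rintro rfl
  exact hne ((hUW w hw w h2.right_mem).1 rfl).symm

theorem ac_apex {S : Set V} (hS : S ⊆ Outside G a A B C) : AC G {a} S := by
  rintro p rfl q hq
  have := hS hq
  simp only [Outside, Set.mem_compl_iff, Set.mem_union, mem_closedNbhd, mem_PSSVerts] at this
  grind

theorem Outside.notMem {p : V} (hp : p ∈ Outside G a A B C) (i : Fin k) :
    p ∉ A i ∪ B i ∪ C i :=
  fun h => hp (Or.inl (mem_PSSVerts.2 (Or.inr ⟨i, h⟩)))

theorem Outside.ne {p : V} (hp : p ∈ Outside G a A B C) {i : Fin k} {w : V}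
    (hw : w ∈ A i ∪ B i ∪ C i) : p ≠ w := fun e => Outside.notMem hp i (e ▸ hw)

namespace IsPyramidStripSystem

variable {i j : Fin k} {x y x' y' : V} {R R' : Set V} {n n' : ℕ}

theorem exists_prefix (h : IsPyramidStripSystem G a A B C)
    (r : Rung G (A i) (B i) (C i) x y R n) (N : V → Prop) (hN : ∃ w ∈ R, w ∈ A i ∪ C i ∧ N w) :
    ∃ x₁ U m, Seg G x x₁ U m ∧ U ⊆ R ∧ U ⊆ A i ∪ C i ∧ y ∉ U ∧ N x₁ ∧ ∀ u ∈ U, N u → u = x₁ := by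
  obtain ⟨w, hw, hwA, hNw⟩ := hN
  obtain ⟨x₁, U, W, m, l, s1, s2, hU, -, hUW, h1, h2⟩ := r.seg.exists_first N ⟨w, hw, hNw⟩
  have hUR : U ⊆ R := hU ▸ Set.subset_union_left
  have hy : y ∉ U := fun hy => by
    have e := (hUW y hy y s2.right_mem).1 rfl
    have : w = y := by
      rcases (hU ▸ hw : w ∈ U ∪ W) with hw | hw
      · exact (h2 w hw hNw).trans e.symm
      · rw [(s2.eq_of_ends e.symm).2] at hw
        exact Eq.trans hw e.symm
    exact h.notMem_B hwA (this ▸ r.right)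
  refine ⟨x₁, U, m, s1, hUR, fun u hu => ?_, hy, h1, h2⟩
  by_cases hx : u = x
  · exact Or.inl (hx ▸ r.left)
  · exact Or.inr (r.mid u (hUR hu) hx fun e => hy (e ▸ hu))

end IsPyramidStripSystem

namespace MaximalSystem

variable {i j : Fin k} {p q : V} {S : Set V} {n : ℕ}

theorem no_path_to_bases (H : MaximalSystem G a A B C) (s : Seg G p q S n)
    (hS : S ⊆ Outside G a A B C) (hp : ∃ w ∈ A i ∪ C i, G.Adj p w)
    (hp' : ∀ u ∈ S, ∀ w ∈ A i ∪ C i, G.Adj u w → u = p)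
    (hq : ∃ j, j ≠ i ∧ ∃ w ∈ A j ∪ B j ∪ C j, G.Adj q w)
    (hq' : ∀ u ∈ S, ∀ j, j ≠ i → ∀ w ∈ A j ∪ B j ∪ C j, G.Adj u w → u = q ∧ w ∈ B j) :
    False := by
  have h := H.sys
  obtain ⟨w₀, hw₀, hpw₀⟩ := hp
  have hw₀V : w₀ ∈ A i ∪ B i ∪ C i := hw₀.elim (fun h => Or.inl (Or.inl h)) Or.inr
  obtain ⟨x, y, R, ρ, r, hw₀R⟩ := h.exists_rung hw₀V
  obtain ⟨x₁, U, m, sU, hUR, hUA, hyU, hx₁, hfst⟩ :=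
    h.exists_prefix r (fun u => G.Adj p u) ⟨w₀, hw₀R, hw₀, hpw₀⟩
  have hUV : ∀ u ∈ U, u ∈ A i ∪ B i ∪ C i := fun u hu => r.sub (hUR hu)
  have hUS : Link G U S x₁ p := ⟨hx₁.symm, fun u hu w hw =>
    ⟨(Outside.ne (hS hw) (hUV u hu)).symm, fun e => by
      have := hp' w hw u (hUA hu) e.symm
      subst this
      exact ⟨hfst u hu e.symm, rfl⟩⟩⟩
  by_cases hcomp : ∀ j, j ≠ i → ∀ b ∈ B j, G.Adj q b
  · obtain ⟨j, hji, -⟩ := exists_ne_ne h.1 i i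
    obtain ⟨j', hj'i, hj'j⟩ := exists_ne_ne h.1 i j
    have hun : ∀ D : Fin k → Set V, (⋃ j ∈ ({j | j ≠ i}ᶜ : Set (Fin k)), D j) = D i := by
      intro D; ext; simp
    have huniv : (∅ : Set V) ∪ {q} ∪ S \ {q} = S := by
      rw [Set.empty_union, Set.singleton_union, Set.insert_sdiff_singleton]
      exact Set.insert_eq_of_mem s.right_mem
    have := h.no_merge H.connected H.maximal {j | j ≠ i} (i := j) (j := j') hji hj'i
      hj'j.symm (XA := ∅) (XB := {q}) (XC := S \ {q}) rfl rfl rfl (by simp) ?_ ?_ ?_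
      ?_ ?_ ?_ w₀ ?_ ?_
    · rw [huniv] at this
      exact Set.notMem_empty _ (this ▸ s.left_mem)
    · rintro w (rfl | hw)
      · exact (ac_apex hS a rfl w s.right_mem).2
      · exact (ac_apex hS a rfl w hw.1).2
    · rw [huniv]
      exact fun w hw hw' => hS hw (Or.inl hw')
    · exact Set.disjoint_sdiff_right
    · rintro j hj w (hw | hw) u hu e
      · exact hw
      · exact hw.2 (hq' w hw.1 j hj u hu e).1
    · rintro j hj w rfl u hu
      exact ⟨fun e => (hq' w s.right_mem j hj u hu e).2, hcomp j hj u⟩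
    · rw [huniv]
      intro w hw
      refine ⟨x, q, U ∪ S, _, ⟨sU.append s hUS, ?_, ?_, ?_⟩, Or.inr hw⟩
      · rw [hun]; exact Or.inl r.left
      · exact Or.inr rfl
      · rintro w (hw | hw) hwx hwq
        · rw [hun]
          exact Or.inl (r.mid w (hUR hw) hwx fun e => hyU (e ▸ hw))
        · exact Or.inr ⟨hw, hwq⟩
    · intro l hl
      obtain rfl : l = i := by simpa using hl
      exact ⟨w₀, hw₀, Joined.refl (by rw [hun, hun]; exact hw₀.imp Or.inl Or.inl)⟩
    · rintro w (hw | hw)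
      · exact hw.elim
      · have hpS : p ∈ S \ {q} := ⟨s.left_mem, fun e => by
          rw [(s.eq_of_ends e).2] at hw
          exact hw.2 (hw.1.trans e)⟩
        refine Joined.trans (Joined.of_adj ?_ (Or.inr (Or.inr hpS)) hpw₀.symm)
          ((s.joined_diff hw.1 hw.2).mono fun u hu => Or.inr (Or.inr hu))
        rw [hun, hun]
        exact hw₀.imp Or.inl Or.inl
  · push Not at hcomp
    obtain ⟨h₀, hh₀, b, hb, hqb⟩ := hcomp
    obtain ⟨j₀, hj₀, c, hc, hqc⟩ := hq
    replace hc := (hq' q s.right_mem j₀ hj₀ c hc hqc).2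
    obtain ⟨j, g, b, c, hj, hg, hjg, hc, hb, hqc, hqb⟩ : ∃ j g b c, j ≠ i ∧ g ≠ i ∧ j ≠ g ∧
        c ∈ B j ∧ b ∈ B g ∧ G.Adj q c ∧ ¬ G.Adj q b := by
      by_cases hjh : j₀ = h₀
      · subst hjh
        obtain ⟨g, hgi, hgj⟩ := exists_ne_ne h.1 i j₀
        obtain ⟨b', hb'⟩ := (h.2.1 g).2.1
        by_cases hqb' : G.Adj q b'
        · exact ⟨g, j₀, b, b', hgi, hh₀, hgj, hb', hb, hqb', hqb⟩
        · exact ⟨j₀, g, b', c, hh₀, hgi, hgj.symm, hc, hb', hqc, hqb'⟩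
      · exact ⟨j₀, h₀, b, c, hj₀, hh₀, hjh, hc, hb, hqc, hqb⟩
    obtain ⟨xj, Rj, nj, rj⟩ := h.rung_to hc
    obtain ⟨xg, Rg, ng, rg⟩ := h.rung_to hb
    have hSR : Link G S Rj q c := ⟨hqc, fun u hu w hw =>
      ⟨Outside.ne (hS hu) (rj.sub hw), fun e => by
        have := hq' u hu j hj w (rj.sub hw) e
        exact ⟨this.1, h.eq_right rj hw this.2⟩⟩⟩
    have hSg : AC G S Rg := fun u hu w hw =>
      ⟨Outside.ne (hS hu) (rg.sub hw), fun e => by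
        have := hq' u hu g hg w (rg.sub hw) e
        obtain rfl := this.1
        exact hqb (h.eq_right rg hw this.2 ▸ e)⟩
    have hcR : ({c} : Set V) ⊆ Rj := Set.singleton_subset_iff.2 rj.seg.right_mem
    have haU := (h.apex r).mono subset_rfl hUR
    have hca : AC G {a} {c} := (h.apex rj).ac_right subset_rfl hcR fun e => h.ne rj e
    have hUj := (h.link r rj hj.symm).ac_left hUR subset_rfl hyU
    have H1 := hole4 H.evenHoleFree (Seg.single a) sU s rj.seg.reverse haU hUS hSR
      (h.apex rj).symm (ac_apex hS) hUj
    have H2 := hole5 H.evenHoleFree (Seg.single a) sU s (Seg.single c) rg.seg.reverse haU hUS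
      (hSR.mono subset_rfl hcR) ((h.link rj rg hjg).mono hcR subset_rfl) (h.apex rg).symm
      (ac_apex hS) hca (hUj.mono subset_rfl hcR)
      ((h.link r rg hg.symm).ac_left hUR subset_rfl hyU) hSg
    have := h.parity H.evenHoleFree rj rg
    omega

theorem no_vertex_three_strips (H : MaximalSystem G a A B C) {g : Fin k} (hij : i ≠ j)
    (hig : i ≠ g) (hjg : j ≠ g) (hp : p ∈ Outside G a A B C)
    (hi : ∃ w ∈ A i ∪ C i, G.Adj p w) (hj : ∃ w ∈ A j ∪ C j, G.Adj p w)
    (hg : ∃ w ∈ A g ∪ B g ∪ C g, G.Adj p w) : False := by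
  have h := H.sys
  have get : ∀ i, (∃ w ∈ A i ∪ C i, G.Adj p w) → ∃ x y R n, Rung G (A i) (B i) (C i) x y R n ∧
      ∃ x₁ U m, Seg G x x₁ U m ∧ U ⊆ R ∧ y ∉ U ∧ G.Adj p x₁ ∧ ∀ u ∈ U, G.Adj p u → u = x₁ := by
    rintro i ⟨w, hw, hpw⟩
    obtain ⟨x, y, R, n, r, hwR⟩ := h.exists_rung (hw.elim (fun h => Or.inl (Or.inl h)) Or.inr)
    obtain ⟨x₁, U, m, s, h1, -, h2, h3⟩ :=
      h.exists_prefix r (fun u => G.Adj p u) ⟨w, hwR, hw, hpw⟩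
    exact ⟨x, y, R, n, r, x₁, U, m, s, h1, h2, h3⟩
  obtain ⟨x, y, R, ρ, r, x₁, U, m, s, hU, hy, hx₁, hf⟩ := get i hi
  obtain ⟨x', y', R', ρ', r', x₁', U', m', s', hU', hy', hx₁', hf'⟩ := get j hj
  obtain ⟨w, hw, hpw⟩ := hg
  obtain ⟨x'', y'', R'', ρ'', r'', hwR⟩ := h.exists_rung hw
  obtain ⟨x₁'', U'', W, m'', l, s'', -, hUW, -, -, hx₁'', hf''⟩ :=
    r''.seg.exists_first (fun u => G.Adj p u) ⟨w, hwR, hpw⟩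
  have hU'' : U'' ⊆ R'' := hUW ▸ Set.subset_union_left
  have hap : AC G {a} {p} := ac_apex (Set.singleton_subset_iff.2 hp)
  have hpU : ∀ {U : Set V} {i x₁}, U ⊆ A i ∪ B i ∪ C i → G.Adj p x₁ →
      (∀ u ∈ U, G.Adj p u → u = x₁) → Link G {p} U p x₁ := by
    intro U i x₁ h1 h2 h3
    refine ⟨h2, ?_⟩
    rintro _ rfl q hq
    exact ⟨Outside.ne hp (h1 hq), fun e => ⟨rfl, h3 q hq e⟩⟩
  have L := hpU (hU.trans r.sub) hx₁ hf
  have L' := hpU (hU'.trans r'.sub) hx₁' hf'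
  have L'' := hpU (hU''.trans r''.sub) hx₁'' hf''
  have K := (h.apex r).mono subset_rfl hU
  have K' := (h.apex r').mono subset_rfl hU'
  have K'' := (h.apex r'').mono subset_rfl hU''
  have sa := Seg.single (G := G) a
  have sp := Seg.single (G := G) p
  have H1 := hole4 H.evenHoleFree sa s sp s'.reverse K L.symm L' K'.symm hap
    ((h.link r r' hij).ac_left hU hU' hy)
  have H2 := hole4 H.evenHoleFree sa s sp s''.reverse K L.symm L'' K''.symm hap
    ((h.link r r'' hig).ac_left hU hU'' hy)
  have H3 := hole4 H.evenHoleFree sa s' sp s''.reverse K' L'.symm L'' K''.symm hap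
    ((h.link r' r'' hjg).ac_left hU' hU'' hy')
  omega

theorem no_path_two_strips (H : MaximalSystem G a A B C) (hij : i ≠ j) (s : Seg G p q S n)
    (hS : S ⊆ Outside G a A B C) (hp : ∃ w ∈ A i ∪ C i, G.Adj p w)
    (hq : ∃ w ∈ A j ∪ C j, G.Adj q w)
    (hp' : ∀ u ∈ S, ∀ w ∈ A i ∪ B i ∪ C i, G.Adj u w → u = p)
    (hq' : ∀ u ∈ S, ∀ w ∈ A j ∪ B j ∪ C j, G.Adj u w → u = q)
    (hg : ∀ g, g ≠ i → g ≠ j → ∀ u ∈ S, ∀ w ∈ A g ∪ B g ∪ C g, ¬ G.Adj u w) : False := by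
  have h := H.sys
  have hG := H.evenHoleFree
  obtain ⟨g, hgi, hgj⟩ := exists_ne_ne h.1 i j
  obtain ⟨xg, yg, Rg, ng, rg⟩ := h.rung g
  have get : ∀ i p, (∃ w ∈ A i ∪ C i, G.Adj p w) → ∃ x y R n, Rung G (A i) (B i) (C i) x y R n ∧
      ∃ w ∈ R, w ∈ A i ∪ C i ∧ G.Adj p w := by
    rintro i p ⟨w, hw, hpw⟩
    obtain ⟨x, y, R, n, r, hwR⟩ := h.exists_rung (hw.elim (fun h => Or.inl (Or.inl h)) Or.inr)
    exact ⟨x, y, R, n, r, w, hwR, hw, hpw⟩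
  obtain ⟨x, y, R, ρ, r, w, hwR, hw, hpw⟩ := get i p hp
  obtain ⟨x', y', R', ρ', r', w', hwR', hw', hqw'⟩ := get j q hq
  obtain ⟨x₁, x₂, U, W, m, l, sU, sW, hU, hW, hx₁, hx₂, hf, hl, hyU, hxW, hcase⟩ :=
    r.seg.exists_first_last (fun u => G.Adj p u) ⟨w, hwR, hpw⟩
  obtain ⟨x₁', x₂', U', W', m', l', sU', sW', hU', hW', hx₁', hx₂', hf', hl', hyU', hxW', hcase'⟩ :=
    r'.seg.exists_first_last (fun u => G.Adj q u) ⟨w', hwR', hqw'⟩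
  have hy : y ∉ U := fun hy => by
    obtain ⟨e1, e2⟩ := hyU hy
    rcases hcase with ⟨-, -, h3⟩ | h3 | h3
    · exact h.notMem_B hw (h3 w hwR hpw ▸ e1 ▸ r.right)
    · exact h3.1 e2
    · exact h3.1 e2
  have hy' : y' ∉ U' := fun hy => by
    obtain ⟨e1, e2⟩ := hyU' hy
    rcases hcase' with ⟨-, -, h3⟩ | h3 | h3
    · exact h.notMem_B hw' (h3 w' hwR' hqw' ▸ e1 ▸ r'.right)
    · exact h3.1 e2
    · exact h3.1 e2
  have hne : ∀ {i}, ∀ u ∈ S, ∀ w ∈ A i ∪ B i ∪ C i, u ≠ w := fun u hu w hw => Outside.ne (hS hu) hw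
  have mkL : ∀ {T z}, T ⊆ R → G.Adj p z → (∀ u ∈ T, G.Adj p u → u = z) → Link G S T p z := by
    intro T z hT hz hu
    refine ⟨hz, fun u hu' w hw => ⟨hne u hu' w (r.sub (hT hw)), fun e => ?_⟩⟩
    have := hp' u hu' w (r.sub (hT hw)) e
    subst this
    exact ⟨rfl, hu w hw e⟩
  have mkL' : ∀ {T z}, T ⊆ R' → G.Adj q z → (∀ u ∈ T, G.Adj q u → u = z) → Link G S T q z := by
    intro T z hT hz hu
    refine ⟨hz, fun u hu' w hw => ⟨hne u hu' w (r'.sub (hT hw)), fun e => ?_⟩⟩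
    have := hq' u hu' w (r'.sub (hT hw)) e
    subst this
    exact ⟨rfl, hu w hw e⟩
  have hSg : AC G S Rg := fun u hu w hw =>
    ⟨hne u hu w (rg.sub hw), hg g hgi hgj u hu w (rg.sub hw)⟩
  have haS := ac_apex hS
  have uniq : x ∈ W → ∀ u ∈ R, G.Adj p u → u = x := fun hx u hu e => by
    obtain ⟨e1, e2⟩ := hxW hx
    rcases hcase with ⟨-, -, h3⟩ | h3 | h3
    · exact (h3 u hu e).trans e1.symm
    · exact (h3.1 e2).elim
    · exact (h3.1 e2).elim
  have uniq' : x' ∈ W' → ∀ u ∈ R', G.Adj q u → u = x' := fun hx u hu e => by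
    obtain ⟨e1, e2⟩ := hxW' hx
    rcases hcase' with ⟨-, -, h3⟩ | h3 | h3
    · exact (h3 u hu e).trans e1.symm
    · exact (h3.1 e2).elim
    · exact (h3.1 e2).elim
  by_cases hx : x ∈ W
  · have hpx : G.Adj p x := (hxW hx).1 ▸ hx₁
    exact pyramid_no_path hG H.no_extNearPrism r.seg r'.seg rg.seg (h.apex r) (h.apex r')
      (h.apex rg) (h.ne r) (h.ne r') (h.link r r' hij) (h.link r rg hgi.symm)
      (h.link r' rg hgj.symm) s haS hSg (mkL subset_rfl hpx (uniq hx)).symm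
      (fun u hu w hw => ⟨hne u hu w (r'.sub hw), hq' u hu w (r'.sub hw)⟩) ⟨w', hwR', hqw'⟩
  by_cases hx' : x' ∈ W'
  · have hqx : G.Adj q x' := (hxW' hx').1 ▸ hx₁'
    exact pyramid_no_path hG H.no_extNearPrism r'.seg r.seg rg.seg (h.apex r') (h.apex r)
      (h.apex rg) (h.ne r') (h.ne r) (h.link r' r hij.symm) (h.link r' rg hgj.symm)
      (h.link r rg hgi.symm) s.reverse haS hSg (mkL' subset_rfl hqx (uniq' hx')).symm
      (fun u hu w hw => ⟨hne u hu w (r.sub hw), hp' u hu w (r.sub hw)⟩) ⟨w, hwR, hpw⟩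
  have sa := Seg.single (G := G) a
  have aU := (h.apex r).mono subset_rfl hU
  have aU' := (h.apex r').mono subset_rfl hU'
  have aW := (h.apex r).ac_right subset_rfl hW hx
  have aW' := (h.apex r').ac_right subset_rfl hW' hx'
  have H1 := hole4 hG sa sU s sU'.reverse aU (mkL hU hx₁ hf).symm (mkL' hU' hx₁' hf') aU'.symm haS
    ((h.link r r' hij).ac_left hU hU' hy)
  have H2 := hole5 hG sa sU s sW' rg.seg.reverse aU (mkL hU hx₁ hf).symm (mkL' hW' hx₂' hl')
    ((h.link r' rg hgj.symm).mono hW' subset_rfl) (h.apex rg).symm haS aW'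
    ((h.link r r' hij).ac_left hU hW' hy) ((h.link r rg hgi.symm).ac_left hU subset_rfl hy) hSg
  have H3 := hole5 hG sa sU' s.reverse sW rg.seg.reverse aU' (mkL' hU' hx₁' hf').symm
    (mkL hW hx₂ hl) ((h.link r rg hgi.symm).mono hW subset_rfl) (h.apex rg).symm haS aW
    ((h.link r' r hij.symm).ac_left hU' hW hy')
    ((h.link r' rg hgj.symm).ac_left hU' subset_rfl hy') hSg
  have H4 := hole3 hG s sW' sW.reverse (mkL' hW' hx₂' hl') ((h.link r' r hij.symm).mono hW' hW)
    (mkL hW hx₂ hl).symm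
  have := s.pos
  have := sW.pos
  have := sW'.pos
  omega

/-- A component attaching to `A i ∪ C i` has no neighbours in the other strips. -/
theorem component_anticomplete (H : MaximalSystem G a A B C) {F : Set V}
    (hF : IsComponentOf G (PSSVerts a A B C ∪ closedNbhd G a) F)
    (hi : ∃ w ∈ A i ∪ C i, ∃ u ∈ F, G.Adj w u) (hij : i ≠ j) :
    ∀ u ∈ F, ∀ w ∈ A j ∪ B j ∪ C j, ¬ G.Adj u w := by
  intro u hu w hw huw
  obtain ⟨w₀, hw₀, u₀, hu₀, e₀⟩ := hi
  have hFO : F ⊆ Outside G a A B C := fun x hx hx' => Set.disjoint_left.1 hF.2.1 hx hx'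
  have toV : ∀ {i w}, w ∈ A i ∪ C i → w ∈ A i ∪ B i ∪ C i :=
    fun h => h.elim (fun h => Or.inl (Or.inl h)) Or.inr
  have hconn : Joined G F u₀ u := hF.1.2 u₀ hu₀ u hu
  obtain ⟨p, q, S, n, s, hSF, hXp, hYq, hX, hY⟩ := hconn.exists_linking
    (fun u => ∃ w ∈ A i ∪ C i, G.Adj u w)
    (fun u => ∃ j, j ≠ i ∧ ∃ w ∈ A j ∪ B j ∪ C j, G.Adj u w)
    ⟨w₀, hw₀, e₀.symm⟩ ⟨j, hij.symm, w, hw, huw⟩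
  have hSO := hSF.trans hFO
  by_cases hq : ∃ j, j ≠ i ∧ ∃ w ∈ A j ∪ C j, G.Adj q w
  · obtain ⟨j, hji, w, hw, hqw⟩ := hq
    obtain ⟨p', U, _, m, _, sU, -, hUW, -, -, hp', hlast⟩ := s.reverse.exists_first
      (fun u => ∃ g, g ≠ j ∧ ∃ w ∈ A g ∪ B g ∪ C g, G.Adj u w)
      ⟨p, s.left_mem, i, hji.symm, by obtain ⟨w, hw, e⟩ := hXp; exact ⟨w, toV hw, e⟩⟩
    have hUS : U ⊆ S := hUW ▸ Set.subset_union_left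
    by_cases hp'' : ∃ g, g ≠ j ∧ ∃ w ∈ A g ∪ C g, G.Adj p' w
    · obtain ⟨g, hgj, w', hw', hpw'⟩ := hp''
      by_cases hthird : ∃ f, f ≠ g ∧ f ≠ j ∧ ∃ w ∈ A f ∪ B f ∪ C f, G.Adj p' w
      · obtain ⟨f, hfg, hfj, w'', hw'', hpw''⟩ := hthird
        obtain rfl : p' = q := by
          refine hY p' (hUS sU.right_mem) ?_
          by_cases hgi : g = i
          · exact ⟨f, hgi ▸ hfg, w'', hw'', hpw''⟩
          · exact ⟨g, hgi, w', toV hw', hpw'⟩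
        exact H.no_vertex_three_strips hgj hfg.symm hfj.symm (hSO s.right_mem) ⟨w', hw', hpw'⟩
          ⟨w, hw, hqw⟩ ⟨w'', hw'', hpw''⟩
      · refine H.no_path_two_strips hgj sU.reverse (hUS.trans hSO) ⟨w', hw', hpw'⟩ ⟨w, hw, hqw⟩
          (fun u hu w hw e => hlast u hu ⟨g, hgj, w, hw, e⟩)
          (fun u hu w hw e => hY u (hUS hu) ⟨j, hji, w, hw, e⟩) ?_
        intro f hfg hfj u hu w hw e
        have := hlast u hu ⟨f, hfj, w, hw, e⟩
        subst this
        exact hthird ⟨f, hfg, hfj, w, hw, e⟩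
    · push Not at hp''
      refine H.no_path_to_bases sU (hUS.trans hSO) ⟨w, hw, hqw⟩
        (fun u hu w hw e => hY u (hUS hu) ⟨j, hji, w, toV hw, e⟩) hp' ?_
      intro u hu g hg w hw e
      have := hlast u hu ⟨g, hg, w, hw, e⟩
      subst this
      refine ⟨rfl, ?_⟩
      have := hp'' g hg w
      simp only [Set.mem_union] at hw this
      tauto
  · push Not at hq
    refine H.no_path_to_bases s hSO hXp (fun u hu w hw e => hX u hu ⟨w, hw, e⟩) hYq ?_
    intro u hu g hg w hw e
    have := hY u hu ⟨g, hg, w, hw, e⟩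
    subst this
    refine ⟨rfl, ?_⟩
    have := hq g hg w
    simp only [Set.mem_union] at hw this
    tauto

end MaximalSystem

end Components

/-- An induced path from the neighbour `t` of `v` to `b ∈ B h`, within `B h ∪ C h ∪ D h`. -/
structure Tail (G : SimpleGraph V) (a : V) {k : ℕ} (A B C : Fin k → Set V) (v : V) (h : Fin k)
    (t b : V) (T : Set V) (n : ℕ) : Prop where
  seg : Seg G t b T n
  sub : T ⊆ B h ∪ C h ∪ PSSD G a A B C h
  right : b ∈ B h
  adj : G.Adj v t
  first : ∀ u ∈ T, G.Adj v u → u = t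
  last : ∀ u ∈ T, u ∈ B h → u = b

section Tails

variable {G : SimpleGraph V} {a : V} {k : ℕ} {A B C : Fin k → Set V} {v : V} {i j h : Fin k}

theorem PSSD_subset : PSSD G a A B C i ⊆ Outside G a A B C := by
  rintro u ⟨F, ⟨hF, -⟩, hu⟩ hu'
  exact Set.disjoint_left.1 hF.2.1 hu hu'

theorem notMem_outside_of_adj (hav : G.Adj a v) : v ∉ Outside G a A B C :=
  fun h => h (Or.inr (mem_closedNbhd.2 (Or.inr hav)))

namespace MaximalSystem

theorem PSSD_anticomplete (H : MaximalSystem G a A B C) (hij : i ≠ j) {u w : V}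
    (hu : u ∈ PSSD G a A B C i) (hw : w ∈ A j ∪ B j ∪ C j) : ¬ G.Adj u w := by
  obtain ⟨F, ⟨hF, hi⟩, hu⟩ := hu
  exact H.component_anticomplete hF hi hij u hu w hw

theorem ac_PSSD (H : MaximalSystem G a A B C) (hij : i ≠ j) :
    AC G (PSSD G a A B C i) (PSSD G a A B C j) := by
  rintro u ⟨F, ⟨hF, hi⟩, hu⟩ w ⟨F', ⟨hF', x, hx, y, hy, hxy⟩, hw⟩
  have key : w ∉ F := fun hwF => by
    have hyF : y ∈ F := Joined.induct (hF'.1.2 w hw y hy) (· ∈ F)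
      (fun p _ q hq e hp => hF.2.2 p hp q (Set.disjoint_left.1 hF'.2.1 hq) e) hwF
    exact H.component_anticomplete hF hi hij y hyF x
      (hx.elim (fun h => Or.inl (Or.inl h)) Or.inr) hxy.symm
  exact ⟨fun e => key (e ▸ hu), fun e =>
    key (hF.2.2 u hu w (Set.disjoint_left.1 hF'.2.1 hw) e)⟩

theorem joined_of_mem_BC (H : MaximalSystem G a A B C) {w : V} (hw : w ∈ B h ∪ C h) :
    ∃ b ∈ B h, Joined G (B h ∪ C h) w b := by
  have hs := H.sys
  rcases hw with hw | hw
  · exact ⟨w, hw, Joined.refl (Or.inl hw)⟩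
  · obtain ⟨x, y, R, n, r, hwR⟩ := hs.exists_rung (Or.inr hw)
    have hwx : w ≠ x := fun e => hs.notMem_A (Or.inr hw) (e ▸ r.left)
    refine ⟨y, r.right, ((r.seg.reverse.joined_diff hwR hwx).mono ?_).symm⟩
    rintro u ⟨hu, hux⟩
    by_cases huy : u = y
    · exact Or.inl (huy ▸ r.right)
    · exact Or.inr (r.mid u hu hux huy)

theorem exists_tail (H : MaximalSystem G a A B C)
    (hconn : ConnectedSubset G ((closedNbhd G a)ᶜ))
    (hh : ∃ w ∈ B h ∪ C h ∪ PSSD G a A B C h, G.Adj v w) :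
    ∃ t b T n, Tail G a A B C v h t b T n := by
  have hs := H.sys
  have hfar : ∀ {w}, w ∈ B h ∪ C h → w ∉ closedNbhd G a := fun {w} hw hw' => by
    have hV : w ∈ A h ∪ B h ∪ C h := by
      simp only [Set.mem_union] at hw ⊢; tauto
    rcases mem_closedNbhd.1 hw' with e | e
    · exact hs.apex_ne hV e.symm
    · exact hs.notMem_A hw ((hs.apex_adj hV).1 e)
  obtain ⟨w, hw, hvw⟩ := hh
  have main : ∃ b ∈ B h, Joined G (B h ∪ C h ∪ PSSD G a A B C h) w b := by
    rcases hw with hw | hw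
    · obtain ⟨b, hb, hj⟩ := H.joined_of_mem_BC hw
      exact ⟨b, hb, hj.mono Set.subset_union_left⟩
    · obtain ⟨F, ⟨hF, hi⟩, hwF⟩ := hw
      have hFD : F ⊆ PSSD G a A B C h := fun u hu => ⟨F, ⟨hF, hi⟩, hu⟩
      have hFN : ∀ u ∈ F, u ∉ closedNbhd G a := fun u hu hu' =>
        Set.disjoint_left.1 hF.2.1 hu (Or.inr hu')
      obtain ⟨b₀, hb₀⟩ := (hs.2.1 h).2.1
      have hb₀F : b₀ ∉ F := fun hb => Set.disjoint_left.1 hF.2.1 hb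
        (Or.inl (mem_PSSVerts.2 (Or.inr ⟨h, Or.inl (Or.inr hb₀)⟩)))
      obtain ⟨u, hu, y, hyN, hyF, huy⟩ :
          ∃ u ∈ F, ∃ y, y ∉ closedNbhd G a ∧ y ∉ F ∧ G.Adj u y := by
        by_contra! hc
        exact hb₀F (Joined.induct (hconn.2 w (hFN w hwF) b₀ (hfar (Or.inl hb₀))) (· ∈ F)
          (fun p _ q hq e hp => by_contra fun hqF => hc p hp q hq hqF e) hwF)
      have hyV : y ∈ PSSVerts a A B C := by
        by_contra hyV
        exact hyF (hF.2.2 u hu y (fun hy => hy.elim hyV hyN) huy)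
      have hyBC : y ∈ B h ∪ C h := by
        rcases mem_PSSVerts.1 hyV with rfl | ⟨j, hyj⟩
        · exact (hyN (mem_closedNbhd.2 (Or.inl rfl))).elim
        · obtain rfl : h = j := by
            by_contra hne
            exact H.component_anticomplete hF hi hne u hu y hyj huy
          have : y ∉ A h := fun hA => hyN (mem_closedNbhd.2 (Or.inr ((hs.apex_adj hyj).2 hA)))
          simp only [Set.mem_union] at hyj ⊢
          tauto
      obtain ⟨b, hb, hj⟩ := H.joined_of_mem_BC hyBC
      have hwu : Joined G (B h ∪ C h ∪ PSSD G a A B C h) w u :=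
        Joined.mono (hF.1.2 w hwF u hu) fun u hu => Or.inr (hFD hu)
      exact ⟨b, hb, hwu.trans ((Joined.of_adj hwu.right_mem (Or.inl hyBC) huy).trans
        (hj.mono Set.subset_union_left))⟩
  obtain ⟨b, hb, hj⟩ := main
  obtain ⟨p, q, S, n, s, hS, hp, hq, hX, hY⟩ :=
    hj.exists_linking (fun u => G.Adj v u) (· ∈ B h) hvw hb
  exact ⟨p, q, S, n, s, hS, hq, hp, hX, hY⟩

variable {t b x y : V} {T R : Set V} {n m : ℕ}

theorem tail_apex (H : MaximalSystem G a A B C) (T' : Tail G a A B C v h t b T n) :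
    AC G {a} T := by
  rintro p rfl q hq
  rcases T'.sub hq with hq | hq
  · have hV : q ∈ A h ∪ B h ∪ C h := by
      simp only [Set.mem_union] at hq ⊢; tauto
    exact ⟨H.sys.apex_ne hV, fun e => H.sys.notMem_A hq ((H.sys.apex_adj hV).1 e)⟩
  · exact ac_apex PSSD_subset p rfl q hq

theorem tail_link (H : MaximalSystem G a A B C) (T' : Tail G a A B C v h t b T n)
    (r : Rung G (A i) (B i) (C i) x y R m) (hhi : h ≠ i) : Link G T R b y := by
  have hbV : b ∈ A h ∪ B h ∪ C h := Or.inl (Or.inr T'.right)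
  refine ⟨(H.sys.adj_iff hhi hbV (r.sub r.seg.right_mem)).2 ⟨T'.right, r.right⟩,
    fun p hp q hq => ?_⟩
  rcases T'.sub hp with hpV | hpD
  · have hV : p ∈ A h ∪ B h ∪ C h := by
      simp only [Set.mem_union] at hpV ⊢; tauto
    refine ⟨?_, fun e => ?_⟩
    · rintro rfl
      exact hhi (H.sys.index_eq hV (r.sub hq))
    · have := (H.sys.adj_iff hhi hV (r.sub hq)).1 e
      exact ⟨T'.last p hp this.1, H.sys.eq_right r hq this.2⟩
  · exact ⟨Outside.ne (PSSD_subset hpD) (r.sub hq),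
      fun e => (H.PSSD_anticomplete hhi hpD (r.sub hq) e).elim⟩

theorem tail_start (hav : G.Adj a v) (hv : v ∉ PSSVerts a A B C)
    (T' : Tail G a A B C v h t b T n) : Link G {v} T v t := by
  refine ⟨T'.adj, ?_⟩
  rintro p rfl q hq
  refine ⟨?_, fun e => ⟨rfl, T'.first q hq e⟩⟩
  rintro rfl
  rcases T'.sub hq with hq | hq
  · refine hv (mem_PSSVerts.2 (Or.inr ⟨h, ?_⟩))
    simp only [Set.mem_union] at hq ⊢; tauto
  · exact notMem_outside_of_adj hav (PSSD_subset hq)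

theorem rung_ne (hv : v ∉ PSSVerts a A B C) (r : Rung G (A i) (B i) (C i) x y R m) :
    ∀ u ∈ R, v ≠ u := by
  rintro u hu rfl
  exact hv (mem_PSSVerts.2 (Or.inr ⟨i, r.sub hu⟩))

theorem ac_rung (hv : v ∉ PSSVerts a A B C) (r : Rung G (A i) (B i) (C i) x y R m)
    (hx : ¬ G.Adj v x) (hBC : ∀ p ∈ B i ∪ C i, ¬ G.Adj v p) : AC G {v} R := by
  rintro p rfl q hq
  refine ⟨rung_ne hv r q hq, fun e => ?_⟩
  by_cases h1 : q = x
  · exact hx (h1 ▸ e)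
  · by_cases h2 : q = y
    · exact hBC q (Or.inl (h2 ▸ r.right)) e
    · exact hBC q (Or.inr (r.mid q hq h1 h2)) e

theorem link_rung (hv : v ∉ PSSVerts a A B C) (r : Rung G (A i) (B i) (C i) x y R m)
    (hx : G.Adj v x) (hBC : ∀ p ∈ B i ∪ C i, ¬ G.Adj v p) : Link G {v} R v x := by
  refine ⟨hx, ?_⟩
  rintro p rfl q hq
  refine ⟨rung_ne hv r q hq, fun e => ⟨rfl, ?_⟩⟩
  by_contra h1
  by_cases h2 : q = y
  · exact hBC q (Or.inl (h2 ▸ r.right)) e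
  · exact hBC q (Or.inr (r.mid q hq h1 h2)) e

/-- If `v` misses a rung and has a tail, then it misses `A j` whenever it misses `B j ∪ C j`. -/
theorem anticomplete_A (H : MaximalSystem G a A B C) (hav : G.Adj a v)
    (hv : v ∉ PSSVerts a A B C) (T' : Tail G a A B C v h t b T n)
    (r : Rung G (A i) (B i) (C i) x y R m) (hvR : AC G {v} R) (hih : i ≠ h) (hjh : j ≠ h)
    (hj : ∀ p ∈ B j ∪ C j, ¬ G.Adj v p) : ∀ p ∈ A j, ¬ G.Adj v p := by
  intro p hp hvp
  obtain ⟨y', R', m', r'⟩ := H.sys.rung_from hp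
  have sv := Seg.single (G := G) v
  have hst := tail_start hav hv T'
  have hav' := link_single hav
  have := H.sys.two_le r'
  have := T'.seg.pos
  have H1 := hole4 H.evenHoleFree (Seg.single a) sv T'.seg r.seg.reverse hav' hst
    (H.tail_link T' r hih.symm) (H.sys.apex r).symm (H.tail_apex T') hvR
  have H2 := hole3 H.evenHoleFree sv T'.seg r'.seg.reverse hst (H.tail_link T' r' hjh.symm)
    (link_rung hv r' hvp hj).symm (by omega)
  have := H.sys.parity H.evenHoleFree r r'
  omega

/-- A vertex with a tail that misses a rung cannot miss a further strip and have a neighbour in the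
corresponding set `D j`. -/
theorem no_neighbour_PSSD (H : MaximalSystem G a A B C) (hav : G.Adj a v)
    (hv : v ∉ PSSVerts a A B C) (T' : Tail G a A B C v h t b T n)
    (r : Rung G (A i) (B i) (C i) x y R m) (hvR : AC G {v} R) (hih : i ≠ h) (hjh : j ≠ h)
    (hij : i ≠ j) (hj : ∀ p ∈ A j ∪ B j ∪ C j, ¬ G.Adj v p) :
    ∀ p ∈ PSSD G a A B C j, ¬ G.Adj v p := by
  rintro p hpD hvp
  obtain ⟨F, ⟨hF, w, hw, u, hu, hwu⟩, hp⟩ := id hpD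
  have hFD : F ⊆ PSSD G a A B C j := fun u' hu' => ⟨F, ⟨hF, w, hw, u, hu, hwu⟩, hu'⟩
  obtain ⟨x', y', R', m', r', hwR⟩ :=
    H.sys.exists_rung (hw.elim (fun h => Or.inl (Or.inl h)) Or.inr)
  obtain ⟨p₁, p₂, P, l, s, hP, hp₁, hp₂, hX, hY⟩ := Joined.exists_linking (hF.1.2 p hp u hu)
    (fun u => G.Adj v u) (fun u => ∃ w ∈ R', G.Adj u w) hvp ⟨w, hwR, hwu.symm⟩
  have hPD := hP.trans hFD
  have hPO := hPD.trans PSSD_subset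
  have hst := tail_start hav hv T'
  have hav' := link_single hav
  have hvR' : AC G {v} R' := by
    rintro _ rfl q hq
    exact ⟨rung_ne hv r' q hq, hj q (r'.sub hq)⟩
  have hvP : Link G {v} P v p₁ := ⟨hp₁, by
    rintro _ rfl q hq
    exact ⟨fun e => notMem_outside_of_adj hav (e ▸ hPO hq), fun e => ⟨rfl, hX q hq e⟩⟩⟩
  have hTP : AC G T P := by
    intro q hq u hu
    rcases T'.sub hq with hqV | hqD
    · have hqV' : q ∈ A h ∪ B h ∪ C h := by
        simp only [Set.mem_union] at hqV ⊢; tauto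
      exact ⟨(Outside.ne (hPO hu) hqV').symm, fun e =>
        H.PSSD_anticomplete hjh (hPD hu) hqV' e.symm⟩
    · exact H.ac_PSSD hjh.symm q hqD u (hPD hu)
  refine pyramid_no_path H.evenHoleFree H.no_extNearPrism ((Seg.single v).append T'.seg hst)
    r'.seg r.seg (hav'.union_right (H.tail_apex T')) (H.sys.apex r') (H.sys.apex r) ?_
    (H.sys.ne r') ((H.tail_link T' r' hjh.symm).union_left' hvR')
    ((H.tail_link T' r hih.symm).union_left' hvR) (H.sys.link r' r hij.symm) s (ac_apex hPO) ?_
    (hvP.union_left hTP) (fun p hp q hq => ⟨Outside.ne (hPO hp) (r'.sub hq),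
      fun e => hY p hp ⟨q, hq, e⟩⟩) hp₂
  · exact (hst.2 v rfl b T'.seg.right_mem).1
  · exact fun p hp q hq => ⟨Outside.ne (hPO hp) (r.sub hq),
      H.PSSD_anticomplete hij.symm (hPD hp) (r.sub hq)⟩

/-- If `v` has a tail into strip `h` and misses a rung elsewhere, then the interior of the tail
meets or attaches to `A h ∪ C h`. -/
theorem tail_attaches (H : MaximalSystem G a A B C) (hav : G.Adj a v)
    (hv : v ∉ PSSVerts a A B C) (T' : Tail G a A B C v h t b T n)
    (r : Rung G (A i) (B i) (C i) x y R m) (hvR : AC G {v} R) (hih : i ≠ h) :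
    ∃ w ∈ ({v} ∪ T) \ {b}, ∃ u ∈ A h ∪ C h, w = u ∨ G.Adj w u := by
  by_contra! hc
  have hst := tail_start hav hv T'
  have hav' := link_single hav
  have hvb : v ≠ b := (hst.2 v rfl b T'.seg.right_mem).1
  obtain ⟨x', R', m', r'⟩ := H.sys.rung_to T'.right
  have hbx := H.sys.ne r'
  obtain ⟨z, S, l, hl, s, hbz, hS, hRS⟩ : ∃ z S l, m' = l + 1 ∧ Seg G z x' S l ∧ G.Adj b z ∧
      (∀ w ∈ S, w ≠ b ∧ (G.Adj b w → w = z)) ∧ R' = insert b S := by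
    cases r'.seg.reverse with
    | single => exact (hbx rfl).elim
    | @cons _ z _ S _ l hxy s hx hT => exact ⟨z, S, l, rfl, s, hxy, hx, hT⟩
  have hSR : S ⊆ R' := hRS ▸ Set.subset_insert _ _
  have hSA : S ⊆ A h ∪ C h := fun u hu => by
    by_cases e : u = x'
    · exact Or.inl (e ▸ r'.left)
    · exact Or.inr (r'.mid u (hSR hu) e (hS u hu).1)
  have hTS : Link G T S b z := by
    refine ⟨hbz, fun p hp q hq => ?_⟩
    by_cases hpb : p = b
    · subst hpb
      exact ⟨(hS q hq).1.symm, fun e => ⟨rfl, (hS q hq).2 e⟩⟩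
    · have := hc p ⟨Or.inr hp, hpb⟩ q (hSA hq)
      exact ⟨this.1, fun e => (this.2 e).elim⟩
  have H1 := hole4 H.evenHoleFree (Seg.single a) (Seg.single v) T'.seg s hav' hst hTS
    ((H.sys.apex r').symm.mono hSR subset_rfl) (H.tail_apex T') (by
      rintro _ rfl q hq
      exact hc _ ⟨Or.inl rfl, hvb⟩ q (hSA hq))
  have H2 := hole4 H.evenHoleFree (Seg.single a) (Seg.single v) T'.seg r.seg.reverse hav' hst
    (H.tail_link T' r hih.symm) (H.sys.apex r).symm (H.tail_apex T') hvR
  have := H.sys.parity H.evenHoleFree r r'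
  omega

/-- If `v` has a tail and misses two strips, then the other strips can be merged. -/
theorem no_two_missed (H : MaximalSystem G a A B C)
    (hconn : ConnectedSubset G ((closedNbhd G a)ᶜ)) (hav : G.Adj a v)
    (hv : v ∉ PSSVerts a A B C) (hij : i ≠ j)
    (hi : ∀ w ∈ B i ∪ C i ∪ PSSD G a A B C i, ¬ G.Adj v w)
    (hj : ∀ w ∈ B j ∪ C j ∪ PSSD G a A B C j, ¬ G.Adj v w)
    (hh : ∃ w ∈ B h ∪ C h ∪ PSSD G a A B C h, G.Adj v w)
    (hA : ∀ l, (∀ w ∈ B l ∪ C l ∪ PSSD G a A B C l, ¬ G.Adj v w) → ∀ w ∈ A l, ¬ G.Adj v w) :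
    False := by
  have hs := H.sys
  set K : Set (Fin k) := {l | ∀ w ∈ B l ∪ C l ∪ PSSD G a A B C l, ¬ G.Adj v w} with hK
  have htail : ∀ l, l ∉ K → ∃ T, ∃ t b n, Tail G a A B C v l t b T n := by
    intro l hl
    simp only [hK, Set.mem_ofPred_eq, not_forall, not_not] at hl
    obtain ⟨w, hw, e⟩ := hl
    obtain ⟨t, b, T, n, T'⟩ := H.exists_tail hconn ⟨w, hw, e⟩
    exact ⟨T, t, b, n, T'⟩
  choose T t b n hT using htail
  have hhK : h ∉ K := fun hhK => by
    obtain ⟨w, hw, e⟩ := hh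
    exact hhK w hw e
  obtain ⟨x, y, R, m, r⟩ := hs.rung i
  have hvR : AC G {v} R := by
    refine ac_rung hv r (hA i hi x r.left) fun p hp => hi p (Or.inl hp)
  set XC : Set V := ⋃ l, ⋃ hl : l ∉ K, T l hl \ PSSVerts a A B C with hXC
  have memXC : ∀ w, w ∈ XC ↔ ∃ l, ∃ hl : l ∉ K, w ∈ T l hl ∧ w ∉ PSSVerts a A B C := by
    simp [hXC]
  have hmid : ∀ l (hl : l ∉ K), ∀ w ∈ T l hl, w ≠ b l hl → w ∈ (⋃ l ∈ Kᶜ, C l) ∪ XC := by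
    intro l hl w hw hwb
    rcases (hT l hl).sub hw with (hw' | hw') | hw'
    · exact (hwb ((hT l hl).last w hw hw')).elim
    · exact Or.inl (Set.mem_biUnion hl hw')
    · exact Or.inr ((memXC w).2 ⟨l, hl, hw, fun hw'' => PSSD_subset hw' (Or.inl hw'')⟩)
  have hseg : ∀ l (hl : l ∉ K), Seg G v (b l hl) ({v} ∪ T l hl) (1 + n l hl) := fun l hl =>
    (Seg.single v).append (hT l hl).seg (tail_start hav hv (hT l hl))
  have hM : ∀ l (hl : l ∉ K), ({v} ∪ T l hl) \ {b l hl} ⊆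
      ((⋃ l ∈ Kᶜ, A l) ∪ {v}) ∪ ((⋃ l ∈ Kᶜ, C l) ∪ XC) := by
    rintro l hl w ⟨hw | hw, hwb⟩
    · exact Or.inl (Or.inr hw)
    · exact Or.inr (hmid l hl w hw hwb)
  have hrung : ∀ l (hl : l ∉ K), Rung G ((⋃ l ∈ Kᶜ, A l) ∪ {v}) ((⋃ l ∈ Kᶜ, B l) ∪ ∅)
      ((⋃ l ∈ Kᶜ, C l) ∪ XC) v (b l hl) ({v} ∪ T l hl) (1 + n l hl) := by
    intro l hl
    refine ⟨hseg l hl, Or.inr rfl, Or.inl (Set.mem_biUnion hl (hT l hl).right), ?_⟩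
    rintro w (hw | hw) hwv hwb
    · exact (hwv hw).elim
    · exact hmid l hl w hw hwb
  have hbv : ∀ l (hl : l ∉ K), v ≠ b l hl := fun l hl =>
    ((tail_start hav hv (hT l hl)).2 v rfl _ (hT l hl).seg.right_mem).1
  have hvM : v ∈ ((⋃ l ∈ Kᶜ, A l) ∪ {v}) ∪ ((⋃ l ∈ Kᶜ, C l) ∪ XC) := Or.inl (Or.inr rfl)
  have := hs.no_merge H.connected H.maximal K (i := i) (j := j) hi hj hij
    (XA := {v}) (XB := ∅) (XC := XC) rfl rfl rfl ?_ ?_ ?_ (by simp) ?_ (by simp) ?_ v ?_ ?_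
  · exact Set.notMem_empty v (this ▸ Or.inl (Or.inl rfl))
  · rintro w rfl
    exact hav
  · rintro w (hw | hw)
    · exact hw.elim
    · obtain ⟨l, hl, hw, -⟩ := (memXC w).1 hw
      exact (H.tail_apex (hT l hl) a rfl w hw).2
  · rintro w ((rfl | hw) | hw)
    · exact hv
    · exact hw.elim
    · obtain ⟨l, hl, -, hw⟩ := (memXC w).1 hw
      exact hw
  · rintro l hl w (rfl | hw) u hu
    · rcases hu with (hu | hu) | hu
      · exact hA l hl u hu
      · exact hl u (Or.inl (Or.inl hu))
      · exact hl u (Or.inl (Or.inr hu))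
    · obtain ⟨l', hl', hw, hw'⟩ := (memXC w).1 hw
      rcases (hT l' hl').sub hw with hwV | hwD
      · refine (hw' (mem_PSSVerts.2 (Or.inr ⟨l', ?_⟩))).elim
        simp only [Set.mem_union] at hwV ⊢; tauto
      · exact H.PSSD_anticomplete (fun e : l' = l => hl' (e ▸ hl)) hwD hu
  · rintro w ((rfl | hw) | hw)
    · exact ⟨_, _, _, _, hrung h hhK, Or.inl rfl⟩
    · exact hw.elim
    · obtain ⟨l, hl, hw, -⟩ := (memXC w).1 hw
      exact ⟨_, _, _, _, hrung l hl, Or.inr hw⟩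
  · intro l hl
    obtain ⟨w, hw, u, hu, e⟩ := H.tail_attaches hav hv (hT l hl) r hvR fun e => hl (e ▸ hi)
    have hvw := ((hseg l hl).joined_diff hw.1 hw.2).mono (hM l hl)
    refine ⟨u, hu, ?_⟩
    rcases e with rfl | e
    · exact hvw
    · refine hvw.trans (Joined.of_adj hvw.right_mem ?_ e)
      rcases hu with hu | hu
      · exact Or.inl (Or.inl (Set.mem_biUnion hl hu))
      · exact Or.inr (Or.inl (Set.mem_biUnion hl hu))
  · rintro w (rfl | hw)
    · exact Joined.refl hvM
    · obtain ⟨l, hl, hw, hw'⟩ := (memXC w).1 hw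
      refine ((hseg l hl).joined_diff (Or.inr hw) fun e => hw' ?_).mono (hM l hl)
      exact mem_PSSVerts.2 (Or.inr ⟨l, e ▸ Or.inl (Or.inr (hT l hl).right)⟩)

/-- A vertex of `N(a)` with a neighbour in some `B h ∪ C h ∪ D h` has type `α`, `α'` or `β`. -/
theorem type_of_hit (H : MaximalSystem G a A B C)
    (hconn : ConnectedSubset G ((closedNbhd G a)ᶜ)) (hav : G.Adj a v)
    (hv : v ∉ PSSVerts a A B C)
    (hh : ∃ h, ∃ w ∈ B h ∪ C h ∪ PSSD G a A B C h, G.Adj v w) :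
    TypeAlpha G A B C v ∨ TypeAlpha' G a A B C v ∨ TypeBeta G A B C v := by
  have hs := H.sys
  by_contra! hcon
  obtain ⟨hα, hα', hβ⟩ := hcon
  simp only [TypeAlpha, not_forall, not_or, not_exists, not_and] at hα
  obtain ⟨i, hiBC, x, hx, hvx⟩ := hα
  obtain ⟨y, R, m, r⟩ := hs.rung_from hx
  have hvR := ac_rung hv r hvx hiBC
  set hit : Fin k → Prop := fun h => ∃ w ∈ B h ∪ C h ∪ PSSD G a A B C h, G.Adj v w with hhit
  have not_hit : ∀ {l}, ¬ hit l → ∀ w ∈ B l ∪ C l ∪ PSSD G a A B C l, ¬ G.Adj v w :=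
    fun hl w hw e => hl ⟨w, hw, e⟩
  have not_hit' : ∀ {l}, ¬ hit l → ∀ w ∈ B l ∪ C l, ¬ G.Adj v w :=
    fun hl w hw => not_hit hl w (Or.inl hw)
  have dagger : ∀ {i h j}, (∃ x y R m, Rung G (A i) (B i) (C i) x y R m ∧ AC G {v} R) → hit h →
      i ≠ h → j ≠ h → (∀ p ∈ B j ∪ C j, ¬ G.Adj v p) → ∀ p ∈ A j, ¬ G.Adj v p := by
    rintro i h j ⟨x, y, R, m, r, hvR⟩ hh hih hjh hj
    obtain ⟨t, b, T, n, T'⟩ := H.exists_tail hconn hh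
    exact H.anticomplete_A hav hv T' r hvR hih hjh hj
  have bad : ∀ {i}, (∀ p ∈ B i ∪ C i, ¬ G.Adj v p) → (∀ p ∈ A i, ¬ G.Adj v p) →
      ∃ x y R m, Rung G (A i) (B i) (C i) x y R m ∧ AC G {v} R := by
    intro i h1 h2
    obtain ⟨x, y, R, m, r⟩ := hs.rung i
    exact ⟨x, y, R, m, r, ac_rung hv r (h2 x r.left) h1⟩
  obtain ⟨h, hh⟩ := hh
  by_cases hone : ∀ l, hit l → l = h
  · by_cases hbad : ∃ i, i ≠ h ∧ ∃ x ∈ A i, ¬ G.Adj v x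
    · obtain ⟨i, hih, x, hx, hvx⟩ := hbad
      have hni : ¬ hit i := fun e => hih (hone i e)
      obtain ⟨y, R, m, r⟩ := hs.rung_from hx
      have hb : ∃ x y R m, Rung G (A i) (B i) (C i) x y R m ∧ AC G {v} R :=
        ⟨x, y, R, m, r, ac_rung hv r hvx (not_hit' hni)⟩
      obtain ⟨j, hji, hjh⟩ := exists_ne_ne hs.1 i h
      have hnj : ¬ hit j := fun e => hjh (hone j e)
      refine H.no_two_missed hconn hav hv hji.symm (not_hit hni) (not_hit hnj) hh fun l hl => ?_
      refine dagger hb hh hih (fun e => ?_) fun w hw => hl w (Or.inl hw)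
      subst e
      obtain ⟨w, hw, e⟩ := hh
      exact hl w hw e
    · push Not at hbad
      obtain rfl : i = h := by
        by_contra hne
        exact hvx (hbad i hne x hx)
      refine hα' ⟨i, ?_, hiBC, fun j hj => ⟨hbad j hj, not_hit fun e => hj (hone j e)⟩⟩
      obtain ⟨w, hw | hw, e⟩ := hh
      · exact (hiBC w hw e).elim
      · exact ⟨w, hw, e⟩
  · push Not at hone
    obtain ⟨h', hh', hne⟩ := hone
    have bi : ∃ x y R m, Rung G (A i) (B i) (C i) x y R m ∧ AC G {v} R := ⟨x, y, R, m, r, hvR⟩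
    have anti : ∀ j, (∀ p ∈ B j ∪ C j, ¬ G.Adj v p) → ∀ p ∈ A j, ¬ G.Adj v p := by
      intro j hj
      by_cases hex : ∃ l, hit l ∧ l ≠ i ∧ l ≠ j
      · obtain ⟨l, hl, hli, hlj⟩ := hex
        exact dagger bi hl hli.symm hlj.symm hj
      · push Not at hex
        obtain ⟨hj', hi', hij⟩ : hit j ∧ hit i ∧ i ≠ j := by
          have h1 := hex h hh
          have h2 := hex h' hh'
          by_cases e : h = i
          · have e' : h' ≠ i := fun e' => hne (e'.trans e.symm)
            have := h2 e'
            exact ⟨this ▸ hh', e ▸ hh, fun e'' => e' (this.trans e''.symm)⟩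
          · have := h1 e
            have e' : h' = i := by
              by_contra e'
              exact hne ((h2 e').trans this.symm)
            exact ⟨this ▸ hh, e' ▸ hh', fun e'' => e (this.trans e''.symm)⟩
        obtain ⟨g, hgi, hgj⟩ := exists_ne_ne hs.1 i j
        have hng : ¬ hit g := fun e => hgj (hex g e hgi)
        have hgA := dagger bi hj' hij hgj (not_hit' hng)
        exact dagger (bad (not_hit' hng) hgA) hi' hgi hij.symm hj
    have antiV : ∀ j, (∀ p ∈ B j ∪ C j, ¬ G.Adj v p) → ∀ p ∈ A j ∪ B j ∪ C j, ¬ G.Adj v p := by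
      rintro j hj p ((hp | hp) | hp)
      · exact anti j hj p hp
      · exact hj p (Or.inl hp)
      · exact hj p (Or.inr hp)
    have two : ∀ i j, i ≠ j → ¬ hit i → hit j := by
      intro i j hij hi
      by_contra hj
      exact H.no_two_missed hconn hav hv hij (not_hit hi) (not_hit hj) hh fun l hl =>
        anti l fun w hw => hl w (Or.inl hw)
    have ddagger : ∀ i j h, i ≠ h → j ≠ h → i ≠ j → hit h → (∀ p ∈ B i ∪ C i, ¬ G.Adj v p) →
        hit j → ∃ p ∈ B j ∪ C j, G.Adj v p := by
      intro i j h hih hjh hij hh hi hj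
      by_contra! hc
      obtain ⟨t, b, T, n, T'⟩ := H.exists_tail hconn hh
      obtain ⟨x, y, R, m, r, hvR⟩ := bad hi (anti i hi)
      obtain ⟨w, hw | hw, e⟩ := hj
      · exact hc w hw e
      · exact H.no_neighbour_PSSD hav hv T' r hvR hih hjh hij (antiV j hc) w hw e
    refine hβ ⟨i, antiV i hiBC, fun j hji => ?_⟩
    by_contra! hj
    obtain ⟨g, hgi, hgj⟩ := exists_ne_ne hs.1 i j
    have key : ∀ i j, i ≠ j → g ≠ i → g ≠ j → (∀ p ∈ B i ∪ C i, ¬ G.Adj v p) →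
        (∀ p ∈ B j ∪ C j, ¬ G.Adj v p) → hit g → hit j → False := by
      intro i j hij hgi hgj hi hj hg hhj
      obtain ⟨p, hp, e⟩ := ddagger i j g hgi.symm hgj.symm hij hg hi hhj
      exact hj p hp e
    by_cases hhi : hit i
    · by_cases hhg : hit g
      · exact key j i hji hgj hgi hj hiBC hhg hhi
      · have hhj := two g j hgj hhg
        obtain ⟨p, hp, e⟩ := ddagger g j i hgi hji hgj hhi (not_hit' hhg) hhj
        exact hj p hp e
    · exact key i j hji.symm hgi hgj hiBC hj (two i g hgi.symm hhi) (two i j hji.symm hhi)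

end MaximalSystem

end Tails

section MixedRungs

variable {G : SimpleGraph V} {a : V} {k : ℕ} {A B C : Fin k → Set V} {i : Fin k}

theorem Joined.exists_rung {X Y Z : Set V} {x y : V} (hx : x ∈ X) (hy : y ∈ Y)
    (hxy : Joined G ({x} ∪ Z ∪ {y}) x y) : ∃ R m, Rung G X Y Z x y R m := by
  obtain ⟨R, m, s, hR⟩ := hxy.exists_seg
  refine ⟨R, m, s, hx, hy, fun w hw hwx hwy => ?_⟩
  rcases hR hw with (hw | hw) | hw
  · exact (hwx hw).elim
  · exact hw
  · exact (hwy hw).elim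

/-- If a non-constant property of the vertices of `A i` is determined by the other end of any
rung, then there are two rungs whose only edge is between their ends in `A i`. -/
theorem IsPyramidStripSystem.exists_mixed_rungs (hs : IsPyramidStripSystem G a A B C)
    (hG : EvenHoleFree G) (hidc : ConnectedSubset G (A i ∪ C i)) {M N : V → Prop}
    (hMN : ∀ x y R m, Rung G (A i) (B i) (C i) x y R m → (M x ↔ N y)) {x x' : V} (hx : x ∈ A i)
    (hMx : M x) (hx' : x' ∈ A i) (hMx' : ¬ M x') :
    ∃ x₁ y₁ R₁ m₁ x₂ y₂ R₂ m₂, Rung G (A i) (B i) (C i) x₁ y₁ R₁ m₁ ∧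
      Rung G (A i) (B i) (C i) x₂ y₂ R₂ m₂ ∧ M x₁ ∧ ¬ M x₂ ∧ Link G R₁ R₂ x₁ x₂ := by
  have hpass : ∀ x ∈ A i, ∀ y ∈ B i, ∀ c d, Joined G ({x} ∪ C i) x c →
      Joined G (C i ∪ {y}) d y → (c = d ∨ G.Adj c d) → (M x ↔ N y) := by
    intro x hx y hy c d hxc hdy e
    have hxc' : Joined G ({x} ∪ C i ∪ {y}) x c := hxc.mono Set.subset_union_left
    have hdy' : Joined G ({x} ∪ C i ∪ {y}) d y := hdy.mono (by
      rw [Set.union_assoc]; exact Set.subset_union_right)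
    obtain ⟨R, m, r⟩ : ∃ R m, Rung G (A i) (B i) (C i) x y R m := by
      refine Joined.exists_rung hx hy ?_
      rcases e with rfl | e
      · exact hxc'.trans hdy'
      · exact hxc'.trans ((Joined.of_adj hxc'.right_mem hdy'.left_mem e).trans hdy')
    exact hMN x y R m r
  have hstart : ∀ {x y R m} (r : Rung G (A i) (B i) (C i) x y R m) {u}, u ∈ R → u ≠ y →
      Joined G ({x} ∪ C i) x u := by
    refine fun {x y R m} r {u} hu huy => (r.seg.joined_diff hu huy).mono fun w hw => ?_
    by_cases hwx : w = x
    · exact Or.inl hwx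
    · exact Or.inr (r.mid w hw.1 hwx hw.2)
  have hend : ∀ {x y R m} (r : Rung G (A i) (B i) (C i) x y R m) {u}, u ∈ R → u ≠ x →
      Joined G (C i ∪ {y}) u y := by
    refine fun {x y R m} r {u} hu hux =>
      ((r.seg.reverse.joined_diff hu hux).mono fun w hw => ?_).symm
    by_cases hwy : w = y
    · exact Or.inr hwy
    · exact Or.inl (r.mid w hw.1 hw.2 hwy)
  obtain ⟨p, q, S, n, s, hS, ⟨hp, hMp⟩, ⟨hq, hMq⟩, hX, hY⟩ := Joined.exists_linking
    (hidc.2 x (Or.inl hx) x' (Or.inl hx')) (fun u => u ∈ A i ∧ M u) (fun u => u ∈ A i ∧ ¬ M u)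
    ⟨hx, hMx⟩ ⟨hx', hMx'⟩
  have hpq : p ≠ q := fun e => hMq (e ▸ hMp)
  have hSC : ∀ c ∈ S, c ≠ p → c ≠ q → c ∈ C i := by
    intro c hc hcp hcq
    refine (hS hc).resolve_left fun hcA => ?_
    by_cases hM : M c
    · exact hcp (hX c hc ⟨hcA, hM⟩)
    · exact hcq (hY c hc ⟨hcA, hM⟩)
  have hint : ∀ c ∈ S, c ≠ p → c = q := by
    intro c hc hcp
    by_contra hcq
    have hcC := hSC c hc hcp hcq
    obtain ⟨x₀, y₀, R₀, m₀, r₀, hcR⟩ := hs.exists_rung (Or.inr hcC)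
    have hcy := hend r₀ hcR fun e => hs.notMem_A (Or.inr hcC) (e ▸ r₀.left)
    have h1 := hpass p hp y₀ r₀.right c c ((s.joined_diff hc hcq).mono fun w hw => by
      by_cases hwp : w = p
      · exact Or.inl hwp
      · exact Or.inr (hSC w hw.1 hwp hw.2)) hcy (Or.inl rfl)
    have h2 := hpass q hq y₀ r₀.right c c ((s.reverse.joined_diff hc hcp).mono fun w hw => by
      by_cases hwq : w = q
      · exact Or.inl hwq
      · exact Or.inr (hSC w hw.1 hw.2 hwq)) hcy (Or.inl rfl)
    exact hMq (h2.2 (h1.1 hMp))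
  have hadj : G.Adj p q := by
    obtain ⟨z, hz, hzp, hpz⟩ : ∃ z ∈ S, z ≠ p ∧ G.Adj p z := by
      cases s with
      | single => exact (hpq rfl).elim
      | @cons _ z _ S _ l hxy s hx hT =>
        exact ⟨z, hT ▸ Or.inr s.left_mem, hxy.ne', hxy⟩
    exact hint z hz hzp ▸ hpz
  obtain ⟨y₁, R₁, m₁, r₁⟩ := hs.rung_from hp
  obtain ⟨y₂, R₂, m₂, r₂⟩ := hs.rung_from hq
  have hN₁ : N y₁ := (hMN _ _ _ _ r₁).1 hMp
  have hN₂ : ¬ N y₂ := fun e => hMq ((hMN _ _ _ _ r₂).2 e)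
  have hy : y₁ ≠ y₂ := fun e => hN₂ (e ▸ hN₁)
  have hcross : ∀ u ∈ R₁, ∀ w ∈ R₂, (u = w ∨ G.Adj u w) →
      (u = y₁ ∧ w = y₂) ∨ (u = p ∧ w = q) := by
    intro u hu w hw e
    have h1 : u = y₁ ∨ w = q := by
      by_contra! hc
      exact hN₂ ((hpass p hp y₂ r₂.right u w (hstart r₁ hu hc.1) (hend r₂ hw hc.2) e).1 hMp)
    have h2 : w = y₂ ∨ u = p := by
      by_contra! hc
      exact hMq ((hpass q hq y₁ r₁.right w u (hstart r₂ hw hc.1) (hend r₁ hu hc.2)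
        (e.imp Eq.symm Adj.symm)).2 hN₁)
    have := hs.ne r₁
    have := hs.ne r₂
    grind
  have hne : ∀ u ∈ R₁, ∀ w ∈ R₂, u ≠ w := by
    rintro u hu w hw rfl
    rcases hcross u hu u hw (Or.inl rfl) with ⟨rfl, e⟩ | ⟨rfl, e⟩
    · exact hy e
    · exact hpq e
  have hy₁₂ : ¬ G.Adj y₁ y₂ := by
    intro e
    have := hs.two_le r₁
    have := hs.two_le r₂
    have := hole2 hG r₁.seg r₂.seg.reverse e hadj.symm (fun u hu w hw =>
      ⟨hne u hu w hw, fun e => hcross u hu w hw (Or.inr e)⟩) (by omega)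
    have := hs.parity hG r₁ r₂
    omega
  refine ⟨p, y₁, R₁, m₁, q, y₂, R₂, m₂, r₁, r₂, hMp, hMq, hadj, fun u hu w hw =>
    ⟨hne u hu w hw, fun e => (hcross u hu w hw (Or.inr e)).resolve_left ?_⟩⟩
  rintro ⟨rfl, rfl⟩
  exact hy₁₂ e

end MixedRungs

/-- An induced path, outside `V(𝒮) ∪ N[a]`, from the neighbour `t` of `v` to the vertex `q`, such
that all edges between the path and the strips are between `q` and the sets `B i`. -/
structure OuterPath (G : SimpleGraph V) (a : V) {k : ℕ} (A B C : Fin k → Set V) (v t q : V)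
    (S : Set V) (n : ℕ) : Prop where
  seg : Seg G t q S n
  sub : S ⊆ Outside G a A B C
  adj : G.Adj v t
  first : ∀ u ∈ S, G.Adj v u → u = t
  base : ∃ i, ∃ b ∈ B i, G.Adj q b
  last : ∀ u ∈ S, ∀ i, ∀ w ∈ A i ∪ B i ∪ C i, G.Adj u w → u = q ∧ w ∈ B i

section OuterPaths

variable {G : SimpleGraph V} {a : V} {k : ℕ} {A B C : Fin k → Set V} {v : V} {i j h : Fin k}

theorem MaximalSystem.exists_outerPath (H : MaximalSystem G a A B C)
    (hconn : ConnectedSubset G ((closedNbhd G a)ᶜ))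
    (hno : ∀ l, ∀ w ∈ B l ∪ C l ∪ PSSD G a A B C l, ¬ G.Adj v w) {w : V}
    (hw : w ∉ closedNbhd G a) (hvw : G.Adj v w) :
    ∃ t q S n, OuterPath G a A B C v t q S n := by
  have hs := H.sys
  have hBC : ∀ {i u}, u ∈ A i ∪ B i ∪ C i → u ∉ closedNbhd G a → u ∈ B i ∪ C i := by
    intro i u hu hua
    have : u ∉ A i := fun hA => hua (mem_closedNbhd.2 (Or.inr ((hs.apex_adj hu).2 hA)))
    simp only [Set.mem_union] at hu ⊢
    tauto
  have hwO : w ∈ Outside G a A B C := by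
    rintro (hwV | hwa)
    · rcases mem_PSSVerts.1 hwV with rfl | ⟨i, hi⟩
      · exact hw (mem_closedNbhd.2 (Or.inl rfl))
      · exact hno i w (Or.inl (hBC hi hw)) hvw
    · exact hw hwa
  set F : Set V := {u | Joined G (Outside G a A B C) w u} with hFdef
  have hwF : w ∈ F := Joined.refl hwO
  have hFO : F ⊆ Outside G a A B C := fun u hu => Joined.right_mem hu
  have hFcl : ∀ u ∈ F, ∀ y ∈ Outside G a A B C, G.Adj u y → y ∈ F := fun u hu y hy e =>
    Joined.trans hu (Joined.of_adj (hFO hu) hy e)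
  have hFj : ∀ u ∈ F, Joined G F w u := by
    intro u hu
    obtain ⟨S, n, s, hS⟩ := Joined.exists_seg hu
    exact (s.joined s.right_mem).mono fun y hy => (s.joined hy).mono hS
  have hFc : IsComponentOf G (PSSVerts a A B C ∪ closedNbhd G a) F :=
    ⟨⟨⟨w, hwF⟩, fun x hx y hy => (hFj x hx).symm.trans (hFj y hy)⟩,
      Set.disjoint_left.2 hFO, hFcl⟩
  have hFAC : ∀ i, ∀ x ∈ A i ∪ C i, ∀ u ∈ F, ¬ G.Adj u x := fun i x hx u hu e =>
    hno i w (Or.inr ⟨F, ⟨hFc, x, hx, u, hu, e.symm⟩, hwF⟩) hvw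
  have hFB : ∀ u ∈ F, ∀ i, ∀ x ∈ A i ∪ B i ∪ C i, G.Adj u x → x ∈ B i := by
    intro u hu i x hx e
    by_contra hB
    refine hFAC i x ?_ u hu e
    simp only [Set.mem_union] at hx ⊢
    tauto
  obtain ⟨u, hu, i, b, hb, hub⟩ : ∃ u ∈ F, ∃ i, ∃ b ∈ B i, G.Adj u b := by
    by_contra! hc
    have hk := hs.1
    obtain ⟨b₀, hb₀⟩ := (hs.2.1 ⟨0, by omega⟩).2.1
    have hb₀V : b₀ ∈ A ⟨0, by omega⟩ ∪ B ⟨0, by omega⟩ ∪ C ⟨0, by omega⟩ := Or.inl (Or.inr hb₀)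
    have hb₀a : b₀ ∉ closedNbhd G a := fun e => by
      rcases mem_closedNbhd.1 e with e | e
      · exact hs.apex_ne hb₀V e.symm
      · exact hs.notMem_A (Or.inl hb₀) ((hs.apex_adj hb₀V).1 e)
    have hb₀F : b₀ ∈ F := Joined.induct (hconn.2 w hw b₀ hb₀a) (· ∈ F) (fun p _ y hy e hp => by
      refine hFcl p hp y (fun hy' => hy'.elim (fun hyV => ?_) hy) e
      rcases mem_PSSVerts.1 hyV with rfl | ⟨i, hyi⟩
      · exact hy (mem_closedNbhd.2 (Or.inl rfl))
      · exact hc p hp i y (hFB p hp i y hyi e) e) hwF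
    exact Outside.notMem (hFO hb₀F) _ hb₀V
  obtain ⟨t, q, S, n, s, hS, ht, hq, hX, hY⟩ := (hFj u hu).exists_linking (fun u => G.Adj v u)
    (fun u => ∃ i, ∃ b ∈ B i, G.Adj u b) hvw ⟨i, b, hb, hub⟩
  refine ⟨t, q, S, n, s, hS.trans hFO, ht, hX, hq, fun u hu i x hx e => ?_⟩
  have hxB := hFB u (hS hu) i x hx e
  exact ⟨hY u hu ⟨i, x, hxB, e⟩, hxB⟩

namespace OuterPath

variable {t q x y b x' y' : V} {S R R' : Set V} {n m m' : ℕ}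

theorem start (P : OuterPath G a A B C v t q S n) (hav : G.Adj a v) : Link G {v} S v t := by
  refine ⟨P.adj, ?_⟩
  rintro _ rfl u hu
  exact ⟨fun e => notMem_outside_of_adj hav (e ▸ P.sub hu), fun e => ⟨rfl, P.first u hu e⟩⟩

theorem link_rung (P : OuterPath G a A B C v t q S n) (hs : IsPyramidStripSystem G a A B C)
    (r : Rung G (A i) (B i) (C i) x y R m) (hy : G.Adj q y) : Link G S R q y := by
  refine ⟨hy, fun u hu w hw => ⟨Outside.ne (P.sub hu) (r.sub hw), fun e => ?_⟩⟩
  have := P.last u hu i w (r.sub hw) e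
  exact ⟨this.1, hs.eq_right r hw this.2⟩

theorem ac_rung (P : OuterPath G a A B C v t q S n) (hs : IsPyramidStripSystem G a A B C)
    (r : Rung G (A i) (B i) (C i) x y R m) (hy : ¬ G.Adj q y) : AC G S R := by
  refine fun u hu w hw => ⟨Outside.ne (P.sub hu) (r.sub hw), fun e => ?_⟩
  have := P.last u hu i w (r.sub hw) e
  obtain rfl := hs.eq_right r hw this.2
  exact hy (this.1 ▸ e)

theorem link_base (P : OuterPath G a A B C v t q S n) (hb : b ∈ B i) (hqb : G.Adj q b) :
    Link G S {b} q b := by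
  refine ⟨hqb, ?_⟩
  rintro u hu b rfl
  have hV : b ∈ A i ∪ B i ∪ C i := Or.inl (Or.inr hb)
  exact ⟨Outside.ne (P.sub hu) hV, fun e => ⟨(P.last u hu i b hV e).1, rfl⟩⟩

theorem ac_base (P : OuterPath G a A B C v t q S n) (hb : b ∈ B i) (hqb : ¬ G.Adj q b) :
    AC G S {b} := by
  rintro u hu b rfl
  have hV : b ∈ A i ∪ B i ∪ C i := Or.inl (Or.inr hb)
  exact ⟨Outside.ne (P.sub hu) hV, fun e => hqb ((P.last u hu i b hV e).1 ▸ e)⟩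

end OuterPath

theorem ac_apex_base (hs : IsPyramidStripSystem G a A B C) {b : V} (hb : b ∈ B i) :
    AC G {a} {b} := by
  rintro _ rfl b rfl
  have hV : b ∈ A i ∪ B i ∪ C i := Or.inl (Or.inr hb)
  exact ⟨hs.apex_ne hV, fun e => hs.notMem_A (Or.inl hb) ((hs.apex_adj hV).1 e)⟩

theorem ac_single_base (hv : v ∉ PSSVerts a A B C) {b : V} (hb : b ∈ B i) (hvb : ¬ G.Adj v b) :
    AC G {v} {b} := by
  rintro _ rfl _ rfl
  exact ⟨fun e => hv (mem_PSSVerts.2 (Or.inr ⟨i, e ▸ Or.inl (Or.inr hb)⟩)), hvb⟩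

theorem IsPyramidStripSystem.link_base_rung (hs : IsPyramidStripSystem G a A B C)
    {b x y : V} {R : Set V} {m : ℕ} (hb : b ∈ B i) (r : Rung G (A j) (B j) (C j) x y R m)
    (hij : i ≠ j) : Link G {b} R b y := by
  obtain ⟨x', R', m', r'⟩ := hs.rung_to hb
  exact (hs.link r' r hij).mono (Set.singleton_subset_iff.2 r'.seg.right_mem) subset_rfl

namespace OuterPath

variable {t q x y b x' y' : V} {S R R' : Set V} {n m m' : ℕ}

theorem adj_iff_even (P : OuterPath G a A B C v t q S n) (H : MaximalSystem G a A B C)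
    (hav : G.Adj a v) (hv : v ∉ PSSVerts a A B C) (hBC : ∀ l, ∀ w ∈ B l ∪ C l, ¬ G.Adj v w)
    (r : Rung G (A i) (B i) (C i) x y R m) (hy : G.Adj q y) : G.Adj v x ↔ (n + m) % 2 = 0 := by
  have := H.sys.two_le r
  have := P.seg.pos
  by_cases hx : G.Adj v x
  · have := hole3 H.evenHoleFree (Seg.single v) P.seg r.seg.reverse (P.start hav)
      (P.link_rung H.sys r hy) (MaximalSystem.link_rung hv r hx (hBC i)).symm (by omega)
    simp only [hx, true_iff]
    omega
  · have := hole4 H.evenHoleFree (Seg.single a) (Seg.single v) P.seg r.seg.reverse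
      (link_single hav) (P.start hav) (P.link_rung H.sys r hy) (H.sys.apex r).symm
      (ac_apex P.sub) (MaximalSystem.ac_rung hv r hx (hBC i))
    simp only [hx, false_iff]
    omega

theorem adj_iff_odd (P : OuterPath G a A B C v t q S n) (H : MaximalSystem G a A B C)
    (hav : G.Adj a v) (hv : v ∉ PSSVerts a A B C) (hBC : ∀ l, ∀ w ∈ B l ∪ C l, ¬ G.Adj v w)
    (r : Rung G (A i) (B i) (C i) x y R m) (hy : ¬ G.Adj q y) (hb : b ∈ B j) (hij : i ≠ j)
    (hqb : G.Adj q b) : G.Adj v x ↔ (n + m) % 2 = 1 := by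
  have hvb := ac_single_base hv hb (hBC j b (Or.inl hb))
  by_cases hx : G.Adj v x
  · have := hole4 H.evenHoleFree (Seg.single v) P.seg (Seg.single b) r.seg.reverse
      (P.start hav) (P.link_base hb hqb) (H.sys.link_base_rung hb r hij.symm)
      (MaximalSystem.link_rung hv r hx (hBC i)).symm hvb (P.ac_rung H.sys r hy)
    simp only [hx, true_iff]
    omega
  · have := hole5 H.evenHoleFree (Seg.single a) (Seg.single v) P.seg (Seg.single b) r.seg.reverse
      (link_single hav) (P.start hav) (P.link_base hb hqb) (H.sys.link_base_rung hb r hij.symm)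
      (H.sys.apex r).symm (ac_apex P.sub) (ac_apex_base H.sys hb) hvb
      (MaximalSystem.ac_rung hv r hx (hBC i)) (P.ac_rung H.sys r hy)
    simp only [hx, false_iff]
    omega

theorem typeGamma (P : OuterPath G a A B C v t q S n) (hav : G.Adj a v)
    (hno : ∀ l, ∀ w ∈ B l ∪ C l ∪ PSSD G a A B C l, ¬ G.Adj v w) (i : Fin k)
    (hA : ∀ j ≠ i, ∀ p ∈ A j, G.Adj v p)
    (hq : (∀ j ≠ i, ∀ p ∈ B j, G.Adj q p) ∨ ∀ j ≠ i, ∀ p ∈ B j, ¬ G.Adj q p) :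
    TypeGamma G a A B C v := by
  obtain ⟨Q, hQ, hsupp, -, hind⟩ := ((Seg.single v).append P.seg (P.start hav)).toWalk
  have hmem : ∀ w ∈ Q.support, w ≠ v → w ∈ S := fun w hw hwv =>
    ((hsupp w).1 hw).resolve_left hwv
  have hB : ∀ p ∈ (⋃ j, B j) \ B i, ∃ j, j ≠ i ∧ p ∈ B j := by
    rintro p ⟨hp, hpi⟩
    obtain ⟨j, hj⟩ := Set.mem_iUnion.1 hp
    exact ⟨j, fun e => hpi (e ▸ hj), hj⟩
  obtain ⟨l, b, hb, hqb⟩ := P.base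
  refine ⟨i, q, Q, hQ, hind, fun w hw hwv => P.sub (hmem w hw hwv),
    ⟨b, Set.mem_iUnion.2 ⟨l, hb⟩, hqb⟩, ?_, hA, hno, fun w hw hwv p hp e => ?_⟩
  · refine hq.imp (fun hq p hp => ?_) (fun hq p hp => ?_) <;>
    · obtain ⟨j, hj, hpj⟩ := hB p hp
      exact hq j hj p hpj
  · have hwS := hmem w hw hwv
    rcases mem_PSSVerts.1 hp with rfl | ⟨j, hj⟩
    · exact ((ac_apex P.sub p rfl w hwS).2 e.symm).elim
    · have := P.last w hwS j p hj e
      exact ⟨this.1, Set.mem_iUnion.2 ⟨j, this.2⟩⟩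

end OuterPath

end OuterPaths

section OuterTypes

variable {G : SimpleGraph V} {a : V} {k : ℕ} {A B C : Fin k → Set V} {v t q : V} {S : Set V}
  {n : ℕ} {i j h : Fin k}

namespace OuterPath

theorem walk_sub (P : OuterPath G a A B C v t q S n) (hv : v ∉ PSSVerts a A B C) :
    ∀ w ∈ {v} ∪ S, w ∉ PSSVerts a A B C := by
  rintro w (rfl | hw)
  · exact hv
  · exact fun hw' => P.sub hw (Or.inl hw')

/-- In the even case, there are not two strips whose ends in `B` are all nonadjacent to `q`. -/
theorem no_two_null (P : OuterPath G a A B C v t q S n) (H : MaximalSystem G a A B C)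
    (hav : G.Adj a v) (hv : v ∉ PSSVerts a A B C) (hBC : ∀ l, ∀ w ∈ B l ∪ C l, ¬ G.Adj v w)
    (heven : ∀ i x y R m, Rung G (A i) (B i) (C i) x y R m → (n + m) % 2 = 0) (hij : i ≠ j)
    (hi : ∀ b ∈ B i, ¬ G.Adj q b) (hj : ∀ b ∈ B j, ¬ G.Adj q b) : False := by
  have hs := H.sys
  set K : Set (Fin k) := {l | ∀ b ∈ B l, ¬ G.Adj q b} with hK
  obtain ⟨l₀, b₀, hb₀, hqb₀⟩ := P.base
  have hl₀ : l₀ ∉ K := fun e => e b₀ hb₀ hqb₀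
  have hstart := P.start hav
  have hr : Rung G ((⋃ l ∈ Kᶜ, A l) ∪ {v}) ((⋃ l ∈ Kᶜ, B l) ∪ ∅) ((⋃ l ∈ Kᶜ, C l) ∪ S) v b₀
      ({v} ∪ S ∪ {b₀}) (1 + n + 1) := by
    refine ⟨((Seg.single v).append P.seg hstart).append (Seg.single b₀)
      ((P.link_base hb₀ hqb₀).union_left' (ac_single_base hv hb₀ (hBC l₀ b₀ (Or.inl hb₀)))),
      Or.inr rfl, Or.inl (Set.mem_biUnion hl₀ hb₀), ?_⟩
    rintro w ((hw | hw) | hw) hwv hwb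
    · exact (hwv hw).elim
    · exact Or.inr hw
    · exact (hwb hw).elim
  have hvM : v ∈ ((⋃ l ∈ Kᶜ, A l) ∪ {v}) ∪ ((⋃ l ∈ Kᶜ, C l) ∪ S) := Or.inl (Or.inr rfl)
  have := hs.no_merge H.connected H.maximal K hi hj hij
    (XA := {v}) (XB := ∅) (XC := S) rfl rfl rfl ?_ ?_ ?_ (by simp) ?_ (by simp) ?_ v ?_ ?_
  · exact Set.notMem_empty v (this ▸ Or.inl (Or.inl rfl))
  · rintro w rfl
    exact hav
  · rintro w (hw | hw)
    · exact hw.elim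
    · exact (ac_apex P.sub a rfl w hw).2
  · rw [Set.union_empty]
    exact P.walk_sub hv
  · rintro l hl w (rfl | hw) u hu e
    · by_cases hu' : u ∈ B l ∪ C l
      · exact hBC l u hu' e
      · have huA : u ∈ A l := by
          simp only [Set.mem_union] at hu hu'
          tauto
        obtain ⟨y, R, m, r⟩ := hs.rung_from huA
        have := (P.adj_iff_odd H hav hv hBC r (hl y r.right) hb₀ (fun e' => hl₀ (e' ▸ hl))
          hqb₀).1 e
        have := heven _ _ _ _ _ r
        omega
    · have := P.last w hw l u hu e
      exact hl u this.2 (this.1 ▸ e)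
  · rw [Set.union_empty]
    exact fun w hw => ⟨_, _, _, _, hr, Or.inl hw⟩
  · intro l hl
    simp only [hK, Set.mem_ofPred_eq, not_forall, not_not] at hl
    obtain ⟨b, hb, hqb⟩ := hl
    obtain ⟨x, R, m, r⟩ := hs.rung_to hb
    refine ⟨x, Or.inl r.left, Joined.of_adj hvM ?_
      ((P.adj_iff_even H hav hv hBC r hqb).2 (heven _ _ _ _ _ r))⟩
    exact Or.inl (Or.inl (Set.mem_biUnion (fun e => e b hb hqb : l ∈ Kᶜ) r.left))
  · intro w hw
    refine (((Seg.single v).append P.seg hstart).joined hw).mono ?_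
    rintro u (hu | hu)
    · exact Or.inl (Or.inr hu)
    · exact Or.inr (Or.inr hu)

/-- In the odd case, there are not two strips whose ends in `B` are all adjacent to `q`. -/
theorem no_two_full (P : OuterPath G a A B C v t q S n) (H : MaximalSystem G a A B C)
    (hav : G.Adj a v) (hv : v ∉ PSSVerts a A B C) (hBC : ∀ l, ∀ w ∈ B l ∪ C l, ¬ G.Adj v w)
    (hodd : ∀ i x y R m, Rung G (A i) (B i) (C i) x y R m → (n + m) % 2 = 1) (hij : i ≠ j)
    (hi : ∀ b ∈ B i, G.Adj q b) (hj : ∀ b ∈ B j, G.Adj q b) : False := by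
  have hs := H.sys
  set K : Set (Fin k) := {l | ∀ b ∈ B l, G.Adj q b} with hK
  have hstart := P.start hav
  have hqv : q ≠ v := (hstart.2 v rfl q P.seg.right_mem).1.symm
  have hseg := (Seg.single v).append P.seg hstart
  have huniv : {v} ∪ {q} ∪ S \ {q} = {v} ∪ S := by
    rw [Set.union_assoc, Set.singleton_union (a := q), Set.insert_sdiff_singleton,
      Set.insert_eq_of_mem P.seg.right_mem]
  have hr : Rung G ((⋃ l ∈ Kᶜ, A l) ∪ {v}) ((⋃ l ∈ Kᶜ, B l) ∪ {q}) ((⋃ l ∈ Kᶜ, C l) ∪ S \ {q}) v q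
      ({v} ∪ S) (1 + n) := by
    refine ⟨hseg, Or.inr rfl, Or.inr rfl, ?_⟩
    rintro w (hw | hw) hwv hwb
    · exact (hwv hw).elim
    · exact Or.inr ⟨hw, hwb⟩
  have hvM : v ∈ ((⋃ l ∈ Kᶜ, A l) ∪ {v}) ∪ ((⋃ l ∈ Kᶜ, C l) ∪ S \ {q}) := Or.inl (Or.inr rfl)
  have := hs.no_merge H.connected H.maximal K hi hj hij (XA := {v}) (XB := {q}) (XC := S \ {q})
    rfl rfl rfl ?_ ?_ ?_ Set.disjoint_sdiff_right ?_ ?_ ?_ v ?_ ?_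
  · exact Set.notMem_empty v (this ▸ Or.inl (Or.inl rfl))
  · rintro w rfl
    exact hav
  · rintro w (rfl | hw)
    · exact (ac_apex P.sub a rfl w P.seg.right_mem).2
    · exact (ac_apex P.sub a rfl w hw.1).2
  · rw [huniv]
    exact P.walk_sub hv
  · rintro l hl w (rfl | hw) u hu e
    · by_cases hu' : u ∈ B l ∪ C l
      · exact hBC l u hu' e
      · have huA : u ∈ A l := by
          simp only [Set.mem_union] at hu hu'
          tauto
        obtain ⟨y, R, m, r⟩ := hs.rung_from huA
        have := (P.adj_iff_even H hav hv hBC r (hl y r.right)).1 e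
        have := hodd _ _ _ _ _ r
        omega
    · exact hw.2 (P.last w hw.1 l u hu e).1
  · rintro l hl w rfl u hu
    exact ⟨fun e => (P.last w P.seg.right_mem l u hu e).2, hl u⟩
  · rw [huniv]
    exact fun w hw => ⟨_, _, _, _, hr, hw⟩
  · intro l hl
    have hil : l ≠ i := fun e => hl (e ▸ hi)
    simp only [hK, Set.mem_ofPred_eq, not_forall] at hl
    obtain ⟨b, hb, hqb⟩ := hl
    obtain ⟨b', hb'⟩ := (hs.2.1 i).2.1
    obtain ⟨x, R, m, r⟩ := hs.rung_to hb
    refine ⟨x, Or.inl r.left, Joined.of_adj hvM ?_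
      ((P.adj_iff_odd H hav hv hBC r hqb hb' hil (hi b' hb')).2 (hodd _ _ _ _ _ r))⟩
    exact Or.inl (Or.inl (Set.mem_biUnion (fun e => hqb (e b hb) : l ∈ Kᶜ) r.left))
  · intro w hw
    have hwq : w ≠ q := by
      rcases hw with rfl | hw
      · exact hqv.symm
      · exact hw.2
    refine (hseg.joined_diff (hw.imp id fun hw => hw.1) hwq).mono ?_
    rintro u ⟨hu | hu, huq⟩
    · exact Or.inl (Or.inr hu)
    · exact Or.inr (Or.inr ⟨hu, huq⟩)

/-- The even case. -/
theorem type_of_even (P : OuterPath G a A B C v t q S n) (H : MaximalSystem G a A B C)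
    (hav : G.Adj a v) (hv : v ∉ PSSVerts a A B C)
    (hno : ∀ l, ∀ w ∈ B l ∪ C l ∪ PSSD G a A B C l, ¬ G.Adj v w)
    (heven : ∀ i x y R m, Rung G (A i) (B i) (C i) x y R m → (n + m) % 2 = 0) :
    TypeAlpha G A B C v ∨ TypeGamma G a A B C v := by
  have hs := H.sys
  have hBC : ∀ l, ∀ w ∈ B l ∪ C l, ¬ G.Adj v w := fun l w hw => hno l w (Or.inl hw)
  have hnull : ∀ {i j}, i ≠ j → (∀ b ∈ B i, ¬ G.Adj q b) → ∃ b ∈ B j, G.Adj q b := by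
    intro i j hij hi
    by_contra! hj
    exact P.no_two_null H hav hv hBC heven hij hi hj
  have hMN : ∀ i x y R m, Rung G (A i) (B i) (C i) x y R m → (G.Adj v x ↔ G.Adj q y) := by
    intro i x y R m r
    have he := heven _ _ _ _ _ r
    by_cases hy : G.Adj q y
    · simp [hy, P.adj_iff_even H hav hv hBC r hy, he]
    · obtain ⟨j, hji, -⟩ := exists_ne_ne hs.1 i i
      obtain ⟨l, hli, hlj⟩ := exists_ne_ne hs.1 i j
      obtain ⟨g, b, hb, hig, hqb⟩ : ∃ g, ∃ b ∈ B g, i ≠ g ∧ G.Adj q b := by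
        by_cases hj : ∀ b ∈ B j, ¬ G.Adj q b
        · obtain ⟨b, hb, hqb⟩ := hnull hlj.symm hj
          exact ⟨l, b, hb, hli.symm, hqb⟩
        · push Not at hj
          obtain ⟨b, hb, hqb⟩ := hj
          exact ⟨j, b, hb, hji.symm, hqb⟩
      simp [hy, P.adj_iff_odd H hav hv hBC r hy hb hig hqb, he]
  have hmix : ∀ {i h}, i ≠ h → (∃ b ∈ B i, G.Adj q b) → (∃ x ∈ A i, ¬ G.Adj v x) →
      (∃ x ∈ A h, ¬ G.Adj v x) → False := by
    rintro i h hih ⟨b, hb, hqb⟩ ⟨x, hx, hvx⟩ ⟨x', hx', hvx'⟩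
    obtain ⟨x₀, R₀, m₀, r₀⟩ := hs.rung_to hb
    obtain ⟨y', R', m', r'⟩ := hs.rung_from hx'
    obtain ⟨x₁, y₁, R₁, m₁, x₂, y₂, R₂, m₂, r₁, r₂, hx₁, hx₂, hl⟩ := hs.exists_mixed_rungs
      H.evenHoleFree (H.connected i) (hMN i) r₀.left ((hMN _ _ _ _ _ r₀).2 hqb) hx hvx
    have hy₁ := (hMN _ _ _ _ _ r₁).1 hx₁
    have hy₂ : ¬ G.Adj q y₂ := fun e => hx₂ ((hMN _ _ _ _ _ r₂).2 e)
    have hy' : ¬ G.Adj q y' := fun e => hvx' ((hMN _ _ _ _ _ r').2 e)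
    have := hole6 H.evenHoleFree (Seg.single a) (Seg.single v) P.seg (Seg.single y₁)
      (Seg.single y') r₂.seg.reverse (link_single hav) (P.start hav) (P.link_base r₁.right hy₁)
      (link_single (hs.link_base_rung r₁.right r' hih).1) (hs.link_base_rung r'.right r₂ hih.symm)
      (hs.apex r₂).symm (ac_apex P.sub) (ac_apex_base hs r₁.right) (ac_apex_base hs r'.right)
      (ac_single_base hv r₁.right (hBC i y₁ (Or.inl r₁.right)))
      (ac_single_base hv r'.right (hBC h y' (Or.inl r'.right)))
      (MaximalSystem.ac_rung hv r₂ hx₂ (hBC i)) (P.ac_base r'.right hy') (P.ac_rung hs r₂ hy₂)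
      (hl.ac_left (Set.singleton_subset_iff.2 r₁.seg.right_mem) subset_rfl (hs.ne r₁))
    have := heven _ _ _ _ _ r₂
    omega
  by_cases hα : ∀ i, ∀ x ∈ A i, G.Adj v x
  · exact Or.inl fun i => Or.inr (hα i)
  push Not at hα
  obtain ⟨i, hi⟩ := hα
  have hA : ∀ j ≠ i, ∀ p ∈ A j, G.Adj v p := by
    intro j hji
    by_contra! hj
    by_cases hin : ∀ b ∈ B i, ¬ G.Adj q b
    · exact hmix hji (hnull hji.symm hin) hj hi
    · push Not at hin
      exact hmix hji.symm hin hi hj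
  refine Or.inr (P.typeGamma hav hno i hA (Or.inl fun j hj p hp => ?_))
  obtain ⟨x, R, m, r⟩ := hs.rung_to hp
  exact (hMN _ _ _ _ _ r).1 (hA j hj x r.left)

/-- The odd case. -/
theorem type_of_odd (P : OuterPath G a A B C v t q S n) (H : MaximalSystem G a A B C)
    (hav : G.Adj a v) (hv : v ∉ PSSVerts a A B C)
    (hno : ∀ l, ∀ w ∈ B l ∪ C l ∪ PSSD G a A B C l, ¬ G.Adj v w)
    (hodd : ∀ i x y R m, Rung G (A i) (B i) (C i) x y R m → (n + m) % 2 = 1) :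
    TypeGamma G a A B C v := by
  have hs := H.sys
  have hBC : ∀ l, ∀ w ∈ B l ∪ C l, ¬ G.Adj v w := fun l w hw => hno l w (Or.inl hw)
  have hfull : ∀ {i j}, i ≠ j → (∀ b ∈ B i, G.Adj q b) → ∃ b ∈ B j, ¬ G.Adj q b := by
    intro i j hij hi
    by_contra! hj
    exact P.no_two_full H hav hv hBC hodd hij hi hj
  obtain ⟨i, b, hb, hqb⟩ := P.base
  by_cases hone : ∀ j ≠ i, ∀ p ∈ B j, ¬ G.Adj q p
  · refine P.typeGamma hav hno i (fun j hj p hp => ?_) (Or.inr hone)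
    obtain ⟨y, R, m, r⟩ := hs.rung_from hp
    exact (P.adj_iff_odd H hav hv hBC r (hone j hj y r.right) hb hj hqb).2 (hodd _ _ _ _ _ r)
  push Not at hone
  obtain ⟨j, hji, b', hb', hqb'⟩ := hone
  exfalso
  have hMN : ∀ l x y R m, Rung G (A l) (B l) (C l) x y R m → (G.Adj v x ↔ ¬ G.Adj q y) := by
    intro l x y R m r
    have ho := hodd _ _ _ _ _ r
    by_cases hy : G.Adj q y
    · simp [hy, P.adj_iff_even H hav hv hBC r hy, ho]
    · by_cases hl : l = i
      · simp [hy, P.adj_iff_odd H hav hv hBC r hy hb' (hl ▸ hji.symm) hqb', ho]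
      · simp [hy, P.adj_iff_odd H hav hv hBC r hy hb hl hqb, ho]
  have hmix : ∀ {i}, (∃ b ∈ B i, G.Adj q b) → (∃ b ∈ B i, ¬ G.Adj q b) → False := by
    rintro i ⟨b, hb, hqb⟩ ⟨b', hb', hqb'⟩
    obtain ⟨g, c, hc, hig, hqc⟩ : ∃ g, ∃ c ∈ B g, i ≠ g ∧ ¬ G.Adj q c := by
      obtain ⟨j, hji, -⟩ := exists_ne_ne hs.1 i i
      obtain ⟨l, hli, hlj⟩ := exists_ne_ne hs.1 i j
      by_cases hj : ∀ b ∈ B j, G.Adj q b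
      · obtain ⟨c, hc, hqc⟩ := hfull hlj.symm hj
        exact ⟨l, c, hc, hli.symm, hqc⟩
      · push Not at hj
        obtain ⟨c, hc, hqc⟩ := hj
        exact ⟨j, c, hc, hji.symm, hqc⟩
    obtain ⟨x, R, m, r⟩ := hs.rung_to hb
    obtain ⟨x', R', m', r'⟩ := hs.rung_to hb'
    obtain ⟨x₁, y₁, R₁, m₁, x₂, y₂, R₂, m₂, r₁, r₂, hx₁, hx₂, hl⟩ := hs.exists_mixed_rungs
      H.evenHoleFree (H.connected i) (hMN i) r'.left ((hMN _ _ _ _ _ r').2 hqb') r.left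
      fun e => (hMN _ _ _ _ _ r).1 e hqb
    have hy₁ := (hMN _ _ _ _ _ r₁).1 hx₁
    have hy₂ : G.Adj q y₂ := by
      by_contra e
      exact hx₂ ((hMN _ _ _ _ _ r₂).2 e)
    have := hole5 H.evenHoleFree (Seg.single v) r₁.seg (Seg.single c) (Seg.single y₂)
      P.seg.reverse (MaximalSystem.link_rung hv r₁ hx₁ (hBC i))
      (hs.link_base_rung hc r₁ hig.symm).symm
      (link_single (hs.link_base_rung hc r₂ hig.symm).1) (P.link_base r₂.right hy₂).symm
      (P.start hav).symm (ac_single_base hv hc (hBC g c (Or.inl hc)))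
      (ac_single_base hv r₂.right (hBC i y₂ (Or.inl r₂.right)))
      (hl.ac_right subset_rfl (Set.singleton_subset_iff.2 r₂.seg.right_mem) (hs.ne r₂))
      (P.ac_rung hs r₁ hy₁).symm (P.ac_base hc hqc).symm
    have := hodd _ _ _ _ _ r₁
    omega
  by_cases hi : ∀ b ∈ B i, G.Adj q b
  · exact hmix ⟨b', hb', hqb'⟩ (hfull hji.symm hi)
  · push Not at hi
    exact hmix ⟨b, hb, hqb⟩ hi

/-- A vertex of `N(a)` with no neighbour in any `B i ∪ C i ∪ D i` has type `α` or `γ`. -/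
theorem typeAlpha_or_typeGamma (P : OuterPath G a A B C v t q S n) (H : MaximalSystem G a A B C)
    (hav : G.Adj a v) (hv : v ∉ PSSVerts a A B C)
    (hno : ∀ l, ∀ w ∈ B l ∪ C l ∪ PSSD G a A B C l, ¬ G.Adj v w) :
    TypeAlpha G A B C v ∨ TypeGamma G a A B C v := by
  obtain ⟨i, -⟩ := P.base
  obtain ⟨x₀, y₀, R₀, m₀, r₀⟩ := H.sys.rung i
  have hpar : ∀ i x y R m, Rung G (A i) (B i) (C i) x y R m → m % 2 = m₀ % 2 :=
    fun i x y R m r => H.sys.parity H.evenHoleFree r r₀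
  rcases Nat.mod_two_eq_zero_or_one (n + m₀) with he | ho
  · refine P.type_of_even H hav hv hno fun i x y R m r => ?_
    have := hpar i x y R m r
    omega
  · refine Or.inr (P.type_of_odd H hav hv hno fun i x y R m r => ?_)
    have := hpar i x y R m r
    omega

end OuterPath

end OuterTypes

theorem statement_16 {V : Type*} [Fintype V] (G : SimpleGraph V)
    (hG : EvenHoleFree G)
    (a : V) (hsp : Splendid G a) (hnx : ¬ ExtNearPrismCrossEnd G a)
    (k : ℕ) (A B C : Fin k → Set V)
    (hsys : IsPyramidStripSystem G a A B C)
    (hidc : ∀ i, ConnectedSubset G (A i ∪ C i))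
    (hmax : ∀ (k' : ℕ) (A' B' C' : Fin k' → Set V),
      IsPyramidStripSystem G a A' B' C' →
      (∀ i, ConnectedSubset G (A' i ∪ C' i)) →
      PSSVerts a A B C ⊆ PSSVerts a A' B' C' →
      PSSVerts a A' B' C' = PSSVerts a A B C) :
    ∀ v ∈ closedNbhd G a \ PSSVerts a A B C,
      TypeAlpha G A B C v ∨ TypeAlpha' G a A B C v ∨ TypeBeta G A B C v ∨
        TypeGamma G a A B C v := by
  rintro v ⟨hva, hv⟩
  have H : MaximalSystem G a A B C := ⟨hG, hnx, hsys, hidc, hmax⟩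
  have hav : G.Adj a v := (mem_closedNbhd.1 hva).resolve_left fun e =>
    hv (mem_PSSVerts.2 (Or.inl e))
  by_cases hh : ∃ h, ∃ w ∈ B h ∪ C h ∪ PSSD G a A B C h, G.Adj v w
  · rcases H.type_of_hit hsp.1 hav hv hh with h | h | h
    · exact Or.inl h
    · exact Or.inr (Or.inl h)
    · exact Or.inr (Or.inr (Or.inl h))
  · push Not at hh
    obtain ⟨w, hw, hvw⟩ := hsp.2.1 v hav
    obtain ⟨t, q, S, n, P⟩ := H.exists_outerPath hsp.1 hh hw hvw
    rcases P.typeAlpha_or_typeGamma H hav hv hh with h | h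
    · exact Or.inl h
    · exact Or.inr (Or.inr (Or.inr h))

end EHF
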